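/- There exists a constant μ₀ > 0 such that for every α with 1/2 ≤ α < 3/5 there is a constant A > 0 with the following property: for every K > 0 there exists n₀ such that for all integers n ≥ n₀ and m, setting d = 2m/n and μ = d/(n−1), if (log n)^K / n ≤ μ ≤ μ₀, then for every sequence d = (d_1,…,d_n) of nonnegative integers with Σ_{i} d_i = 2m and |d_i − d| ≤ d^α for all i ∈ [n], one has Pr_{D(G(n,m))}(d) = Pr_{B_m}(d) · exp(1/4 − γ₂²/(4μ²(1−μ)²)) · (1 + E) with |E| ≤ A·( (log n)²/√n + d^{5α−3} ). -/

import Mathlib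

open Finset

noncomputable section

/-- Simple graphs on vertex set `[n]`, encoded as finsets of non-diagonal unordered pairs. -/
def Graphs (n : ℕ) : Finset (Finset (Sym2 (Fin n))) :=
  Finset.univ.filter (fun E => ∀ e ∈ E, ¬ e.IsDiag)

/-- Degree of vertex `i` in the graph `E`. -/
def deg {n : ℕ} (E : Finset (Sym2 (Fin n))) (i : Fin n) : ℕ :=
  (E.filter (fun e => i ∈ e)).card

/-- `Pr_{D(G(n,m))}(D)`: probability that a uniformly random graph on `[n]` with exactly `m`
edges has degree sequence `D`. -/
def prG (n m : ℕ) (D : Fin n → ℕ) : ℝ :=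
  (((Graphs n).filter (fun E => E.card = m ∧ ∀ i, deg E i = D i)).card : ℝ) /
    (((Graphs n).filter (fun E => E.card = m)).card : ℝ)

/-- `Pr_{B_m}(D)`: probability of `D` for `n` independent `Bin(n-1,p)` variables conditioned
on the sum being `2m` (independent of `p`). -/
def prB (n m : ℕ) (D : Fin n → ℕ) : ℝ :=
  if ∑ i, D i = 2 * m then
    (∏ i, ((n - 1).choose (D i) : ℝ)) / ((n * (n - 1)).choose (2 * m) : ℝ)
  else 0

lemma mL {a b c : ℝ} : b ≤ c → 0 ≤ a → a * b ≤ a * c := mul_le_mul_of_nonneg_left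
lemma mR {a b c : ℝ} : b ≤ c → 0 ≤ a → b * a ≤ c * a := mul_le_mul_of_nonneg_right

def ee {n : ℕ} (a : Fin n) : Fin n → ℤ := Pi.single a 1

lemma ee_apply {n : ℕ} (a i : Fin n) : ee a i = if i = a then 1 else 0 := by
  simp [ee, Pi.single_apply]

/-- number of graphs with degree sequence `D` and property `Q` -/
def cnt {n : ℕ} (D : Fin n → ℤ) (Q : Finset (Sym2 (Fin n)) → Prop) : ℕ := by
  classical exact ((Graphs n).filter (fun E => (∀ i, (deg E i : ℤ) = D i) ∧ Q E)).card

lemma cnt_def {n : ℕ} (D : Fin n → ℤ) (Q : Finset (Sym2 (Fin n)) → Prop) [DecidablePred Q] :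
    cnt D Q = ((Graphs n).filter (fun E => (∀ i, (deg E i : ℤ) = D i) ∧ Q E)).card := by
  unfold cnt; congr

lemma cnt_congr {n : ℕ} (D : Fin n → ℤ) {Q Q' : Finset (Sym2 (Fin n)) → Prop}
    (h : ∀ E, Q E ↔ Q' E) : cnt D Q = cnt D Q' := by
  have : Q = Q' := funext fun E => propext (h E)
  rw [this]

lemma cnt_split {n : ℕ} (D : Fin n → ℤ) (Q R : Finset (Sym2 (Fin n)) → Prop) :
    cnt D Q = cnt D (fun E => Q E ∧ R E) + cnt D (fun E => Q E ∧ ¬ R E) := by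
  classical
  simp only [cnt_def]
  rw [← card_filter_add_card_filter_not (p := R), filter_filter, filter_filter]
  simp only [and_assoc]

lemma mem_Graphs {n : ℕ} {E : Finset (Sym2 (Fin n))} : E ∈ Graphs n ↔ ∀ e ∈ E, ¬ e.IsDiag := by
  simp [Graphs]

lemma deg_insert {n : ℕ} {E : Finset (Sym2 (Fin n))} {a v : Fin n} (hav : a ≠ v)
    (h : s(a,v) ∉ E) (i : Fin n) : (deg (insert s(a,v) E) i : ℤ) = deg E i + ee a i + ee v i := by
  unfold deg
  rw [filter_insert]
  simp only [Sym2.mem_iff, ee_apply]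
  by_cases h1 : i = a
  · have : i ≠ v := fun h2 => hav (h1.symm.trans h2)
    simp [h1, hav, h]
  · by_cases h2 : i = v <;> simp [h1, h2, h, hav.symm]

lemma cnt_insert {n : ℕ} (D : Fin n → ℤ) {a v : Fin n} (hav : a ≠ v)
    (Q Q' : Finset (Sym2 (Fin n)) → Prop)
    (hQ : ∀ E, s(a,v) ∉ E → (Q (insert s(a,v) E) ↔ Q' E)) :
    cnt D (fun E => s(a,v) ∈ E ∧ Q E) = cnt (D - ee a - ee v) (fun E => s(a,v) ∉ E ∧ Q' E) := by
  classical
  simp only [cnt_def]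
  refine card_bij' (fun E _ => E.erase s(a,v)) (fun E _ => insert s(a,v) E) ?_ ?_ ?_ ?_
  · intro E hE
    simp only [mem_filter, mem_Graphs] at hE ⊢
    obtain ⟨h1, h2, h3, h4⟩ := hE
    have hni : s(a,v) ∉ E.erase s(a,v) := by simp
    have hins := insert_erase h3
    refine ⟨fun e he => h1 e (mem_of_mem_erase he), fun i => ?_, hni, ?_⟩
    · have := deg_insert hav hni i
      rw [hins, h2] at this
      simp only [Pi.sub_apply]; linarith
    · rw [← hQ _ hni, hins]; exact h4
  · intro E hE
    simp only [mem_filter, mem_Graphs] at hE ⊢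
    obtain ⟨h1, h2, h3, h4⟩ := hE
    refine ⟨?_, fun i => ?_, by simp, (hQ _ h3).2 h4⟩
    · intro e he
      rcases mem_insert.1 he with rfl | he
      · simpa using hav
      · exact h1 e he
    · rw [deg_insert hav h3 i, h2]; simp only [Pi.sub_apply]; ring
  · intro E hE
    simp only [mem_filter] at hE
    exact insert_erase hE.2.2.1
  · intro E hE
    simp only [mem_filter] at hE
    exact erase_insert hE.2.2.1

def NN {n : ℕ} (D : Fin n → ℤ) : ℕ := cnt D (fun _ => True)
def NE {n : ℕ} (D : Fin n → ℤ) (a v : Fin n) : ℕ := cnt D (fun E => s(a,v) ∈ E)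
def NEE {n : ℕ} (D : Fin n → ℤ) (a v b : Fin n) : ℕ :=
  cnt D (fun E => s(a,v) ∈ E ∧ s(b,v) ∈ E)

lemma NE_comm {n : ℕ} (D : Fin n → ℤ) (a v : Fin n) : NE D a v = NE D v a := by
  unfold NE; rw [Sym2.eq_swap]

lemma NEE_comm {n : ℕ} (D : Fin n → ℤ) (a v b : Fin n) : NEE D a v b = NEE D b v a := by
  unfold NEE; exact cnt_congr _ fun E => and_comm

lemma NEE_le {n : ℕ} (D : Fin n → ℤ) (a v b : Fin n) : NEE D a v b ≤ NE D a v := by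
  have := cnt_split D (fun E => s(a,v) ∈ E) (fun E => s(b,v) ∈ E)
  unfold NE NEE; omega

lemma NE_rec {n : ℕ} (D : Fin n → ℤ) {a v : Fin n} (hav : a ≠ v) :
    NE D a v + NE (D - ee a - ee v) a v = NN (D - ee a - ee v) := by
  have h1 := cnt_insert D hav (fun _ => True) (fun _ => True) (fun _ _ => Iff.rfl)
  have h2 := cnt_split (D - ee a - ee v) (fun _ => True) (fun E => s(a,v) ∈ E)
  simp only [true_and, and_true] at h1 h2
  unfold NE NN; omega

lemma sym2_ne {n : ℕ} {a b v : Fin n} (hab : a ≠ b) : s(b,v) ≠ s(a,v) := by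
  intro h
  rw [Sym2.eq_iff] at h
  rcases h with h | h
  · exact hab h.1.symm
  · exact hab (h.2 ▸ h.1.symm)

lemma NEE_rec {n : ℕ} (D : Fin n → ℤ) {a v b : Fin n} (hav : a ≠ v) (hab : a ≠ b) :
    NEE D a v b + NEE (D - ee a - ee v) a v b = NE (D - ee a - ee v) b v := by
  have h1 := cnt_insert D hav (fun E => s(b,v) ∈ E) (fun E => s(b,v) ∈ E)
    (fun E _ => by simp [sym2_ne hab])
  have h2 := cnt_split (D - ee a - ee v) (fun E => s(b,v) ∈ E) (fun E => s(a,v) ∈ E)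
  unfold NE NEE
  rw [h1, cnt_congr _ (fun E => and_comm), h2, add_comm]
  congr 1
  exact cnt_congr _ fun E => and_comm

lemma cnt_switch {n : ℕ} (D : Fin n → ℤ) {a v b : Fin n} (hav : a ≠ v) (hbv : b ≠ v)
    (hab : a ≠ b) :
    cnt (D - ee b) (fun E => s(a,v) ∈ E ∧ s(b,v) ∉ E) =
      cnt (D - ee a) (fun E => s(b,v) ∈ E ∧ s(a,v) ∉ E) := by
  rw [cnt_insert _ hav _ (fun E => s(b,v) ∉ E) (fun E _ => by simp [sym2_ne hab]),
    cnt_insert _ hbv _ (fun E => s(a,v) ∉ E) (fun E _ => by simp [sym2_ne hab.symm]),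
    show D - ee b - ee a - ee v = D - ee a - ee b - ee v by ring]
  exact cnt_congr _ fun E => and_comm

/-- neighbours -/
def nb {n : ℕ} (E : Finset (Sym2 (Fin n))) (a : Fin n) : Finset (Fin n) :=
  univ.filter (fun v => s(a,v) ∈ E)

lemma mem_nb {n : ℕ} {E : Finset (Sym2 (Fin n))} {a v : Fin n} : v ∈ nb E a ↔ s(a,v) ∈ E := by
  simp [nb]

lemma ne_of_mem_G {n : ℕ} {E : Finset (Sym2 (Fin n))} (hE : E ∈ Graphs n) {a v : Fin n}
    (h : s(a,v) ∈ E) : a ≠ v := by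
  have := mem_Graphs.1 hE _ h
  simpa using this

lemma card_nb {n : ℕ} (E : Finset (Sym2 (Fin n))) (a : Fin n) :
    (nb E a).card = deg E a := by
  unfold deg
  refine card_bij (fun v _ => s(a,v)) ?_ ?_ ?_
  · intro v hv; simp [mem_nb.1 hv]
  · intro v _ w _ h
    rcases (by simpa using h : v = w ∨ a = w ∧ v = a) with h | h
    · exact h
    · exact h.2.trans h.1
  · intro e he
    simp only [mem_filter] at he
    obtain ⟨v, rfl⟩ := he.2
    exact ⟨v, mem_nb.2 he.1, rfl⟩

lemma sum_NE {n : ℕ} (D : Fin n → ℤ) (a : Fin n) :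
    ∑ v ∈ univ.erase a, (NE D a v : ℤ) = D a * NN D := by
  classical
  have h0 : NE D a a =0 := by
    unfold NE; rw [cnt_def, card_eq_zero, filter_eq_empty_iff]
    intro E hE h
    exact ne_of_mem_G hE h.2 rfl
  have h1 : ∑ v ∈ univ.erase a, (NE D a v : ℤ) = ∑ v, (NE D a v : ℤ) := by
    rw [← add_sum_erase univ _ (mem_univ a), h0]; simp
  rw [h1]
  unfold NE NN
  simp only [cnt_def, card_filter, and_true]
  push_cast
  rw [sum_comm, mul_sum]
  refine sum_congr rfl fun E hE => ?_
  by_cases h : ∀ i, (deg E i : ℤ) = D i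
  · simp only [h, implies_true, true_and, if_true, mul_one]
    rw [← h a, ← card_nb E a, nb, card_filter]; push_cast; rfl
  · simp [h]

/-- degree switching identity -/
lemma bal {n : ℕ} (D : Fin n → ℤ) {a b : Fin n} (hab : a ≠ b) :
    (NN (D - ee b) : ℤ) * D a - NE (D - ee b) a b
        - ∑ v ∈ (univ.erase a).erase b, (NEE (D - ee b) a v b : ℤ) =
      (NN (D - ee a) : ℤ) * D b - NE (D - ee a) a b
        - ∑ v ∈ (univ.erase a).erase b, (NEE (D - ee a) a v b : ℤ) := by
  have key : ∀ (D' : Fin n → ℤ) (a b : Fin n), a ≠ b → (NN D' : ℤ) * D' a - NE D' a b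
        - ∑ v ∈ (univ.erase a).erase b, (NEE D' a v b : ℤ) =
        ∑ v ∈ (univ.erase a).erase b, (cnt D' (fun E => s(a,v) ∈ E ∧ s(b,v) ∉ E) : ℤ) := by
    intro D' a b hab
    have h := sum_NE D' a
    rw [← add_sum_erase _ _ (show b ∈ univ.erase a by simp [hab.symm])] at h
    rw [mul_comm, ← h, add_sub_cancel_left, ← sum_sub_distrib]
    refine sum_congr rfl fun v _ => ?_
    have := cnt_split D' (fun E => s(a,v) ∈ E) (fun E => s(b,v) ∈ E)
    unfold NE NEE; push_cast [this]; ring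
  have h1 := key (D - ee b) a b hab
  have h2 := key (D - ee a) b a hab.symm
  have e1 : (D - ee b) a = D a := by simp [ee_apply, hab]
  have e2 : (D - ee a) b = D b := by simp [ee_apply, hab.symm]
  rw [e1] at h1
  rw [e2, erase_right_comm] at h2
  simp only [NEE_comm (D - ee a) b, NE_comm (D - ee a) b] at h2
  rw [h1, h2]
  refine sum_congr rfl fun v hv => ?_
  simp only [mem_erase, mem_univ, and_true] at hv
  rw [cnt_switch D (Ne.symm hv.2) (Ne.symm hv.1) hab]

def prs {n : ℕ} (E : Finset (Sym2 (Fin n))) : Finset (Fin n × Fin n) :=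
  univ.filter (fun p => s(p.1,p.2) ∈ E)

def good {n : ℕ} (E : Finset (Sym2 (Fin n))) (u w : Fin n) : Finset (Fin n × Fin n) :=
  univ.filter (fun p => s(p.1,p.2) ∈ E ∧ p.1 ≠ u ∧ s(u,p.1) ∉ E ∧ p.2 ≠ w ∧ s(w,p.2) ∉ E)

lemma card_prs {n : ℕ} (E : Finset (Sym2 (Fin n))) : (prs E).card = ∑ i, deg E i := by
  classical
  simp only [← card_nb, prs, nb, card_filter]
  rw [← univ_product_univ, sum_product]

lemma sum_deg {n : ℕ} {E : Finset (Sym2 (Fin n))} (hE : E ∈ Graphs n) :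
    ∑ i, deg E i =2 * E.card := by
  classical
  simp only [deg, card_filter]
  rw [sum_comm, sum_const_nat (m := 2), mul_comm]
  intro e he
  have h := mem_Graphs.1 hE e he
  rw [← card_filter]
  induction e with
  | _ x y =>
    have hxy : x ≠ y := by simpa using h
    rw [show univ.filter (fun i => i ∈ s(x,y)) = {x, y} by ext i; simp]
    exact card_pair hxy

lemma card_good {n : ℕ} {E : Finset (Sym2 (Fin n))} (Δ : ℕ)
    (hΔ : ∀ i, deg E i ≤ Δ) (u w : Fin n) :
    ∑ i, deg E i ≤ (good E u w).card +2 * (Δ * (Δ +1)) := by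
  classical
  have key : ∀ u : Fin n, ((insert u (nb E u)).biUnion (fun x => (nb E x).image (fun y => (x,y)))).card
      ≤ Δ * (Δ +1) := by
    intro u
    refine (card_biUnion_le_card_mul _ _ Δ ?_).trans ?_
    · intro x _
      exact card_image_le.trans ((card_nb E x).le.trans (hΔ x))
    · rw [mul_comm]
      refine Nat.mul_le_mul_left _ ((card_insert_le _ _).trans ?_)
      rw [card_nb]; have := hΔ u; omega
  set B1 := (insert u (nb E u)).biUnion (fun x => (nb E x).image (fun y => (x,y))) with hB1
  set B2 := ((insert w (nb E w)).biUnion (fun x => (nb E x).image (fun y => (x,y)))).image Prod.swap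
    with hB2
  have hsub : prs E ⊆ good E u w ∪ (B1 ∪ B2) := by
    rintro ⟨x, y⟩ hp
    have hxy : s(x,y) ∈ E := by simpa [prs] using hp
    by_cases h1 : x = u ∨ s(u,x) ∈ E
    · refine mem_union_right _ (mem_union_left _ ?_)
      simp only [hB1, mem_biUnion, mem_image, mem_insert, mem_nb]
      exact ⟨x, h1, y, hxy, rfl⟩
    by_cases h2 : y = w ∨ s(w,y) ∈ E
    · refine mem_union_right _ (mem_union_right _ ?_)
      simp only [hB2, mem_image, mem_biUnion, mem_insert, mem_nb]
      refine ⟨(y,x), ⟨y, h2, x, ?_, rfl⟩, rfl⟩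
      rwa [Sym2.eq_swap]
    push Not at h1 h2
    refine mem_union_left _ ?_
    simp only [good, mem_filter, mem_univ, true_and]
    exact ⟨hxy, h1.1, h1.2, h2.1, h2.2⟩
  have h1 := card_le_card hsub
  have h2 := card_union_le (good E u w) (B1 ∪ B2)
  have h3 := card_union_le B1 B2
  have h4 := key u
  have h5 : B2.card ≤ Δ * (Δ +1) := card_image_le.trans (key w)
  rw [← card_prs]
  rw [← hB1] at h4
  omega

lemma cnt_switch4 {n : ℕ} (D : Fin n → ℤ) {a v x y : Fin n} (hav : a ≠ v) (hxa : x ≠ a)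
    (hxv : x ≠ v) (hya : y ≠ a) (hyv : y ≠ v) (hxy : x ≠ y) :
    cnt D (fun E => s(a,v) ∈ E ∧ (s(x,y) ∈ E ∧ (s(a,x) ∉ E ∧ s(v,y) ∉ E))) =
      cnt D (fun E => s(a,x) ∈ E ∧ (s(v,y) ∈ E ∧ (s(a,v) ∉ E ∧ s(x,y) ∉ E))) := by
  have e1 : s(x,y) ≠ s(a,v) := by simp [hxa, hxv]
  have e2 : s(a,x) ≠ s(a,v) := by simp [hxv, hav]
  have e3 : s(v,y) ≠ s(a,v) := by simp [hya, hav.symm]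
  have e4 : s(a,x) ≠ s(x,y) := by simp [hxa.symm, hya.symm]
  have e5 : s(v,y) ≠ s(x,y) := by simp [hxv.symm, hyv.symm]
  have e6 : s(v,y) ≠ s(a,x) := by simp [hav.symm, hxv.symm]
  have E1 := cnt_insert D hav (fun E => s(x,y) ∈ E ∧ (s(a,x) ∉ E ∧ s(v,y) ∉ E))
    (fun E => s(x,y) ∈ E ∧ (s(a,x) ∉ E ∧ s(v,y) ∉ E)) (fun E _ => by simp [e1, e2, e3])
  have E2 := cnt_insert (D - ee a - ee v) hxy (fun E => s(a,v) ∉ E ∧ (s(a,x) ∉ E ∧ s(v,y) ∉ E))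
    (fun E => s(a,v) ∉ E ∧ (s(a,x) ∉ E ∧ s(v,y) ∉ E)) (fun E _ => by simp [e1.symm, e4, e5])
  have E3 := cnt_insert D hxa.symm (fun E => s(v,y) ∈ E ∧ (s(a,v) ∉ E ∧ s(x,y) ∉ E))
    (fun E => s(v,y) ∈ E ∧ (s(a,v) ∉ E ∧ s(x,y) ∉ E)) (fun E _ => by simp [e6, e2.symm, e4.symm])
  have E4 := cnt_insert (D - ee a - ee x) hyv.symm (fun E => s(a,x) ∉ E ∧ (s(a,v) ∉ E ∧ s(x,y) ∉ E))
    (fun E => s(a,x) ∉ E ∧ (s(a,v) ∉ E ∧ s(x,y) ∉ E))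
    (fun E _ => by simp [e3.symm, e5.symm, e6.symm])
  rw [E1, E3, cnt_congr _ (Q' := fun E => s(x,y) ∈ E ∧ (s(a,v) ∉ E ∧ (s(a,x) ∉ E ∧ s(v,y) ∉ E)))
      (fun E => by tauto), E2,
    cnt_congr (D - ee a - ee x) (Q' := fun E => s(v,y) ∈ E ∧ (s(a,x) ∉ E ∧ (s(a,v) ∉ E ∧ s(x,y) ∉ E)))
      (fun E => by tauto), E4,
    show D - ee a - ee v - ee x - ee y = D - ee a - ee x - ee v - ee y by ring]
  exact cnt_congr _ (fun E => by tauto)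

lemma sum_cnt {n : ℕ} {ι : Type*} (D : Fin n → ℤ) (s : Finset ι)
    (Q : ι → Finset (Sym2 (Fin n)) → Prop) [∀ i, DecidablePred (Q i)] :
    ∑ i ∈ s, cnt D (Q i) =
      ∑ E ∈ (Graphs n).filter (fun E => ∀ i, (deg E i : ℤ) = D i), (s.filter (fun i => Q i E)).card := by
  classical
  simp only [cnt_def, ← filter_filter]
  simp only [card_filter (p := fun E => Q _ E), card_filter (p := fun i => Q i _)]
  rw [sum_comm]

lemma switch_bound {n : ℕ} (D : Fin n → ℤ) (Δ : ℕ) (hΔ : ∀ i, D i ≤ Δ) {a v : Fin n} (hav : a ≠ v) :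
    (NE D a v : ℤ) * (∑ i, D i -2 * (Δ * (Δ +1))) ≤ D a * D v * (NN D - NE D a v : ℤ) := by
  classical
  set S : Finset (Fin n × Fin n) := univ.filter (fun p => p.1 ≠ a ∧ p.1 ≠ v ∧ p.2 ≠ a ∧ p.2 ≠ v ∧
    p.1 ≠ p.2) with hS
  set G := (Graphs n).filter (fun E => ∀ i, (deg E i : ℤ) = D i) with hG
  have h1 : ∑ p ∈ S, cnt D (fun E => s(a,v) ∈ E ∧ (s(p.1,p.2) ∈ E ∧ (s(a,p.1) ∉ E ∧ s(v,p.2) ∉ E))) =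
      ∑ p ∈ S, cnt D (fun E => s(a,p.1) ∈ E ∧ (s(v,p.2) ∈ E ∧ (s(a,v) ∉ E ∧ s(p.1,p.2) ∉ E))) := by
    refine sum_congr rfl fun p hp => ?_
    simp only [hS, mem_filter, mem_univ, true_and] at hp
    exact cnt_switch4 D hav hp.1 hp.2.1 hp.2.2.1 hp.2.2.2.1 hp.2.2.2.2
  rw [sum_cnt, sum_cnt, ← hG] at h1
  have hNE : (NE D a v : ℤ) = ∑ E ∈ G, if s(a,v) ∈ E then 1 else 0 := by
    unfold NE; rw [cnt_def, ← filter_filter, card_filter]; push_cast; rfl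
  have hNN : (NN D - NE D a v : ℤ) = ∑ E ∈ G, if s(a,v) ∈ E then 0 else 1 := by
    have : (NN D : ℤ) = ∑ E ∈ G, 1 := by
      unfold NN; rw [cnt_def, ← filter_filter, card_filter]; simp [hG]
    rw [this, hNE, ← sum_sub_distrib]
    exact sum_congr rfl fun E _ => by split_ifs <;> simp
  rw [hNN, hNE, sum_mul, mul_sum]
  have h1' := congrArg (Nat.cast : ℕ → ℤ) h1
  push_cast at h1'
  refine le_trans (sum_le_sum ?_) (h1'.le.trans (sum_le_sum ?_))
  · intro E hE
    simp only [hG, mem_filter] at hE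
    by_cases hm : s(a,v) ∈ E
    · have hd : ∀ i, deg E i ≤ Δ := fun i => by
        have := hΔ i; rw [← hE.2 i] at this; exact_mod_cast this
      have hg := card_good Δ hd a v
      have hsum : ∑ i, D i = ((∑ i, deg E i : ℕ) : ℤ) := by
        push_cast; exact sum_congr rfl fun i _ => (hE.2 i).symm
      have hle : (good E a v).card ≤ (S.filter (fun p => s(a,v) ∈ E ∧ (s(p.1,p.2) ∈ E ∧ (s(a,p.1) ∉ E ∧ s(v,p.2) ∉ E)))).card := by
        refine card_le_card ?_
        rintro ⟨x, y⟩ hp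
        simp only [good, hS, mem_filter, mem_univ, true_and] at hp ⊢
        obtain ⟨p1, p2, p3, p4, p5⟩ := hp
        refine ⟨⟨p2, ?_, ?_, p4, ne_of_mem_G hE.1 p1⟩, hm, p1, p3, p5⟩
        · rintro rfl; exact p3 hm
        · rintro rfl; rw [Sym2.eq_swap] at p5; exact p5 hm
      simp only [hm, if_true, one_mul, true_and] at hle ⊢
      rw [hsum]
      have : ((∑ i, deg E i : ℕ) : ℤ) ≤ (good E a v).card +2 * (Δ * (Δ +1)) := mod_cast hg
      have h3 : ((good E a v).card : ℤ) ≤ _ := Nat.cast_le.2 hle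
      linarith
    · simp [hm]
  · intro E hE
    simp only [hG, mem_filter] at hE
    by_cases hm : s(a,v) ∈ E
    · simp [hm]
    · simp only [hm, if_false, mul_one]
      rw [← hE.2 a, ← hE.2 v, ← card_nb, ← card_nb]
      rw [← Nat.cast_mul, ← card_product]
      refine Nat.cast_le.2 (card_le_card ?_)
      rintro ⟨x, y⟩ hp
      simp only [mem_filter, mem_product, mem_nb] at hp ⊢
      exact ⟨hp.2.1, hp.2.2.1⟩

lemma realize {n : ℕ} (D : Fin n → ℤ) (Δ : ℕ) (h0 : ∀ i, 0 ≤ D i) (hΔ : ∀ i, D i ≤ Δ)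
    (hev : Even (∑ i, D i)) (hM :3 * ((Δ : ℤ) * (Δ +1)) < ∑ i, D i) :0 < NN D := by
  classical
  set S := (Graphs n).filter (fun E => ∀ i, (deg E i : ℤ) ≤ D i) with hS
  have hne : S.Nonempty := ⟨∅, by
    simp only [hS, mem_filter, mem_Graphs]
    exact ⟨by simp, fun i => by simpa [deg] using h0 i⟩⟩
  obtain ⟨E, hE, hmax⟩ := exists_max_image S card hne
  simp only [hS, mem_filter] at hE
  obtain ⟨hG, hd⟩ := hE
  have hdΔ : ∀ i, deg E i ≤ Δ := fun i => mod_cast (hd i).trans (hΔ i)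
  suffices hall : ∀ i, (deg E i : ℤ) = D i by
    unfold NN; rw [cnt_def]
    exact card_pos.2 ⟨E, by simp [hG, hall]⟩
  have hsd := sum_deg hG
  -- main improvement step
  have main : ∀ u w : Fin n, (u = w → (deg E u : ℤ) +2 ≤ D u) → (deg E u : ℤ) +1 ≤ D u →
      (deg E w : ℤ) +1 ≤ D w → ∀ x y : Fin n, s(x,y) ∈ E → x ≠ u → s(u,x) ∉ E → y ≠ w → s(w,y) ∉ E →
      s(u,x) ≠ s(w,y) → False := by
    intro u w huw hu hw x y hxy hxu hux hyw hwy hne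
    set E0 := E.erase s(x,y)
    have hxyne := ne_of_mem_G hG hxy
    have n0 : s(x,y) ∉ E0 := by simp [E0]
    have n1 : s(u,x) ∉ E0 := fun h => hux (mem_of_mem_erase h)
    have n2 : s(w,y) ∉ insert s(u,x) E0 := by
      rw [mem_insert]; rintro (h | h)
      · exact hne h.symm
      · exact hwy (mem_of_mem_erase h)
    have hmem : insert s(w,y) (insert s(u,x) E0) ∈ S := by
      simp only [hS, mem_filter, mem_Graphs]
      refine ⟨?_, fun i => ?_⟩
      · intro e he
        simp only [mem_insert] at he
        rcases he with rfl | rfl | he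
        · simpa using hyw.symm
        · simpa using hxu.symm
        · exact mem_Graphs.1 hG e (mem_of_mem_erase he)
      · rw [deg_insert hyw.symm n2, deg_insert hxu.symm n1]
        have := deg_insert hxyne n0 i
        rw [insert_erase hxy] at this
        have hdi := hd i
        have h1 : (deg E i : ℤ) + ee u i + ee w i ≤ D i := by
          simp only [ee_apply]
          by_cases c1 : i = u
          · by_cases c2 : i = w
            · subst c1; subst c2; simp; linarith [huw rfl]
            · subst c1; simp [c2]; linarith
          · by_cases c2 : i = w
            · subst c2; simp [c1]; linarith
            · simp [c1, c2]; linarith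
        linarith
    have := hmax _ hmem
    rw [card_insert_of_notMem n2, card_insert_of_notMem n1] at this
    have h2 := card_erase_add_one hxy
    simp only [E0] at this
    omega
  have adj : ∀ u w : Fin n, u ≠ w → (deg E u : ℤ) +1 ≤ D u → (deg E w : ℤ) +1 ≤ D w →
      s(u,w) ∈ E := by
    intro u w huw hu hw
    by_contra hni
    have hmem : insert s(u,w) E ∈ S := by
      simp only [hS, mem_filter, mem_Graphs]
      refine ⟨?_, fun i => ?_⟩
      · intro e he
        rcases mem_insert.1 he with rfl | he
        · simpa using huw
        · exact mem_Graphs.1 hG e he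
      · rw [deg_insert huw hni]
        simp only [ee_apply]
        by_cases c1 : i = u
        · subst c1; simp [huw]; linarith
        · by_cases c2 : i = w
          · subst c2; simp [c1]; linarith
          · simp [c1, c2, hd i]
    have := hmax _ hmem
    rw [card_insert_of_notMem hni] at this
    omega
  by_contra hnall
  push Not at hnall
  obtain ⟨u, hu⟩ := hnall
  have hu' : (deg E u : ℤ) +1 ≤ D u := lt_of_le_of_ne (hd u) hu
  -- total deficiency
  have hdef : ∑ i, (D i - deg E i) ≤ (Δ : ℤ) * (Δ +1) := by
    have hz : ∀ i ∉ insert u (nb E u), D i - deg E i =0 := by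
      intro i hi
      simp only [mem_insert, mem_nb, not_or] at hi
      by_contra hne
      exact hi.2 (adj u i (Ne.symm hi.1) hu' (lt_of_le_of_ne (hd i) (fun h => hne (by linarith))))
    rw [← sum_subset (subset_univ (insert u (nb E u))) (fun i _ hi => hz i hi)]
    refine (sum_le_card_nsmul _ _ (Δ : ℤ) (fun i _ => ?_)).trans ?_
    · have := hΔ i; linarith [Int.natCast_nonneg (deg E i)]
    · rw [nsmul_eq_mul, mul_comm]
      refine mul_le_mul_of_nonneg_left ?_ (by positivity)
      have h1 := card_insert_le u (nb E u)
      rw [card_nb] at h1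
      have h2 := hdΔ u
      exact_mod_cast h1.trans (by omega)
  have hsumE : ((∑ i, deg E i : ℕ) : ℤ) = ∑ i, D i - ∑ i, (D i - deg E i) := by
    push_cast; rw [sum_sub_distrib]; ring
  have fin : ∀ w : Fin n, (u = w → (deg E u : ℤ) +2 ≤ D u) → (deg E w : ℤ) +1 ≤ D w →
      (u ≠ w → s(u,w) ∈ E) → False := by
    intro w h1 h2 h3
    have hc := card_good Δ hdΔ u w
    have :0 < (good E u w).card := by
      have hc' : ((∑ i, deg E i : ℕ) : ℤ) ≤ (good E u w).card +2 * (Δ * (Δ +1)) := mod_cast hc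
      have : (0 : ℤ) < (good E u w).card := by linarith
      exact_mod_cast this
    obtain ⟨⟨x, y⟩, hp⟩ := card_pos.1 this
    simp only [good, mem_filter, mem_univ, true_and] at hp
    obtain ⟨p1, p2, p3, p4, p5⟩ := hp
    refine main u w h1 hu' h2 x y p1 p2 p3 p4 p5 ?_
    intro heq
    rcases Sym2.eq_iff.1 heq with h | h
    · exact ne_of_mem_G hG p1 h.2
    · obtain ⟨rfl, rfl⟩ := h
      exact p3 (h3 (Ne.symm p2))
  by_cases hw : ∃ w, u ≠ w ∧ (deg E w : ℤ) +1 ≤ D w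
  · obtain ⟨w, huw, hw⟩ := hw
    exact fin w (fun h => absurd h huw) hw (fun _ => adj u w huw hu' hw)
  · push Not at hw
    refine fin u (fun _ => ?_) hu' (fun h => absurd rfl h)
    have hs : ∑ i, (D i - deg E i) = D u - deg E u := by
      refine sum_eq_single u (fun i _ hi => ?_) (by simp)
      have := hw i (Ne.symm hi); have := hd i; omega
    have : Even (D u - deg E u) := by
      rw [← hs, sum_sub_distrib]
      refine hev.sub ?_
      have : (∑ i, (deg E i : ℤ)) =2 * (E.card : ℤ) := mod_cast hsd
      rw [this]; exact even_two_mul _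
    obtain ⟨r, hr⟩ := this
    omega

def Ball {n : ℕ} (C : Fin n → ℤ) (r : ℤ) (D : Fin n → ℤ) : Prop :=
  (∀ i, 0 ≤ D i) ∧ ∑ i, |D i - C i| ≤ r

def Pp {n : ℕ} (D : Fin n → ℤ) (a v : Fin n) : ℝ := (NE D a v : ℝ) / NN D
def Yp {n : ℕ} (D : Fin n → ℤ) (a v b : Fin n) : ℝ := (NEE D a v b : ℝ) / NN D

def co {n : ℕ} (F : ℤ → ℤ → ℝ) (U : ℤ → ℤ → ℤ → ℝ) (D : Fin n → ℤ) (a b : Fin n) : ℝ :=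
  F (D a) (D b) + ∑ v ∈ (univ.erase a).erase b, U (D a) (D v) (D b)

structure Ctr {n : ℕ} (C : Fin n → ℤ) (ρ : ℤ) (Δ : ℤ → Prop) (F : ℤ → ℤ → ℝ) (U : ℤ → ℤ → ℤ → ℝ)
    (Ro : ℤ → ℤ → ℝ) (τ η : ℝ) : Prop where
  hτ :0 < τ
  hτ1 : τ ≤1 /3000
  hη :0 ≤ η
  hη1 : η ≤1 /100
  hΔ : ∀ D, Ball C ρ D → ∀ i, Δ (D i)
  hΔ' : ∀ D, Ball C ρ D → ∀ i, Δ (D i -1)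
  hN : ∀ D, Ball C ρ D → Even (∑ i, D i) → 0 < NN D
  Fnn : ∀ x z, 0 ≤ x → Δ x → 0 ≤ z → Δ z → 0 ≤ F x z
  Fτ : ∀ x z, 0 ≤ x → Δ x → 0 ≤ z → Δ z → F x z ≤ τ
  F0 : ∀ z, F 0 z =0
  Fsym : ∀ x z, F x z = F z x
  Fmono : ∀ x z, 0 ≤ x → Δ x → 1 ≤ z → Δ z → F x (z -1) ≤2 * F x z
  Ubd : ∀ x z y, 0 ≤ x → Δ x → 0 ≤ z → Δ z → 0 ≤ y → Δ y → |U x z y| ≤2 * (F x z * F y z)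
  HA : ∀ x y z, 1 ≤ x → Δ x → 1 ≤ y → Δ y → 1 ≤ z → Δ z →
    |F x z * (1 - F (y -1) (z -1)) - Ro x y * (1 - F (x -1) (z -1)) * F y z| ≤ η * F x z
  HR : ∀ x y, 1 ≤ x → Δ x → 1 ≤ y → Δ y → (x : ℝ) ≤2 * (Ro x y * y)
  HC : ∀ x z y, 1 ≤ x → Δ x → 1 ≤ z → Δ z → 0 ≤ y → Δ y →
    |U x z y * (1 - F (x -1) (z -1)) - F x z * (F y (z -1) - U (x -1) (z -1) y)| ≤
      η * (F x z * F y z)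
  HA2 : ∀ D, Ball C ρ D → ∀ v, |∑ b ∈ univ.erase v, F (D b) (D v) - D v| ≤ η * D v
  HB : ∀ D, Ball C (ρ -1) D → ∀ a b, a ≠ b → 1 ≤ D a → 1 ≤ D b →
    |Ro (D a) (D b) * (D b - co F U (D - ee a) a b) - (D a - co F U (D - ee b) a b)| ≤ τ * η * D a
  HI : ∀ D, Ball C ρ D → Even (∑ i, D i) → ∀ a v, a ≠ v → Pp D a v ≤2 * F (D a) (D v)

section
variable {n : ℕ} {C : Fin n → ℤ} {ρ : ℤ} {Δ : ℤ → Prop} {F : ℤ → ℤ → ℝ} {U : ℤ → ℤ → ℤ → ℝ}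
    {Ro : ℤ → ℤ → ℝ} {τ η : ℝ}

lemma Ball.mono {r r' : ℤ} {D : Fin n → ℤ} (h : Ball C r D) (hr : r ≤ r') : Ball C r' D :=
  ⟨h.1, h.2.trans hr⟩

lemma Ball.sub1 {r : ℤ} {D : Fin n → ℤ} (h : Ball C r D) {a : Fin n} (ha :1 ≤ D a) :
    Ball C (r +1) (D - ee a) := by
  refine ⟨fun i => ?_, ?_⟩
  · have := h.1 i
    simp only [Pi.sub_apply, ee_apply]; split_ifs with hi
    · subst hi; omega
    · omega
  · calc ∑ i, |(D - ee a) i - C i| ≤ ∑ i, (|D i - C i| + ee a i) := by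
          refine sum_le_sum fun i _ => ?_
          simp only [Pi.sub_apply, ee_apply]; split_ifs <;> [skip; simp]
          rw [show D i -1 - C i = (D i - C i) -1 by ring]
          exact (abs_sub _ _).trans (by simp)
      _ ≤ r +1 := by
          rw [sum_add_distrib]; simp only [ee_apply]; simp; exact h.2

lemma Ball.sub2 {r : ℤ} {D : Fin n → ℤ} (h : Ball C r D) {a v : Fin n} (hav : a ≠ v)
    (ha :1 ≤ D a) (hv :1 ≤ D v) : Ball C (r +2) (D - ee a - ee v) := by
  have := (h.sub1 ha).sub1 (a := v) (by simp [ee_apply, hav.symm, hv])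
  rwa [add_assoc] at this

lemma sum_ee (D : Fin n → ℤ) (a : Fin n) : ∑ i, (D - ee a) i = ∑ i, D i -1 := by
  simp [sum_sub_distrib, ee_apply]

lemma even_sub2 {D : Fin n → ℤ} (h : Even (∑ i, D i)) (a v : Fin n) :
    Even (∑ i, (D - ee a - ee v) i) := by
  rw [sum_ee, sum_ee]; obtain ⟨r, hr⟩ := h; exact ⟨r -1, by omega⟩

lemma Pp_nonneg (D : Fin n → ℤ) (a v : Fin n) :0 ≤ Pp D a v := by unfold Pp; positivity
lemma Yp_nonneg (D : Fin n → ℤ) (a v b : Fin n) :0 ≤ Yp D a v b := by unfold Yp; positivity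
lemma Pp_comm (D : Fin n → ℤ) (a v : Fin n) : Pp D a v = Pp D v a := by unfold Pp; rw [NE_comm]
lemma Yp_le (D : Fin n → ℤ) (a v b : Fin n) : Yp D a v b ≤ Pp D a v := by
  unfold Yp Pp; gcongr; exact NEE_le D a v b
lemma P_id {D : Fin n → ℤ} {a v : Fin n} (hav : a ≠ v) (h1 :0 < NN D)
    (h2 :0 < NN (D - ee a - ee v)) :
    NN D * Pp D a v = NN (D - ee a - ee v) * (1 - Pp (D - ee a - ee v) a v) := by
  have h := NE_rec D hav
  have h' : (NE D a v : ℝ) + NE (D - ee a - ee v) a v = NN (D - ee a - ee v) := mod_cast h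
  unfold Pp
  have h1 : (NN D : ℝ) ≠ 0 := by positivity
  have h2 : (NN (D - ee a - ee v) : ℝ) ≠ 0 := by positivity
  field_simp
  linarith

lemma Y_id {D : Fin n → ℤ} {a v b : Fin n} (hav : a ≠ v) (hab : a ≠ b) (h1 :0 < NN D)
    (h2 :0 < NN (D - ee a - ee v)) :
    Yp D a v b * (1 - Pp (D - ee a - ee v) a v) =
      Pp D a v * (Pp (D - ee a - ee v) b v - Yp (D - ee a - ee v) a v b) := by
  have h := NEE_rec D hav hab
  have h' : (NEE D a v b : ℝ) + NEE (D - ee a - ee v) a v b = NE (D - ee a - ee v) b v := by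
    exact_mod_cast h
  have hP := P_id hav h1 h2
  have h1 : (NN D : ℝ) ≠ 0 := by positivity
  have h2 : (NN (D - ee a - ee v) : ℝ) ≠ 0 := by positivity
  have hY : NN D * Yp D a v b = NN (D - ee a - ee v) *
      (Pp (D - ee a - ee v) b v - Yp (D - ee a - ee v) a v b) := by
    unfold Yp Pp; field_simp; linarith
  apply mul_left_cancel₀ h1
  rw [← mul_assoc, ← mul_assoc, hY, hP]; ring

lemma P_sum {D : Fin n → ℤ} (v : Fin n) (h1 :0 < NN D) :
    ∑ b ∈ univ.erase v, Pp D b v = D v := by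
  have h : ∑ b ∈ univ.erase v, (NE D v b : ℝ) = D v * NN D := mod_cast sum_NE D v
  have h1 : (NN D : ℝ) ≠ 0 := by positivity
  calc _ = (∑ b ∈ univ.erase v, (NE D v b : ℝ)) / NN D := by
        rw [sum_div]; exact sum_congr rfl fun b _ => by rw [Pp_comm, Pp]
    _ = _ := by rw [h]; field_simp

def cc (D : Fin n → ℤ) (a b : Fin n) : ℝ :=
  Pp D a b + ∑ v ∈ (univ.erase a).erase b, Yp D a v b

lemma R_id {D : Fin n → ℤ} {a b : Fin n} (hab : a ≠ b) (h1 :0 < NN (D - ee a))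
    (h2 :0 < NN (D - ee b)) :
    (NN (D - ee b) : ℝ) * (D a - cc (D - ee b) a b) = NN (D - ee a) * (D b - cc (D - ee a) a b) := by
  have h : (NN (D - ee b) : ℝ) * D a - NE (D - ee b) a b
        - ∑ v ∈ (univ.erase a).erase b, (NEE (D - ee b) a v b : ℝ) =
      (NN (D - ee a) : ℝ) * D b - NE (D - ee a) a b
        - ∑ v ∈ (univ.erase a).erase b, (NEE (D - ee a) a v b : ℝ) := mod_cast bal D hab
  have h1 : (NN (D - ee a) : ℝ) ≠ 0 := by positivity
  have h2 : (NN (D - ee b) : ℝ) ≠ 0 := by positivity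
  unfold cc Pp Yp
  rw [← sum_div, ← sum_div, mul_sub, mul_sub, mul_add, mul_add,
    mul_div_cancel₀ _ h1, mul_div_cancel₀ _ h1, mul_div_cancel₀ _ h2, mul_div_cancel₀ _ h2]
  linarith

def State (C : Fin n → ℤ) (F : ℤ → ℤ → ℝ) (U : ℤ → ℤ → ℤ → ℝ) (E : ℝ) (r : ℤ) : Prop :=
  ∀ D, Ball C r D → Even (∑ i, D i) →
    (∀ a v, a ≠ v → |Pp D a v - F (D a) (D v)| ≤ E * F (D a) (D v)) ∧
    (∀ a v b, a ≠ v → b ≠ v → a ≠ b → |Yp D a v b - U (D a) (D v) (D b)| ≤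
      E * (F (D a) (D v) * F (D b) (D v)))
end

section
variable {n : ℕ} {C : Fin n → ℤ} {ρ : ℤ} {Δ : ℤ → Prop} {F : ℤ → ℤ → ℝ} {U : ℤ → ℤ → ℤ → ℝ}
    {Ro : ℤ → ℤ → ℝ} {τ η : ℝ}

def ch (F : ℤ → ℤ → ℝ) (D : Fin n → ℤ) (a b : Fin n) : ℝ :=
  F (D a) (D b) + ∑ v ∈ (univ.erase a).erase b, F (D a) (D v) * F (D b) (D v)

lemma ch_comm (H : Ctr C ρ Δ F U Ro τ η) (D : Fin n → ℤ) (a b : Fin n) : ch F D a b = ch F D b a := by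
  unfold ch; rw [H.Fsym, erase_right_comm]; congr 1
  exact sum_congr rfl fun v _ => mul_comm _ _

lemma ch_le (H : Ctr C ρ Δ F U Ro τ η) {D : Fin n → ℤ} (hD : Ball C ρ D) {a b : Fin n} :
    ch F D a b ≤ τ * (1 +1.01 * D b) := by
  have i0 := hD.1
  have i1 := H.hΔ D hD
  have h1 := H.Fτ _ _ (i0 a) (i1 a) (i0 b) (i1 b)
  have h2 : ∑ v ∈ (univ.erase a).erase b, F (D a) (D v) * F (D b) (D v) ≤
      τ * ∑ v ∈ univ.erase b, F (D v) (D b) := by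
    rw [mul_sum]
    refine (sum_le_sum (g := fun v => τ * F (D v) (D b)) fun v _ => ?_).trans
      (sum_le_sum_of_subset_of_nonneg (by rw [erase_right_comm]; exact erase_subset _ _) fun v _ _ => ?_)
    · rw [H.Fsym (D b)]
      exact mR (H.Fτ _ _ (i0 a) (i1 a) (i0 v) (i1 v))
        (H.Fnn _ _ (i0 v) (i1 v) (i0 b) (i1 b))
    · exact mul_nonneg H.hτ.le (H.Fnn _ _ (i0 v) (i1 v) (i0 b) (i1 b))
  have h3 := (abs_le.1 (H.HA2 D hD b)).2
  have hb : (0 : ℝ) ≤ D b := mod_cast i0 b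
  have h4 : ∑ v ∈ univ.erase b, F (D v) (D b) ≤1.01 * D b := by
    linarith [mR H.hη1 hb]
  have := mL h4 H.hτ.le
  unfold ch; linarith

lemma ch_nonneg (H : Ctr C ρ Δ F U Ro τ η) {D : Fin n → ℤ} (hD : Ball C ρ D) {a b : Fin n} :
    0 ≤ ch F D a b := by
  have i0 := hD.1
  have i1 := H.hΔ D hD
  refine add_nonneg (H.Fnn _ _ (i0 a) (i1 a) (i0 b) (i1 b)) (sum_nonneg fun v _ => ?_)
  exact mul_nonneg (H.Fnn _ _ (i0 a) (i1 a) (i0 v) (i1 v)) (H.Fnn _ _ (i0 b) (i1 b) (i0 v) (i1 v))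

lemma cc_co (H : Ctr C ρ Δ F U Ro τ η) {E : ℝ} {r : ℤ} (hr : r ≤ ρ) (S : State C F U E r)
    {D : Fin n → ℤ} (hD : Ball C r D) (hev : Even (∑ i, D i)) {a b : Fin n} (hab : a ≠ b) :
    |cc D a b - co F U D a b| ≤ E * ch F D a b ∧ cc D a b ≤ (2 + E) * ch F D a b := by
  obtain ⟨S1, S2⟩ := S D hD hev
  have i0 := hD.1
  have i1 := H.hΔ D (hD.mono hr)
  have k : |cc D a b - co F U D a b| ≤ E * ch F D a b := by
    unfold cc co ch
    rw [show ∀ p q f u : ℝ, p + q - (f + u) = (p - f) + (q - u) by intros; ring,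
      ← sum_sub_distrib, mul_add, mul_sum]
    refine (abs_add_le _ _).trans (add_le_add (S1 a b hab) ((abs_sum_le_sum_abs _ _).trans
      (sum_le_sum fun v hv => ?_)))
    simp only [mem_erase, mem_univ, and_true] at hv
    exact S2 a v b (Ne.symm hv.2) (Ne.symm hv.1) hab
  have k2 : co F U D a b ≤2 * ch F D a b := by
    unfold co ch
    rw [mul_add, mul_sum]
    refine add_le_add ?_ (sum_le_sum fun v _ => ?_)
    · linarith [H.Fnn _ _ (i0 a) (i1 a) (i0 b) (i1 b)]
    · exact (le_abs_self _).trans (H.Ubd _ _ _ (i0 a) (i1 a) (i0 v) (i1 v) (i0 b) (i1 b))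
  refine ⟨k, ?_⟩
  have := (abs_le.1 k).2
  linarith

lemma R_step (H : Ctr C ρ Δ F U Ro τ η) {E : ℝ} {r : ℤ} (hr : r ≤ ρ) (hE0 :0 ≤ E) (hE : E ≤20)
    (S : State C F U E r) {D : Fin n → ℤ} (hD : Ball C (r -1) D) (hodd : Even (∑ i, D i +1))
    {a b : Fin n} (hab : a ≠ b) (ha :1 ≤ D a) (hb :1 ≤ D b) :
    0 < Ro (D a) (D b) ∧
    |(NN (D - ee a) : ℝ) / NN (D - ee b) - Ro (D a) (D b)| ≤13 * τ * (E + η) * Ro (D a) (D b) := by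
  have Ba : Ball C r (D - ee a) := (hD.sub1 ha).mono (by omega)
  have Bb : Ball C r (D - ee b) := (hD.sub1 hb).mono (by omega)
  have ev : ∀ x : Fin n, Even (∑ i, (D - ee x) i) := by
    intro x; rw [sum_ee]; obtain ⟨k, hk⟩ := hodd; exact ⟨k -1, by omega⟩
  have Na := H.hN _ (Ba.mono hr) (ev a)
  have Nb := H.hN _ (Bb.mono hr) (ev b)
  have i1 := H.hΔ D (hD.mono (by omega))
  have hid := R_id hab Na Nb
  have hB := H.HB D (hD.mono (by omega)) a b hab ha hb
  have hR := H.HR _ _ ha (i1 a) hb (i1 b)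
  obtain ⟨a1, a2⟩ := cc_co H hr S Ba (ev a) hab
  obtain ⟨b1, b2⟩ := cc_co H hr S Bb (ev b) hab
  have da : (1 : ℝ) ≤ D a := mod_cast ha
  have db : (1 : ℝ) ≤ D b := mod_cast hb
  have ca := ch_le H (Ba.mono hr) (a := a) (b := b)
  have ca0 := ch_nonneg H (Ba.mono hr) (a := a) (b := b)
  have cb := ch_le H (Bb.mono hr) (a := b) (b := a)
  have cb0 := ch_nonneg H (Bb.mono hr) (a := a) (b := b)
  rw [ch_comm H] at cb
  rw [show (D - ee a) b = D b by simp [ee_apply, hab.symm]] at ca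
  rw [show (D - ee b) a = D a by simp [ee_apply, hab]] at cb
  set ρa := cc (D - ee a) a b
  set ρb := cc (D - ee b) a b
  set κa := co F U (D - ee a) a b
  set κb := co F U (D - ee b) a b
  set ha' := ch F (D - ee a) a b
  set hb' := ch F (D - ee b) a b
  set X := Ro (D a) (D b)
  have hX :0 < X := by
    by_contra h
    have : X * (D b : ℝ) ≤0 := mul_nonpos_of_nonpos_of_nonneg (not_lt.1 h) (by linarith)
    linarith
  have hτ := H.hτ
  have hτ1 := H.hτ1
  have hη := H.hη
  have ca' : ha' ≤2.01 * τ * D b := by linarith [mL db hτ.le]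
  have cb' : hb' ≤2.01 * τ * D a := by linarith [mL da hτ.le]
  have NaR : (0 : ℝ) < NN (D - ee a) := mod_cast Na
  have NbR : (0 : ℝ) < NN (D - ee b) := mod_cast Nb
  set R := (NN (D - ee a) : ℝ) / NN (D - ee b) with hRdef
  have hRid : R * (D b - ρa) = D a - ρb := by
    rw [hRdef, div_mul_eq_mul_div, ← hid]; field_simp
  have hden : (D b : ℝ) /2 ≤ D b - ρa := by
    have : (2 + E) * ha' ≤22 * (2.01 * τ * D b) := by
      apply mul_le_mul (by linarith) ca' ca0 (by norm_num)
    linarith [mR hτ1 (show (0:ℝ) ≤ D b by linarith)]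
  have e1 : |κb - ρb| ≤ E * (2.01 * τ * D a) := by
    rw [abs_sub_comm]; exact b1.trans (mL cb' hE0)
  have e2 : |X * (ρa - κa)| ≤ X * (E * (2.01 * τ * D b)) := by
    rw [abs_mul, abs_of_pos hX]
    exact mL (a1.trans (mL ca' hE0)) hX.le
  have hdiff : (R - X) * (D b - ρa) = -(X * (D b - κa) - (D a - κb)) + (κb - ρb) + X * (ρa - κa) := by
    rw [sub_mul, hRid]; ring
  have habs : |R - X| * (D b - ρa) ≤ τ * η * D a + E * (2.01 * τ * D a) + X * (E * (2.01 * τ * D b)) := by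
    rw [← abs_of_nonneg (show (0 : ℝ) ≤ D b - ρa by linarith), ← abs_mul, hdiff]
    refine (abs_add_le _ _).trans (add_le_add ((abs_add_le _ _).trans (add_le_add ?_ e1)) e2)
    rw [abs_neg]; exact hB
  refine ⟨hX, ?_⟩
  have h5 : |R - X| * (D b /2) ≤ (13 * τ * (E + η) * X) * (D b /2) := by
    refine (mL hden (abs_nonneg _)).trans (habs.trans ?_)
    have h6 : τ * η * D a ≤ τ * η * (2 * (X * D b)) := mL hR (by positivity)
    have h7 : E * (2.01 * τ * D a) ≤ E * (2.01 * τ * (2 * (X * D b))) := by gcongr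
    have h8 :0 ≤ τ * η * (X * D b) := by positivity
    have h9 :0 ≤ τ * E * (X * D b) := by positivity
    linarith
  exact le_of_mul_le_mul_right h5 (by linarith)

lemma P_zero (H : Ctr C ρ Δ F U Ro τ η) {D : Fin n → ℤ} (hD : Ball C ρ D) (hev : Even (∑ i, D i))
    {a v : Fin n} (hav : a ≠ v) (h : F (D a) (D v) =0) : Pp D a v =0 := by
  have := H.HI D hD hev a v hav
  rw [h] at this
  linarith [Pp_nonneg D a v]

lemma F_zero (H : Ctr C ρ Δ F U Ro τ η) {x z : ℤ} (h : ¬ (1 ≤ x ∧ 1 ≤ z)) (hx :0 ≤ x) (hz :0 ≤ z) :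
    F x z =0 := by
  by_cases h1 : x =0
  · rw [h1, H.F0]
  · have : z =0 := by omega
    rw [this, H.Fsym, H.F0]

lemma P_core {Q P A B X R Pa Pb fa' fb' τ E η : ℝ} (hτ :0 < τ) (hτ1 : τ ≤1 /3000) (hη :0 ≤ η)
    (hη1 : η ≤1 /100) (hE0 :0 ≤ E) (hFa :0 ≤ A) (hFb :0 ≤ B) (hPb :0 ≤ P) (hX :0 < X)
    (pa0 :0 ≤ Pa) (fa : fa' ≤ τ) (fb : fb' ≤ τ) (fb0 :0 ≤ fb')
    (ia : Pa ≤2 * fa') (ib : Pb ≤2 * fb') (qa : |Pa - fa'| ≤ E * fa') (qb : |Pb - fb'| ≤ E * fb')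
    (hR : |R - X| ≤13 * τ * (E + η) * X)
    (hA : |A * (1 - fb') - X * (1 - fa') * B| ≤ η * A)
    (hrel : Q * (1 - Pb) = R * P * (1 - Pa)) :
    |Q * B - P * A| ≤ (18 * τ * E +2 * η) * (P * A) := by
  have qa' : |fa' - Pa| ≤ E * τ := by
    rw [abs_sub_comm]; exact qa.trans (mL fa hE0)
  have qb' : |fb' - Pb| ≤ E * τ := by
    rw [abs_sub_comm]; exact qb.trans (mL fb hE0)
  have hXB : X * B ≤1.02 * A := by
    have h := (abs_le.1 hA).1
    have h3 : X * B * (1 - τ) ≤ X * (1 - fa') * B := by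
      have := mL fa (show 0 ≤ X * B by positivity)
      linarith
    have h4 : η * A ≤1 /100 * A := by gcongr
    have h5 :0 ≤ A * fb' := by positivity
    have : X * B * (1 - τ) ≤ A *1.01 := by linarith
    have h6 : τ * (X * B) ≤1 /3000 * (X * B) := by gcongr
    linarith
  have e1 : |R * (1 - Pa) - X * (1 - fa')| ≤ X * (14 * τ * E +13 * τ * η) := by
    rw [show R * (1 - Pa) - X * (1 - fa') = (R - X) * (1 - Pa) + X * (fa' - Pa) by ring]
    refine (abs_add_le _ _).trans ?_
    rw [abs_mul, abs_mul, abs_of_pos hX, abs_of_nonneg (show 0 ≤1 - Pa by linarith)]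
    have : |R - X| * (1 - Pa) ≤13 * τ * (E + η) * X *1 :=
      mul_le_mul hR (by linarith) (by linarith) (by positivity)
    have := mL qa' hX.le
    linarith
  have key : (Q * B - P * A) * (1 - Pb) =
      P * (B * (R * (1 - Pa) - X * (1 - fa')) -
        (A * (1 - fb') - X * (1 - fa') * B) - A * (fb' - Pb)) := by
    linear_combination B * hrel
  have habs : |Q * B - P * A| * (1 - Pb) ≤
      P * (B * (X * (14 * τ * E +13 * τ * η)) + η * A + A * (E * τ)) := by
    rw [← abs_of_nonneg (show (0 : ℝ) ≤1 - Pb by linarith), ← abs_mul, key, abs_mul, abs_of_nonneg hPb]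
    refine mL ?_ hPb
    refine (abs_sub _ _).trans (add_le_add ((abs_sub _ _).trans (add_le_add ?_ hA)) ?_)
    · rw [abs_mul, abs_of_nonneg hFb]; exact mL e1 hFb
    · rw [abs_mul, abs_of_nonneg hFa]; exact mL qb' hFa
  have hden : (0.99 : ℝ) ≤1 - Pb := by linarith
  have h5 : |Q * B - P * A| *0.99 ≤ ((18 * τ * E +2 * η) * (P * A)) *0.99 := by
    refine (mL hden (abs_nonneg _)).trans (habs.trans ?_)
    have h6 : B * (X * (14 * τ * E +13 * τ * η)) ≤1.02 * A * (14 * τ * E +13 * τ * η) := by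
      rw [← mul_assoc, mul_comm B X]; exact mR hXB (by positivity)
    rw [show (18 * τ * E +2 * η) * (P * A) *0.99 =
      P * ((18 * τ * E +2 * η) * A *0.99) by ring]
    refine mL ?_ hPb
    have h7 :0 ≤ A * (τ * E) := by positivity
    have h8 : τ * (η * A) ≤1 /3000 * (η * A) := by gcongr
    have h9 :0 ≤ η * A := by positivity
    linarith
  exact le_of_mul_le_mul_right h5 (by norm_num)

lemma P_step1 (H : Ctr C ρ Δ F U Ro τ η) {E : ℝ} {r : ℤ} (hr : r ≤ ρ) (hE0 :0 ≤ E) (hE : E ≤20)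
    (S : State C F U E r) {D : Fin n → ℤ} (hD : Ball C (r -2) D) (hev : Even (∑ i, D i))
    {a b v : Fin n} (hav : a ≠ v) (hbv : b ≠ v) :
    |Pp D a v * F (D b) (D v) - Pp D b v * F (D a) (D v)| ≤
      (18 * τ * E +2 * η) * (Pp D b v * F (D a) (D v)) := by
  have hτ := H.hτ
  have hτ1 := H.hτ1
  have hη := H.hη
  have hη1 := H.hη1
  have hDρ : Ball C ρ D := hD.mono (by omega)
  have i0 := hD.1
  have i1 := H.hΔ D hDρ
  have hFa := H.Fnn _ _ (i0 a) (i1 a) (i0 v) (i1 v)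
  have hPb := Pp_nonneg D b v
  have hrhs :0 ≤ (18 * τ * E +2 * η) * (Pp D b v * F (D a) (D v)) := by positivity
  by_cases hab : a = b
  · subst hab; simpa using hrhs
  by_cases h1 :1 ≤ D a ∧ 1 ≤ D v
  swap
  · have hz := F_zero H h1 (i0 a) (i0 v)
    rw [P_zero H hDρ hev hav hz, hz]; simp
  by_cases h2 :1 ≤ D b ∧ 1 ≤ D v
  swap
  · have hz := F_zero H h2 (i0 b) (i0 v)
    rw [P_zero H hDρ hev hbv hz, hz]; simp
  obtain ⟨ha, hv⟩ := h1
  have hb := h2.1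
  have Ba : Ball C r (D - ee a - ee v) := (hD.sub2 hav ha hv).mono (by omega)
  have Bb : Ball C r (D - ee b - ee v) := (hD.sub2 hbv hb hv).mono (by omega)
  have N0 := H.hN _ hDρ hev
  have eva := even_sub2 hev a v
  have evb := even_sub2 hev b v
  have Na := H.hN _ (Ba.mono hr) eva
  have Nb := H.hN _ (Bb.mono hr) evb
  have pa := P_id hav N0 Na
  have pb := P_id hbv N0 Nb
  have Bv : Ball C (r -1) (D - ee v) := (hD.sub1 hv).mono (by omega)
  have evv : Even (∑ i, (D - ee v) i +1) := by rw [sum_ee]; simpa using hev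
  have va : (D - ee v) a = D a := by simp [ee_apply, hav]
  have vb : (D - ee v) b = D b := by simp [ee_apply, hbv]
  obtain ⟨hX, hR⟩ := R_step H hr hE0 hE S Bv evv hab (by rw [va]; exact ha) (by rw [vb]; exact hb)
  rw [va, vb, sub_right_comm D (ee v) (ee a), sub_right_comm D (ee v) (ee b)] at hR
  rw [va, vb] at hX
  have qa := (S _ Ba eva).1 a v hav
  have qb := (S _ Bb evb).1 b v hbv
  have ia := H.HI _ (Ba.mono hr) eva a v hav
  have ib := H.HI _ (Bb.mono hr) evb b v hbv
  have a1 : (D - ee a - ee v) a = D a -1 := by simp [ee_apply, hav]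
  have a2 : (D - ee a - ee v) v = D v -1 := by simp [ee_apply, hav.symm]
  have b1 : (D - ee b - ee v) b = D b -1 := by simp [ee_apply, hbv]
  have b2 : (D - ee b - ee v) v = D v -1 := by simp [ee_apply, hbv.symm]
  rw [a1, a2] at qa ia
  rw [b1, b2] at qb ib
  have hA := H.HA _ _ _ ha (i1 a) hb (i1 b) hv (i1 v)
  have fa := H.Fτ (D a -1) (D v -1) (by omega) (H.hΔ' D hDρ a) (by omega) (H.hΔ' D hDρ v)
  have fb := H.Fτ (D b -1) (D v -1) (by omega) (H.hΔ' D hDρ b) (by omega) (H.hΔ' D hDρ v)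
  have fa0 := H.Fnn (D a -1) (D v -1) (by omega) (H.hΔ' D hDρ a) (by omega) (H.hΔ' D hDρ v)
  have fb0 := H.Fnn (D b -1) (D v -1) (by omega) (H.hΔ' D hDρ b) (by omega) (H.hΔ' D hDρ v)
  have hFb := H.Fnn _ _ (i0 b) (i1 b) (i0 v) (i1 v)
  have pa0 := Pp_nonneg (D - ee a - ee v) a v
  have pb0 := Pp_nonneg (D - ee b - ee v) b v
  have NaR : (0 : ℝ) < NN (D - ee a - ee v) := mod_cast Na
  have NbR : (0 : ℝ) < NN (D - ee b - ee v) := mod_cast Nb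
  have N0R : (0 : ℝ) < NN D := mod_cast N0
  refine P_core (R := (NN (D - ee a - ee v) : ℝ) / NN (D - ee b - ee v)) hτ hτ1 hη hη1 hE0 hFa hFb hPb hX
    pa0 fa fb fb0 ia ib qa qb hR hA ?_
  apply mul_left_cancel₀ N0R.ne'
  calc NN D * (Pp D a v * (1 - Pp (D - ee b - ee v) b v))
      = (NN D * Pp D a v) * (1 - Pp (D - ee b - ee v) b v) := by ring
    _ = (NN (D - ee a - ee v) : ℝ) / NN (D - ee b - ee v) *
        (NN (D - ee b - ee v) * (1 - Pp (D - ee b - ee v) b v)) * (1 - Pp (D - ee a - ee v) a v) := by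
          rw [pa]; field_simp
    _ = _ := by rw [← pb]; ring
end

section
variable {n : ℕ} {C : Fin n → ℤ} {ρ : ℤ} {Δ : ℤ → Prop} {F : ℤ → ℤ → ℝ} {U : ℤ → ℤ → ℤ → ℝ}
    {Ro : ℤ → ℤ → ℝ} {τ η : ℝ}

lemma P_step (H : Ctr C ρ Δ F U Ro τ η) {E : ℝ} {r : ℤ} (hr : r ≤ ρ) (hE0 :0 ≤ E) (hE : E ≤20)
    (S : State C F U E r) {D : Fin n → ℤ} (hD : Ball C (r -2) D) (hev : Even (∑ i, D i))
    {a v : Fin n} (hav : a ≠ v) :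
    |Pp D a v - F (D a) (D v)| ≤ (18 * τ * E +4 * η) * F (D a) (D v) := by
  have hDρ : Ball C ρ D := hD.mono (by omega)
  have i0 := hD.1
  have i1 := H.hΔ D hDρ
  by_cases hv :1 ≤ D v
  swap
  · have hz : F (D a) (D v) =0 := F_zero H (fun h => hv h.2) (i0 a) (i0 v)
    rw [P_zero H hDρ hev hav hz, hz]; simp
  have hvR : (1 : ℝ) ≤ D v := mod_cast hv
  have hs : |Pp D a v * (∑ b ∈ univ.erase v, F (D b) (D v)) - D v * F (D a) (D v)| ≤
      (18 * τ * E +2 * η) * (D v * F (D a) (D v)) := by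
    rw [← P_sum v (H.hN D hDρ hev), mul_sum, sum_mul, ← sum_sub_distrib, mul_sum]
    refine (abs_sum_le_sum_abs _ _).trans (sum_le_sum fun b hb => ?_)
    exact P_step1 H hr hE0 hE S hD hev hav (by simpa using hb)
  have h2 := H.HA2 D hDρ v
  have hI := H.HI D hDρ hev a v hav
  have hP := Pp_nonneg D a v
  set P := Pp D a v
  set f := F (D a) (D v)
  set T := ∑ b ∈ univ.erase v, F (D b) (D v)
  have h3 : |P * (T - D v)| ≤2 * f * (η * D v) := by
    rw [abs_mul, abs_of_nonneg hP]
    exact mul_le_mul hI h2 (abs_nonneg _) (by linarith)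
  have h4 : |(P - f) * D v| ≤ ((18 * τ * E +4 * η) * f) * D v := by
    rw [show (P - f) * D v = (P * T - D v * f) - P * (T - D v) by ring]
    refine (abs_sub _ _).trans ((add_le_add hs h3).trans (le_of_eq (by ring)))
  rw [abs_mul, abs_of_nonneg (show (0:ℝ) ≤ D v by linarith)] at h4
  exact le_of_mul_le_mul_right h4 (by linarith)

lemma Y_core {Y u P f Pa fa Pb fb Y' u' g τ E E2 η : ℝ} (hτ :0 < τ) (hτ1 : τ ≤1 /3000) (hη :0 ≤ η)
    (hE0 :0 ≤ E) (hE2 :0 ≤ E2) (hf :0 ≤ f) (hg :0 ≤ g) (hfb :0 ≤ fb) (hfa :0 ≤ fa) (hfaτ : fa ≤ τ)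
    (hfbg : fb ≤2 * g) (hPb0 :0 ≤ Pb) (hP0 :0 ≤ P)
    (hP2 : P ≤2 * f) (hPb2 : Pb ≤2 * fb) (hPa2 : Pa ≤2 * fa)
    (qP : |P - f| ≤ E2 * f) (qa : |Pa - fa| ≤ E2 * fa) (qb : |Pb - fb| ≤ E2 * fb)
    (qY : |Y' - u'| ≤ E * (fa * fb)) (hu : |u| ≤2 * (f * g)) (hu' : |u'| ≤2 * (fa * fb))
    (hid : Y * (1 - Pa) = P * (Pb - Y')) (hC : |u * (1 - fa) - f * (fb - u')| ≤ η * (f * g)) :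
    |Y - u| ≤ (7 * E2 +5 * τ * E +2 * η) * (f * g) := by
  have key : (Y - u) * (1 - Pa) = (P - f) * Pb + f * (Pb - fb) - P * (Y' - u') - (P - f) * u'
      - (u * (1 - fa) - f * (fb - u')) - u * (fa - Pa) := by linear_combination hid
  have hfg :0 ≤ f * g := by positivity
  have t1 : |(P - f) * Pb| ≤ E2 * f * (4 * g) := by
    rw [abs_mul, abs_of_nonneg hPb0]; exact mul_le_mul qP (by linarith) hPb0 (by positivity)
  have t2 : |f * (Pb - fb)| ≤ f * (E2 * (2 * g)) := by
    rw [abs_mul, abs_of_nonneg hf]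
    exact mL (qb.trans (mL hfbg hE2)) hf
  have hfab : fa * fb ≤ τ * (2 * g) := mul_le_mul hfaτ hfbg hfb hτ.le
  have t3 : |P * (Y' - u')| ≤2 * f * (E * (τ * (2 * g))) := by
    rw [abs_mul, abs_of_nonneg hP0]
    exact mul_le_mul hP2 (qY.trans (mL hfab hE0)) (abs_nonneg _) (by linarith)
  have t4 : |(P - f) * u'| ≤ E2 * f * (2 * (τ * (2 * g))) := by
    rw [abs_mul]; exact mul_le_mul qP (hu'.trans (by linarith)) (abs_nonneg _) (by positivity)
  have t5 : |u * (fa - Pa)| ≤2 * (f * g) * (E2 * τ) := by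
    rw [abs_mul, abs_sub_comm]
    exact mul_le_mul hu (qa.trans (mL hfaτ hE2)) (abs_nonneg _) (by linarith)
  have h1 : |Y - u| * (1 - Pa) ≤ E2 * f * (4 * g) + f * (E2 * (2 * g)) +2 * f * (E * (τ * (2 * g)))
      + E2 * f * (2 * (τ * (2 * g))) + η * (f * g) +2 * (f * g) * (E2 * τ) := by
    rw [← abs_of_nonneg (show (0 : ℝ) ≤1 - Pa by linarith), ← abs_mul, key]
    refine (abs_sub _ _).trans (add_le_add ((abs_sub _ _).trans (add_le_add ((abs_sub _ _).trans
      (add_le_add ((abs_sub _ _).trans (add_le_add ((abs_add_le _ _).trans (add_le_add t1 t2)) t3)) t4)) hC)) t5)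
  have h2 : |Y - u| *0.99 ≤ ((7 * E2 +5 * τ * E +2 * η) * (f * g)) *0.99 := by
    refine (mL (show (0.99:ℝ) ≤1 - Pa by linarith) (abs_nonneg _)).trans (h1.trans ?_)
    have a1 :0 ≤ E2 * (f * g) := by positivity
    have a2 :0 ≤ τ * (E * (f * g)) := by positivity
    have a3 :0 ≤ η * (f * g) := by positivity
    have a4 := mR hτ1 a1
    linarith
  exact le_of_mul_le_mul_right h2 (by norm_num)

lemma step (H : Ctr C ρ Δ F U Ro τ η) {E : ℝ} {r : ℤ} (hr : r ≤ ρ) (hE0 :0 ≤ E) (hE : E ≤20)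
    (S : State C F U E r) : State C F U (140 * τ * E +30 * η) (r -4) := by
  intro D hD hev
  have hτ := H.hτ
  have hη := H.hη
  have hDρ : Ball C ρ D := hD.mono (by omega)
  have i0 := hD.1
  have i1 := H.hΔ D hDρ
  have hFnn : ∀ a v, 0 ≤ F (D a) (D v) := fun a v => H.Fnn _ _ (i0 a) (i1 a) (i0 v) (i1 v)
  have hτE :0 ≤ τ * E := by positivity
  refine ⟨fun a v hav => ?_, fun a v b hav hbv hab => ?_⟩
  · refine (P_step H hr hE0 hE S (hD.mono (by omega)) hev hav).trans ?_
    exact mR (by linarith) (hFnn a v)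
  have hub := H.Ubd _ _ _ (i0 a) (i1 a) (i0 v) (i1 v) (i0 b) (i1 b)
  by_cases h1 :1 ≤ D a ∧ 1 ≤ D v
  swap
  · have hz := F_zero H h1 (i0 a) (i0 v)
    have hp := P_zero H hDρ hev hav hz
    have hY : Yp D a v b =0 := le_antisymm ((Yp_le D a v b).trans hp.le) (Yp_nonneg D a v b)
    rw [hz] at hub ⊢
    rw [hY]; simp at hub ⊢; exact hub
  obtain ⟨ha, hv⟩ := h1
  have B2 : Ball C (r -2) (D - ee a - ee v) := (hD.sub2 hav ha hv).mono (by omega)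
  have B2ρ : Ball C ρ (D - ee a - ee v) := B2.mono (by omega)
  have ev2 := even_sub2 hev a v
  have a1 : (D - ee a - ee v) a = D a -1 := by simp [ee_apply, hav]
  have a2 : (D - ee a - ee v) v = D v -1 := by simp [ee_apply, hav.symm]
  have a3 : (D - ee a - ee v) b = D b := by simp [ee_apply, hab.symm, hbv]
  have qP := P_step H hr hE0 hE S (hD.mono (by omega)) hev hav
  have qa := P_step H hr hE0 hE S B2 ev2 hav
  have qb := P_step H hr hE0 hE S B2 ev2 hbv
  have qY := (S _ (B2.mono (by omega)) ev2).2 a v b hav hbv hab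
  have ip := H.HI _ hDρ hev a v hav
  have ia := H.HI _ B2ρ ev2 a v hav
  have ib := H.HI _ B2ρ ev2 b v hbv
  rw [a1, a2] at qa ia
  rw [a3, a2] at qb ib
  rw [a1, a2, a3] at qY
  have e1 :0 ≤ D a -1 := by omega
  have e2 : Δ (D a -1) := H.hΔ' D hDρ a
  have e3 :0 ≤ D v -1 := by omega
  have e4 : Δ (D v -1) := H.hΔ' D hDρ v
  have hid := Y_id hav hab (H.hN _ hDρ hev) (H.hN _ B2ρ ev2)
  refine (Y_core hτ H.hτ1 hη hE0 (by positivity :0 ≤18 * τ * E +4 * η) (hFnn a v) (hFnn b v)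
    (H.Fnn _ _ (i0 b) (i1 b) e3 e4) (H.Fnn _ _ e1 e2 e3 e4) (H.Fτ _ _ e1 e2 e3 e4)
    (H.Fmono _ _ (i0 b) (i1 b) hv (i1 v)) (Pp_nonneg _ _ _) (Pp_nonneg _ _ _) ip ib ia qP qa qb qY hub
    (H.Ubd _ _ _ e1 e2 e3 e4 (i0 b) (i1 b)) hid (H.HC _ _ _ ha (i1 a) hv (i1 v) (i0 b) (i1 b))).trans ?_
  refine mR (by linarith) (mul_nonneg (hFnn a v) (hFnn b v))

lemma init (H : Ctr C ρ Δ F U Ro τ η) : State C F U 20 (ρ -2) := by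
  intro D hD hev
  have hDρ : Ball C ρ D := hD.mono (by omega)
  have i0 := hD.1
  have i1 := H.hΔ D hDρ
  have hFnn : ∀ a v, 0 ≤ F (D a) (D v) := fun a v => H.Fnn _ _ (i0 a) (i1 a) (i0 v) (i1 v)
  refine ⟨fun a v hav => ?_, fun a v b hav hbv hab => ?_⟩
  · have := H.HI D hDρ hev a v hav
    rw [abs_le]; constructor <;> linarith [Pp_nonneg D a v, hFnn a v]
  have hub := H.Ubd _ _ _ (i0 a) (i1 a) (i0 v) (i1 v) (i0 b) (i1 b)
  have ip := H.HI _ hDρ hev a v hav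
  have hY : Yp D a v b ≤10 * (F (D a) (D v) * F (D b) (D v)) := by
    by_cases h1 :1 ≤ D a ∧ 1 ≤ D v
    swap
    · have hz := F_zero H h1 (i0 a) (i0 v)
      have hp := P_zero H hDρ hev hav hz
      have := Yp_le D a v b
      rw [hz]; linarith
    obtain ⟨ha, hv⟩ := h1
    have B2ρ : Ball C ρ (D - ee a - ee v) := (hD.sub2 hav ha hv).mono (by omega)
    have ev2 := even_sub2 hev a v
    have a1 : (D - ee a - ee v) a = D a -1 := by simp [ee_apply, hav]
    have a2 : (D - ee a - ee v) v = D v -1 := by simp [ee_apply, hav.symm]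
    have a3 : (D - ee a - ee v) b = D b := by simp [ee_apply, hab.symm, hbv]
    have hid := Y_id hav hab (H.hN _ hDρ hev) (H.hN _ B2ρ ev2)
    have ia := H.HI _ B2ρ ev2 a v hav
    have ib := H.HI _ B2ρ ev2 b v hbv
    rw [a1, a2] at ia
    rw [a3, a2] at ib
    have hm := H.Fmono _ _ (i0 b) (i1 b) hv (i1 v)
    have hft := H.Fτ (D a -1) (D v -1) (by omega) (H.hΔ' D hDρ a) (by omega) (H.hΔ' D hDρ v)
    have y0 := Yp_nonneg (D - ee a - ee v) a v b
    have y1 := Yp_nonneg D a v b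
    have : Yp D a v b *0.99 ≤ (2 * F (D a) (D v)) * (4 * F (D b) (D v)) := by
      refine (mL (show (0.99:ℝ) ≤1 - Pp (D - ee a - ee v) a v by linarith [H.hτ1]) y1).trans ?_
      rw [hid]
      refine (mL (show _ ≤4 * F (D b) (D v) by linarith) (Pp_nonneg _ _ _)).trans ?_
      exact mR ip (by linarith [hFnn b v])
    have :0 ≤ F (D a) (D v) * F (D b) (D v) := mul_nonneg (hFnn a v) (hFnn b v)
    linarith
  have h0 := mul_nonneg (hFnn a v) (hFnn b v)
  rw [abs_le] at hub ⊢
  constructor <;> linarith [Yp_nonneg D a v b, hub.1, hub.2]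

lemma iter (H : Ctr C ρ Δ F U Ro τ η) (k : ℕ) :
    State C F U (20 * (140 * τ) ^ k +32 * η) (ρ -2 -4 * k) := by
  have hτ := H.hτ
  have hη := H.hη
  have q1 :140 * τ ≤1 /20 := by linarith [H.hτ1]
  have mono : ∀ E E' : ℝ, E ≤ E' → ∀ r, r ≤ ρ → State C F U E r → State C F U E' r := by
    intro E E' h r hr S D hD hev
    have i1 := H.hΔ D (hD.mono hr)
    have hFnn : ∀ a v, 0 ≤ F (D a) (D v) := fun a v => H.Fnn _ _ (hD.1 a) (i1 a) (hD.1 v) (i1 v)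
    exact ⟨fun a v hav => ((S D hD hev).1 a v hav).trans (mR h (hFnn a v)),
      fun a v b h1 h2 h3 => ((S D hD hev).2 a v b h1 h2 h3).trans
        (mR h (mul_nonneg (hFnn a v) (hFnn b v)))⟩
  induction k with
  | zero => exact mono 20 _ (by simp; linarith) _ (by simp) (by simpa using init H)
  | succ k ih =>
    by_cases hk : k =0
    · subst hk
      have := step H (by omega) (by norm_num) (by norm_num) (init H)
      have e : ρ -2 -4 * ((0 +1 : ℕ) : ℤ) = ρ -2 -4 := by simp
      rw [e]
      exact mono _ _ (by simp; linarith) _ (by omega) this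
    · have hq : (140 * τ) ^ k ≤1 /20 :=
        (pow_le_of_le_one (by linarith) (by linarith) hk).trans q1
      have hp :0 ≤ (140 * τ) ^ k := by positivity
      have := step H (by omega) (by positivity) (by linarith [H.hη1]) ih
      have e : ρ -2 -4 * ((k +1 : ℕ) : ℤ) = ρ -2 -4 * k -4 := by push_cast; ring
      rw [e]
      refine mono _ _ ?_ _ (by omega) this
      rw [pow_succ]
      linarith [mR q1 hη]

/-- ratio conclusion -/
lemma ratio (H : Ctr C ρ Δ F U Ro τ η) (k : ℕ) (hk :1 ≤ k) (hρ :4 * k +3 ≤ ρ)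
    (h0 : ∀ i, 0 ≤ C i) (hodd : Even (∑ i, C i +1)) {a b : Fin n} (hab : a ≠ b) (ha :1 ≤ C a) (hb :1 ≤ C b) :
    0 < NN (C - ee a) ∧ 0 < NN (C - ee b) ∧ 0 < Ro (C a) (C b) ∧
    |(NN (C - ee a) : ℝ) / NN (C - ee b) - Ro (C a) (C b)| ≤
      13 * τ * (20 * (140 * τ) ^ k +33 * η) * Ro (C a) (C b) := by
  have hτ := H.hτ
  have hη := H.hη
  have q1 :140 * τ ≤1 /20 := by linarith [H.hτ1]
  have hq : (140 * τ) ^ k ≤1 /20 := (pow_le_of_le_one (by linarith) (by linarith) (by omega)).trans q1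
  have B0 : Ball C 0 C := ⟨h0, by simp⟩
  have ev : ∀ x : Fin n, Even (∑ i, (C - ee x) i) := by
    intro x; rw [sum_ee]; obtain ⟨k, hk⟩ := hodd; exact ⟨k -1, by omega⟩
  have hp :0 ≤ (140 * τ) ^ k := by positivity
  have := R_step H (by omega) (by positivity) (by linarith [H.hη1]) (iter H k) (B0.mono (by omega)) hodd hab ha hb
  refine ⟨H.hN _ ((B0.sub1 ha).mono (by omega)) (ev a), H.hN _ ((B0.sub1 hb).mono (by omega)) (ev b), this.1, ?_⟩
  convert this.2 using 2; ring
end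

/-- pointwise parameters for the asymptotic expansions -/
structure Pt where
  (μ la h s ε L u w t e1 e2 : ℝ)
  hμ :0 < μ
  hrel : μ + μ * la = la
  hL :1 ≤ L
  hμL : μ * L ^4 ≤1 /100
  hε :0 < ε
  hεL : ε ≤ L
  h0 :0 ≤ h
  hh : h ≤ ε ^2
  s0 :0 ≤ s
  hs : s ≤ ε ^2
  hu : |u| ≤ ε
  hw : |w| ≤ ε
  ht : |t| ≤ ε
  he1 : |e1| ≤ μ * ε ^4 * L
  he2 : |e2| ≤ μ * ε ^4 * L

namespace Pt

def Bd (j k : ℕ) (f : Pt → ℝ) : Prop :=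
  ∃ C : ℝ, ∃ c : ℕ, 0 ≤ C ∧ ∀ p : Pt, |f p| ≤ C * (p.μ ^ j * p.ε ^ k * p.L ^ c)

lemma L0 (p : Pt) :0 < p.L := lt_of_lt_of_le one_pos p.hL
lemma μ1 (p : Pt) : p.μ ≤1 /100 := by
  have h1 :1 ≤ p.L ^4 := one_le_pow₀ p.hL
  nlinarith [p.hμ, p.hμL]

lemma Bd.add {j k} {f g : Pt → ℝ} (hf : Bd j k f) (hg : Bd j k g) : Bd j k (f + g) := by
  obtain ⟨C, c, hC, h⟩ := hf
  obtain ⟨C', c', hC', h'⟩ := hg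
  refine ⟨C + C', c + c', by positivity, fun p => ?_⟩
  have := p.hμ; have := p.hε; have hL := p.hL; have := p.L0
  calc |f p + g p| ≤ |f p| + |g p| := abs_add_le _ _
    _ ≤ C * (p.μ ^ j * p.ε ^ k * p.L ^ c) + C' * (p.μ ^ j * p.ε ^ k * p.L ^ c') := add_le_add (h p) (h' p)
    _ ≤ C * (p.μ ^ j * p.ε ^ k * p.L ^ (c + c')) + C' * (p.μ ^ j * p.ε ^ k * p.L ^ (c + c')) := by
        gcongr <;> first | exact hL | omega
    _ = _ := by ring

lemma Bd.neg {j k} {f : Pt → ℝ} (hf : Bd j k f) : Bd j k (-f) := by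
  obtain ⟨C, c, hC, h⟩ := hf
  exact ⟨C, c, hC, fun p => by simpa using h p⟩

lemma Bd.sub {j k} {f g : Pt → ℝ} (hf : Bd j k f) (hg : Bd j k g) : Bd j k (f - g) := by
  rw [sub_eq_add_neg]; exact hf.add hg.neg

lemma Bd.mul {j k j' k'} {f g : Pt → ℝ} (hf : Bd j k f) (hg : Bd j' k' g) :
    Bd (j + j') (k + k') (f * g) := by
  obtain ⟨C, c, hC, h⟩ := hf
  obtain ⟨C', c', hC', h'⟩ := hg
  refine ⟨C * C', c + c', by positivity, fun p => ?_⟩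
  have := p.hμ; have := p.hε; have hL := p.hL; have := p.L0
  calc |f p * g p| = |f p| * |g p| := abs_mul _ _
    _ ≤ (C * (p.μ ^ j * p.ε ^ k * p.L ^ c)) * (C' * (p.μ ^ j' * p.ε ^ k' * p.L ^ c')) :=
        mul_le_mul (h p) (h' p) (abs_nonneg _) (by positivity)
    _ = _ := by ring

lemma Bd.of {j k j' k'} {f : Pt → ℝ} (hf : Bd j' k' f) (hj : j ≤ j' := by norm_num)
    (hk : k ≤ k' := by norm_num) : Bd j k f := by
  obtain ⟨C, c, hC, h⟩ := hf
  obtain ⟨x, rfl⟩ := Nat.exists_eq_add_of_le hj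
  obtain ⟨y, rfl⟩ := Nat.exists_eq_add_of_le hk
  refine ⟨C, y + c, hC, fun p => (h p).trans ?_⟩
  have hm := p.hμ; have he := p.hε; have hL := p.hL; have := p.L0
  have h1 : p.μ ^ x ≤1 := pow_le_one₀ hm.le (p.μ1.trans (by norm_num))
  have h2 : p.ε ^ y ≤ p.L ^ y := pow_le_pow_left₀ he.le p.hεL y
  calc C * (p.μ ^ (j + x) * p.ε ^ (k + y) * p.L ^ c)
      = C * (p.μ ^ j * p.ε ^ k * (p.μ ^ x * p.ε ^ y * p.L ^ c)) := by ring
    _ ≤ C * (p.μ ^ j * p.ε ^ k * (1 * p.L ^ y * p.L ^ c)) := by gcongr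
    _ = _ := by ring

lemma Bd.congr {j k} {f g : Pt → ℝ} (hf : Bd j k f) (h : g = f) : Bd j k g := h ▸ hf

lemma bnum (r : ℝ) : Bd 0 0 (fun _ => r) := ⟨|r|, 0, abs_nonneg _, fun p => by simp⟩
lemma b1 : Bd 0 0 1 := bnum 1
lemma b2 : Bd 0 0 2 := bnum 2
lemma bμ : Bd 1 0 μ := ⟨1, 0, by norm_num, fun p => by simp [abs_of_pos p.hμ]⟩
lemma la0 (p : Pt) :0 < p.la := by
  have := p.hrel; have := p.hμ; have := p.μ1; nlinarith
lemma la2 (p : Pt) : p.la ≤2 * p.μ := by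
  have := p.hrel; have := p.hμ; have := p.μ1; nlinarith [p.la0]
lemma bla : Bd 1 0 la := ⟨2, 0, by norm_num, fun p => by
  simpa [abs_of_pos p.la0] using p.la2⟩
lemma bh : Bd 0 2 h := ⟨1, 0, by norm_num, fun p => by simpa [abs_of_nonneg p.h0] using p.hh⟩
lemma bs : Bd 0 2 s := ⟨1, 0, by norm_num, fun p => by simpa [abs_of_nonneg p.s0] using p.hs⟩
lemma bu : Bd 0 1 u := ⟨1, 0, by norm_num, fun p => by simpa using p.hu⟩
lemma bw : Bd 0 1 w := ⟨1, 0, by norm_num, fun p => by simpa using p.hw⟩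
lemma bt : Bd 0 1 t := ⟨1, 0, by norm_num, fun p => by simpa using p.ht⟩
lemma be1 : Bd 1 4 e1 := ⟨1, 1, by norm_num, fun p => by simpa using p.he1⟩
lemma be2 : Bd 1 4 e2 := ⟨1, 1, by norm_num, fun p => by simpa using p.he2⟩

lemma rel : μ + μ * la = la := funext fun p => p.hrel

def ka : Pt → ℝ := la * s * (1 + la)
def kp : Pt → ℝ := la * s + μ * h

lemma bka : Bd 1 2 ka := ((bla.mul bs).mul (b1.add bla.of)).of
lemma bkp : Bd 1 2 kp := (bla.mul bs).add (bμ.mul bh)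

lemma binv {f : Pt → ℝ} (hf : ∀ p, 1 /2 ≤ f p) : Bd 0 0 f⁻¹ :=
  ⟨2, 0, by norm_num, fun p => by
    have h := hf p
    have :0 < f p := by linarith
    simp only [Pi.inv_apply, abs_inv, abs_of_pos this, pow_zero, mul_one]
    rw [inv_le_comm₀ this (by norm_num)]; linarith⟩

lemma minv {f : Pt → ℝ} (hf : ∀ p, 1 /2 ≤ f p) : f * f⁻¹ =1 := funext fun p => by
  have h := hf p
  simp [mul_inv_cancel₀ (show f p ≠ 0 by linarith)]

/-- swap `u` and `t` -/
def sw (p : Pt) : Pt := { p with u := p.t, t := p.u, hu := p.ht, ht := p.hu }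

lemma Bd.sw {j k} {f : Pt → ℝ} (hf : Bd j k f) : Bd j k (f ∘ Pt.sw) := by
  obtain ⟨C, c, hC, h⟩ := hf
  exact ⟨C, c, hC, fun p => h p.sw⟩

-- absolute smallness
lemma aux_ab (p : Pt) {x y : ℝ} (hx : |x| ≤2 * p.L ^2) (hy : |y| ≤2 * p.L ^2) :
    |p.la * x * y| ≤1 /10 := by
  rw [abs_mul, abs_mul, abs_of_pos p.la0]
  have := p.la2; have := p.hμL; have := p.la0; have := p.hμ; have := p.L0
  calc p.la * |x| * |y| ≤2 * p.μ * (2 * p.L ^2) * (2 * p.L ^2) := by gcongr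
    _ =8 * (p.μ * p.L ^4) := by ring
    _ ≤ _ := by linarith

lemma hL2 (p : Pt) : p.h ≤ p.L ^2 := p.hh.trans (pow_le_pow_left₀ p.hε.le p.hεL 2)
lemma sL2 (p : Pt) : p.s ≤ p.L ^2 := p.hs.trans (pow_le_pow_left₀ p.hε.le p.hεL 2)
lemma absL (p : Pt) {x : ℝ} (hx : |x| ≤ p.ε) : |x| ≤2 * p.L ^2 := by
  have := p.hεL; have := p.hL; nlinarith
lemma absLh (p : Pt) {x : ℝ} (hx : |x| ≤ p.ε) : |x - p.h| ≤2 * p.L ^2 := by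
  have h1 := p.hεL; have h2 := p.hL; have h3 := p.hL2
  have := abs_sub x p.h
  rw [abs_of_nonneg p.h0] at this
  nlinarith

/-- `kp` and `ka` are tiny -/
lemma kp0 (p : Pt) :0 ≤ kp p := by
  have := p.la0; have := p.s0; have := p.h0; have := p.hμ
  show 0 ≤ p.la * p.s + p.μ * p.h
  positivity
lemma kpL (p : Pt) : kp p * p.L ^2 ≤3 /100 := by
  have := p.la0; have := p.s0; have := p.h0; have := p.hμ
  have a1 := p.la2; have a2 := p.sL2; have a3 := p.hL2; have := p.L0
  calc (p.la * p.s + p.μ * p.h) * p.L ^2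
      ≤ (2 * p.μ * p.L ^2 + p.μ * p.L ^2) * p.L ^2 := by gcongr
    _ =3 * (p.μ * p.L ^4) := by ring
    _ ≤ _ := by linarith [p.hμL]
lemma kax (p : Pt) {x : ℝ} (hx : |x| ≤2 * p.ε) : |ka p * x| ≤1 /10 := by
  have := p.la0; have := p.s0; have := p.hμ; have := p.L0
  have a1 := p.la2; have a2 := p.sL2; have a3 := p.μ1
  have a4 : |x| ≤2 * p.L ^2 := by nlinarith [p.hεL, p.hL]
  have e : ka p = p.la * p.s * (1 + p.la) := rfl
  rw [abs_mul, e, abs_of_nonneg (by positivity)]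
  calc p.la * p.s * (1 + p.la) * |x| ≤ (2 * p.μ) * p.L ^2 * (1 +1) * (2 * p.L ^2) := by
        gcongr; linarith
    _ =8 * (p.μ * p.L ^4) := by ring
    _ ≤ _ := by linarith [p.hμL]
lemma kpx (p : Pt) {x : ℝ} (hx : |x| ≤4 * p.L ^2) : |kp p * x| ≤12 /100 := by
  rw [abs_mul, abs_of_nonneg p.kp0]
  calc kp p * |x| ≤ kp p * (4 * p.L ^2) := mL hx p.kp0
    _ =4 * (kp p * p.L ^2) := by ring
    _ ≤ _ := by linarith [p.kpL]
lemma half {x : ℝ} (hx : |x| ≤12 /100) :1 /2 ≤1 + x := by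
  have := (abs_le.1 hx).1; linarith
lemma addL (p : Pt) {x y : ℝ} (hx : |x| ≤2 * p.L ^2) (hy : |y| ≤2 * p.L ^2) :
    |x + y| ≤4 * p.L ^2 := (abs_add_le _ _).trans (by linarith)

end Pt

def phi (μ la kp u w : ℝ) : ℝ := μ * (1 + u) * (1 + w) / (1 + la * u * w) * (1 + kp * (u + w))
def rho (la ka h u t : ℝ) : ℝ :=
  (1 + u) * (1 - la * (t - h)) / ((1 + t) * (1 - la * (u - h))) * (1 + ka * (u - t))

namespace Pt

def Q0 : Pt → ℝ := 1 + la * u * w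
def Q1 : Pt → ℝ := 1 + la * (u - h) * (w - h)
def Q2 : Pt → ℝ := 1 + kp * (u + w)
def Q3 : Pt → ℝ := 1 - la * (u - h)
def ph : Pt → ℝ := μ * (1 + (u - h)) * (1 + (w - h)) * Q1⁻¹ * (1 + kp * ((u - h) + (w - h)))

lemma Q0h (p : Pt) :1 /2 ≤ Q0 p :=
  half ((p.aux_ab (p.absL p.hu) (p.absL p.hw)).trans (by norm_num))
lemma Q1h (p : Pt) :1 /2 ≤ Q1 p :=
  half ((p.aux_ab (p.absLh p.hu) (p.absLh p.hw)).trans (by norm_num))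
lemma Q2h (p : Pt) :1 /2 ≤ Q2 p :=
  half (p.kpx (p.addL (p.absL p.hu) (p.absL p.hw)))
lemma la1x (p : Pt) {x : ℝ} (hx : |x| ≤2 * p.L ^2) : |p.la * x| ≤1 /10 := by
  have h1 : |(1:ℝ)| ≤2 * p.L ^2 := by
    rw [abs_one]; nlinarith [p.hL]
  have := p.aux_ab hx h1
  rwa [mul_one] at this
lemma Q3h (p : Pt) :1 /2 ≤ Q3 p := by
  have := (p.la1x (p.absLh p.hu))
  have := (abs_le.1 this).2
  show 1 /2 ≤1 - p.la * (p.u - p.h)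
  linarith

lemma bup : Bd 0 1 (u - h) := bu.sub bh.of
lemma bwp : Bd 0 1 (w - h) := bw.sub bh.of
lemma btp : Bd 0 1 (t - h) := bt.sub bh.of
lemma bsig : Bd 0 1 (u + w) := bu.add bw
lemma bQ1 : Bd 0 0 Q1 := b1.add ((bla.mul bup).mul bwp).of
lemma bQ2 : Bd 0 0 Q2 := b1.add (bkp.mul bsig).of
lemma bQ3 : Bd 0 0 Q3 := b1.sub (bla.mul bup).of
lemma bph : Bd 1 0 ph := ((((bμ.mul (b1.add bup.of)).mul (b1.add bwp.of)).mul (binv Q1h)).mul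
  (b1.add (bkp.mul (bup.add bwp)).of))

/-- polynomial defect -/
def NA : Pt → ℝ := Q0 * ((1 - μ) * (1 - la * (w - h)) * Q3
    - μ * kp * (1 + (u - h)) * (1 + (w - h)) * ((u - h) + (w - h)))
  - (1 - μ) * (1 - la * (w - h)) * (1 - ka * (u + w)) * Q1 * Q2 * Q3

lemma bNA : Bd 1 4 NA := by
  have hq : Bd 1 1 (Q1 * Q3 * (1 - la * (w - h)) -1) := by
    have e : Q1 * Q3 * (1 - la * (w - h)) -1 =
      (la * (u - h)) * ((w - h) * (Q3 * (1 - la * (w - h)))) - la * (u - h) * (1 - la * (w - h))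
        - la * (w - h) := by unfold Q1 Q3; ring
    rw [e]
    exact ((((bla.mul bup).mul (bwp.mul (bQ3.mul (b1.sub (bla.mul bwp).of)))).of).sub
      ((bla.mul bup).mul (b1.sub (bla.mul bwp).of))).sub (bla.mul bwp)
  have hq2 : Bd 1 1 ((1 - la * (w - h)) * Q3 -1) := by
    have e : (1 - la * (w - h)) * Q3 -1 = - (la * (w - h) * Q3) - la * (u - h) := by
      unfold Q3; ring
    rw [e]
    exact ((bla.mul bwp).mul bQ3).neg.sub (bla.mul bup)
  have bm : Bd 0 0 (1 - μ) := b1.sub bμ.of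
  have h3 : Bd 0 2 (Q0 * (1 + (u - h)) * (1 + (w - h)) * ((u - h) + (w - h)) - (u + w)) := by
    have e : Q0 * (1 + (u - h)) * (1 + (w - h)) * ((u - h) + (w - h)) - (u + w) =
      (la * u * w) * ((1 + (u - h)) * (1 + (w - h)) * ((u - h) + (w - h)))
       + ((u - h) + (w - h)) * ((u - h) + (1 + (u - h)) * (w - h)) -2 * h := by
      unfold Q0; ring
    rw [e]
    exact ((((bla.mul bu).mul bw).mul (((b1.add bup.of).mul (b1.add bwp.of)).mul
      (bup.add bwp))).of.add ((bup.add bwp).mul (bup.add ((b1.add bup.of).mul bwp)))).sub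
      (b2.mul bh)
  have key : NA = (1 - μ) * ((ka - kp) * (u + w)) * (Q1 * Q3 * (1 - la * (w - h)) -1)
     + (1 - μ) * (Q1 * Q3 * (1 - la * (w - h))) * (ka * kp * (u + w) * (u + w))
     + (1 - μ) * (la * h * (u + w)) * ((1 - la * (w - h)) * Q3 -1)
     - (1 - μ) * (la * h * h) * ((1 - la * (w - h)) * Q3)
     - μ * kp * (Q0 * (1 + (u - h)) * (1 + (w - h)) * ((u - h) + (w - h)) - (u + w)) := by
    have r := rel
    have e1 : (1 - μ) * ka = la * s := by
      unfold ka; linear_combination (-la * s) * r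
    have e2 : (1 - μ) * la = μ := by linear_combination -r
    have e0 : Q0 = Q1 + la * (h * (u + w) - h * h) := by unfold Q0 Q1; ring
    have ek : kp = la * s + μ * h := rfl
    have e3 : (1 - μ) * ka - kp + μ * h =0 := by rw [e1, ek]; ring
    have eQ2 : Q2 =1 + kp * (u + w) := rfl
    unfold NA
    rw [eQ2]
    linear_combination ((1 - μ) * (1 - la * (w - h)) * Q3) * e0 + (u + w) * e3
      + (h * (u + w)) * e2
  rw [key]
  have bb : Bd 0 0 (1 - la * (w - h)) := b1.sub (bla.mul bwp).of
  refine ((((?_ : Bd 1 4 _).add ?_).add ?_).sub ?_).sub ?_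
  · exact ((bm.mul ((bka.sub bkp).mul bsig)).mul hq).of
  · exact ((bm.mul ((bQ1.mul bQ3).mul bb)).mul (((bka.mul bkp).mul bsig).mul bsig)).of
  · exact ((bm.mul ((bla.mul bh).mul bsig)).mul hq2).of
  · exact ((bm.mul ((bla.mul bh).mul bh)).mul (bb.mul bQ3)).of
  · exact ((bμ.mul bkp).mul h3).of

/-- `P(u)` -/
def PA : Pt → ℝ := Q0 * Q2⁻¹ * Q3⁻¹ * (1 - ph)
def EA : Pt → ℝ := PA - (1 - μ) * (1 - la * (w - h)) * (1 - ka * (u + w))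

lemma bEA : Bd 1 4 EA := by
  have key : EA = NA * (Q1⁻¹ * Q2⁻¹ * Q3⁻¹) := by
    have m1 := minv Q1h
    have m2 := minv Q2h
    have m3 := minv Q3h
    have hp : (1 - ph) = ((1 - μ) * (1 - la * (w - h)) * Q3
      - μ * kp * (1 + (u - h)) * (1 + (w - h)) * ((u - h) + (w - h))) * Q1⁻¹ := by
      have hQ : Q1 - μ * (1 + (u - h)) * (1 + (w - h)) = (1 - μ) * (1 - la * (w - h)) * Q3 := by
        have r := rel
        unfold Q1 Q3
        linear_combination (-(u - h) - (w - h) + (u - h) * (w - h) * la - (u - h) * (w - h)) * r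
      unfold ph
      linear_combination (-1 : Pt → ℝ) * m1 + Q1⁻¹ * hQ
    unfold EA PA NA
    rw [hp]
    linear_combination (-(1 - μ) * (1 - la * (w - h)) * (1 - ka * (u + w))) *
      (-Q2 * Q2⁻¹ * Q3 * Q3⁻¹ * m1 - Q3 * Q3⁻¹ * m2 - m3)
  rw [key]
  exact (bNA.mul (((binv Q1h).mul (binv Q2h)).mul (binv Q3h))).of

/-- defect in HA -/
def dA : Pt → ℝ := (Q3 * Q2 * Q0⁻¹) ∘ sw * (PA ∘ sw - (1 + ka * (u - t)) * PA)

lemma bdA : Bd 1 4 dA := by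
  have e : PA ∘ sw - (1 + ka * (u - t)) * PA =
      EA ∘ sw - (1 + ka * (u - t)) * EA +
        (1 - μ) * (1 - la * (w - h)) * (ka * ka * (u - t) * (u + w)) := by
    have e2 : EA ∘ sw = PA ∘ sw - (1 - μ) * (1 - la * (w - h)) * (1 - ka * (t + w)) := rfl
    rw [e2]; unfold EA; ring
  unfold dA
  rw [e]
  have hd : Bd 0 1 (u - t) := bu.sub bt
  refine ((((bQ3.mul bQ2).mul (binv Q0h)).sw).mul (((bEA.sw).sub
    (((b1.add (bka.mul hd).of).mul bEA).of)).add ?_)).of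
  exact (((b1.sub bμ.of).mul (b1.sub (bla.mul bwp).of)).mul
    (((bka.mul bka).mul hd).mul bsig)).of

lemma phi_ph (p : Pt) : phi p.μ p.la (kp p) (p.u - p.h) (p.w - p.h) = ph p := by
  simp only [phi, ph, Q1, Pi.mul_apply, Pi.add_apply, Pi.sub_apply, Pi.inv_apply, Pi.one_apply]
  ring

lemma HA_bd : ∃ C : ℝ, ∃ c : ℕ, 0 ≤ C ∧ ∀ p : Pt, 0 ≤1 + p.u → 0 <1 + p.t → 0 ≤1 + p.w →
    |phi p.μ p.la (kp p) p.u p.w * (1 - phi p.μ p.la (kp p) (p.t - p.h) (p.w - p.h))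
      - rho p.la (ka p) p.h p.u p.t * (1 - phi p.μ p.la (kp p) (p.u - p.h) (p.w - p.h)) *
        phi p.μ p.la (kp p) p.t p.w| ≤
      C * (p.μ * p.ε ^4 * p.L ^ c) * phi p.μ p.la (kp p) p.u p.w := by
  obtain ⟨C, c, hC, h⟩ := bdA
  refine ⟨C, c, hC, fun p h1 h2 h3 => ?_⟩
  have q0 := p.Q0h; have q2 := p.Q2h; have q3 := p.Q3h; have q1 := p.Q1h
  have r0 := p.sw.Q0h; have r2 := p.sw.Q2h; have r3 := p.sw.Q3h; have r1 := p.sw.Q1h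
  have hphi :0 ≤ phi p.μ p.la (kp p) p.u p.w := by
    have e : phi p.μ p.la (kp p) p.u p.w = p.μ * (1 + p.u) * (1 + p.w) / Q0 p * Q2 p := rfl
    have := p.hμ
    rw [e]
    have :0 < Q0 p := by linarith
    have :0 < Q2 p := by linarith
    positivity
  have key : phi p.μ p.la (kp p) p.u p.w * (1 - phi p.μ p.la (kp p) (p.t - p.h) (p.w - p.h))
      - rho p.la (ka p) p.h p.u p.t * (1 - phi p.μ p.la (kp p) (p.u - p.h) (p.w - p.h)) *
        phi p.μ p.la (kp p) p.t p.w = dA p * phi p.μ p.la (kp p) p.u p.w := by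
    have e1 := p.phi_ph
    have e2 : phi p.μ p.la (kp p) (p.t - p.h) (p.w - p.h) = ph p.sw := p.sw.phi_ph
    have e3 : phi p.μ p.la (kp p) p.u p.w = p.μ * (1 + p.u) * (1 + p.w) / Q0 p * Q2 p := rfl
    have e4 : phi p.μ p.la (kp p) p.t p.w = p.μ * (1 + p.t) * (1 + p.w) / Q0 p.sw * Q2 p.sw := rfl
    have e5 : rho p.la (ka p) p.h p.u p.t = (1 + p.u) * Q3 p.sw / ((1 + p.t) * Q3 p) *
      (1 + ka p * (p.u - p.t)) := rfl
    have e6 : dA p = Q3 p.sw * Q2 p.sw * (Q0 p.sw)⁻¹ * (Q0 p.sw * (Q2 p.sw)⁻¹ * (Q3 p.sw)⁻¹ *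
      (1 - ph p.sw) - (1 + ka p * (p.u - p.t)) * (Q0 p * (Q2 p)⁻¹ * (Q3 p)⁻¹ * (1 - ph p))) := rfl
    rw [e1, e2, e3, e4, e5, e6]
    have n0 : Q0 p ≠ 0 := by linarith
    have n2 : Q2 p ≠ 0 := by linarith
    have n3 : Q3 p ≠ 0 := by linarith
    have k0 : Q0 p.sw ≠ 0 := by linarith
    have k2 : Q2 p.sw ≠ 0 := by linarith
    have k3 : Q3 p.sw ≠ 0 := by linarith
    have nt := h2.ne'
    generalize Q0 p = a0 at *
    generalize Q2 p = a2 at *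
    generalize Q3 p = a3 at *
    generalize Q0 p.sw = c0 at *
    generalize Q2 p.sw = c2 at *
    generalize Q3 p.sw = c3 at *
    field_simp
  rw [key, abs_mul, abs_of_nonneg hphi]
  refine mR ?_ hphi
  simpa using h p

end Pt

namespace Pt

def EE : Pt → ℝ := (1 + kp * ((u - h) + (w - h))) * Q1⁻¹
def R4 : Pt → ℝ := 1 + la * t * (w - h)
def T4 : Pt → ℝ := 1 + kp * (t + w)
def rr : Pt → ℝ := (1 + la * t * w) * (1 + kp * (t + (w - h))) * (R4⁻¹ * T4⁻¹)
def ps : Pt → ℝ := ph - μ * h * (1 + (u - h)) * EE + ph * μ * h * (1 + (u - h) + t)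
def br : Pt → ℝ := (1 - ph) * (1 + μ * h * (1 + u + t)) - rr * (1 - ps)
def bq : Pt → ℝ := μ * h * (1 + u + t) * (1 - ph)

lemma R4h (p : Pt) :1 /2 ≤ R4 p :=
  half ((p.aux_ab (p.absL p.ht) (p.absLh p.hw)).trans (by norm_num))
lemma T4h (p : Pt) :1 /2 ≤ T4 p :=
  half (p.kpx (p.addL (p.absL p.ht) (p.absL p.hw)))

lemma ph_EE : ph = μ * (1 + (u - h)) * (1 + (w - h)) * EE := by unfold ph EE; ring

lemma bEE1 : Bd 1 2 (EE -1) := by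
  have e : EE -1 = (kp * ((u - h) + (w - h)) - (la * (u - h)) * (w - h)) * Q1⁻¹ := by
    have m1 := minv Q1h
    have : Q1 =1 + la * (u - h) * (w - h) := rfl
    unfold EE
    linear_combination m1 - Q1⁻¹ * this
  rw [e]
  exact (((bkp.mul (bup.add bwp)).of).sub ((bla.mul bup).mul bwp)).mul (binv Q1h)

lemma bEE : Bd 0 0 EE := by
  have e : EE =1 + (EE -1) := by ring
  rw [e]; exact b1.add bEE1.of

lemma bphμ : Bd 1 1 (ph - μ) := by
  have e : ph - μ = μ * ((u - h) * ((1 + (w - h)) * EE) + (w - h) * EE + (EE -1)) := by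
    rw [ph_EE]; ring
  rw [e]
  exact bμ.mul ((((bup.mul ((b1.add bwp.of).mul bEE))).add (bwp.mul bEE)).add bEE1.of)

lemma brr : Bd 1 4 (rr -1 - la * t * h) := by
  have e : rr -1 - la * t * h = -(kp * h * T4⁻¹) - (la * t * h) * (kp * h * (R4⁻¹ * T4⁻¹))
      - (la * t * h) * (la * t * (w - h)) * R4⁻¹ := by
    have m1 := minv R4h
    have m2 := minv T4h
    have e1 : R4 =1 + la * t * (w - h) := rfl
    have e2 : T4 =1 + kp * (t + w) := rfl
    have a1 :1 + la * t * w = R4 + la * t * h := by rw [e1]; ring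
    have a2 :1 + kp * (t + (w - h)) = T4 - kp * h := by rw [e2]; ring
    have a3 : la * t * (w - h) = R4 -1 := by rw [e1]; ring
    unfold rr
    rw [a1, a2, a3]
    linear_combination (T4 * T4⁻¹ - kp * h * T4⁻¹ + la * t * h) * m1 + (1 + la * t * h * R4⁻¹) * m2
  rw [e]
  have hh : Bd 1 3 (la * t * h) := (bla.mul bt).mul bh
  exact ((((bkp.mul bh).mul (binv T4h)).neg.of).sub
    (hh.mul ((bkp.mul bh).mul ((binv R4h).mul (binv T4h)))).of).sub
    ((hh.mul ((bla.mul bt).mul bwp)).mul (binv R4h)).of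

lemma bps : Bd 1 1 (ps - μ) := by
  have e : ps - μ = (ph - μ) - (μ * h) * ((1 + (u - h)) * EE) + ph * (μ * h * (1 + (u - h) + t)) := by
    unfold ps; ring
  rw [e]
  exact (bphμ.sub ((bμ.mul bh).mul ((b1.add bup.of).mul bEE)).of).add
    (bph.mul ((bμ.mul bh).mul ((b1.add bup.of).add bt.of))).of

lemma bbr : Bd 1 4 br := by
  have e : br = μ * h * h - (μ * h * (1 + (u - h))) * (EE -1) - ph * (μ * h * h)
      + (la * t * h) * (ps - μ) - (rr -1 - la * t * h) * (1 - ps) := by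
    have r := rel
    have hp : ps = ph - μ * h * (1 + (u - h)) * EE + ph * μ * h * (1 + (u - h) + t) := rfl
    unfold br
    linear_combination hp + (t * h) * r
  rw [e]
  have b1ps : Bd 0 0 (1 - ps) := by
    have :1 - ps =1 - μ - (ps - μ) := by ring
    rw [this]; exact (b1.sub bμ.of).sub bps.of
  refine (((((bμ.mul bh).mul bh).sub ((((bμ.mul bh).mul (b1.add bup.of)).mul bEE1).of)).sub
    (bph.mul ((bμ.mul bh).mul bh)).of).add
    ((((bla.mul bt).mul bh).mul bps).of)).sub (brr.mul b1ps)

lemma bbq : Bd 1 2 bq :=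
  ((bμ.mul bh).mul ((b1.add bu.of).add bt.of)).mul (b1.sub bph.of)

lemma phi_nonneg (p : Pt) (h1 :0 ≤1 + p.u) (h3 :0 ≤1 + p.w) :
    0 ≤ phi p.μ p.la (kp p) p.u p.w := by
  have q0 := p.Q0h; have q2 := p.Q2h
  have e : phi p.μ p.la (kp p) p.u p.w = p.μ * (1 + p.u) * (1 + p.w) / Q0 p * Q2 p := rfl
  have := p.hμ
  rw [e]
  have :0 < Q0 p := by linarith
  have :0 < Q2 p := by linarith
  positivity

lemma HC_bd : ∃ C : ℝ, ∃ c : ℕ, 0 ≤ C ∧ ∀ p : Pt, ∀ θ θ2 : ℝ, 0 ≤1 + p.u → 0 ≤1 + p.t →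
    0 ≤1 + p.w → 0 ≤ θ → θ ≤1 → θ ≤4 * p.ε ^2 → θ * (1 + p.w) = p.h →
    (θ =1 ∨ θ2 * (1 + (p.w - p.h)) = p.h) →
    |phi p.μ p.la (kp p) p.u p.w * phi p.μ p.la (kp p) p.t p.w *
        (1 - θ + p.μ * p.h * (1 + p.u + p.t)) * (1 - phi p.μ p.la (kp p) (p.u - p.h) (p.w - p.h))
      - phi p.μ p.la (kp p) p.u p.w * (phi p.μ p.la (kp p) p.t (p.w - p.h) -
        phi p.μ p.la (kp p) (p.u - p.h) (p.w - p.h) * phi p.μ p.la (kp p) p.t (p.w - p.h) *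
          (1 - θ2 + p.μ * p.h * (1 + (p.u - p.h) + p.t)))| ≤
      C * (p.μ * p.ε ^4 * p.L ^ c) *
        (phi p.μ p.la (kp p) p.u p.w * phi p.μ p.la (kp p) p.t p.w) := by
  obtain ⟨C, c, hC, hb⟩ := bbr
  obtain ⟨C', c', hC', hb'⟩ := bbq
  refine ⟨C +4 * C', c + c', by positivity, fun p θ θ2 h1 h2 h3 t0 t1 t2 t3 t4 => ?_⟩
  have n1 := p.phi_nonneg h1 h3
  have n2 :0 ≤ phi p.μ p.la (kp p) p.t p.w := p.sw.phi_nonneg h2 h3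
  have key : phi p.μ p.la (kp p) p.u p.w * phi p.μ p.la (kp p) p.t p.w *
        (1 - θ + p.μ * p.h * (1 + p.u + p.t)) * (1 - phi p.μ p.la (kp p) (p.u - p.h) (p.w - p.h))
      - phi p.μ p.la (kp p) p.u p.w * (phi p.μ p.la (kp p) p.t (p.w - p.h) -
        phi p.μ p.la (kp p) (p.u - p.h) (p.w - p.h) * phi p.μ p.la (kp p) p.t (p.w - p.h) *
          (1 - θ2 + p.μ * p.h * (1 + (p.u - p.h) + p.t))) =
      ((1 - θ) * br p + θ * bq p) * (phi p.μ p.la (kp p) p.u p.w * phi p.μ p.la (kp p) p.t p.w) := by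
    have er : phi p.μ p.la (kp p) p.t (p.w - p.h) =
        phi p.μ p.la (kp p) p.t p.w * (1 - θ) * rr p := by
      have e1 : phi p.μ p.la (kp p) p.t p.w =
        p.μ * (1 + p.t) * (1 + p.w) / (1 + p.la * p.t * p.w) * T4 p := rfl
      have e2 : phi p.μ p.la (kp p) p.t (p.w - p.h) =
        p.μ * (1 + p.t) * (1 + (p.w - p.h)) / R4 p * (1 + kp p * (p.t + (p.w - p.h))) := rfl
      have e3 : rr p = (1 + p.la * p.t * p.w) * (1 + kp p * (p.t + (p.w - p.h))) *
        ((R4 p)⁻¹ * (T4 p)⁻¹) := rfl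
      rw [e1, e2, e3, show 1 + (p.w - p.h) = (1 + p.w) * (1 - θ) by rw [← t3]; ring]
      have := p.R4h; have := p.T4h; have := p.sw.Q0h
      have k1 : R4 p ≠ 0 := by linarith
      have k2 : T4 p ≠ 0 := by linarith
      have k3 :1 + p.la * p.t * p.w ≠ 0 := by
        have :1 /2 ≤1 + p.la * p.t * p.w := this
        linarith
      generalize 1 + p.la * p.t * p.w = a1 at *
      generalize R4 p = a at *
      generalize T4 p = b at *
      field_simp
    rw [p.phi_ph, er]
    have eb : br p = (1 - ph p) * (1 + p.μ * p.h * (1 + p.u + p.t)) - rr p * (1 - ps p) := rfl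
    have eq : bq p = p.μ * p.h * (1 + p.u + p.t) * (1 - ph p) := rfl
    have hps : (1 - θ) * ps p = (1 - θ) * (ph p * (1 - θ2 + p.μ * p.h * (1 + (p.u - p.h) + p.t))) := by
      rcases t4 with t4 | t4
      · rw [t4]; ring
      · have e1 : ps p = ph p - p.μ * p.h * (1 + (p.u - p.h)) * EE p +
          ph p * p.μ * p.h * (1 + (p.u - p.h) + p.t) := rfl
        have e2 : ph p = p.μ * (1 + (p.u - p.h)) * (1 + (p.w - p.h)) * EE p := congrFun ph_EE p
        rw [e1]
        linear_combination (1 - θ) * (θ2 * e2 + p.μ * (1 + (p.u - p.h)) * EE p * t4)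
    rw [eb, eq]
    linear_combination (-rr p * phi p.μ p.la (kp p) p.u p.w * phi p.μ p.la (kp p) p.t p.w) * hps
  rw [key, abs_mul, abs_of_nonneg (mul_nonneg n1 n2)]
  refine mR ?_ (mul_nonneg n1 n2)
  have hm := p.hμ; have he := p.hε; have hL := p.hL; have := p.L0
  calc |(1 - θ) * br p + θ * bq p| ≤ (1 - θ) * |br p| + θ * |bq p| := by
        refine (abs_add_le _ _).trans ?_
        rw [abs_mul, abs_mul, abs_of_nonneg t0, abs_of_nonneg (sub_nonneg.2 t1)]
    _ ≤1 * (C * (p.μ ^1 * p.ε ^4 * p.L ^ c)) +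
        (4 * p.ε ^2) * (C' * (p.μ ^1 * p.ε ^2 * p.L ^ c')) :=
        add_le_add (mul_le_mul (by linarith) (hb p) (abs_nonneg _) (by norm_num))
          (mul_le_mul t2 (hb' p) (abs_nonneg _) (by positivity))
    _ ≤1 * (C * (p.μ ^1 * p.ε ^4 * p.L ^ (c + c'))) +
        (4 * p.ε ^2) * (C' * (p.μ ^1 * p.ε ^2 * p.L ^ (c + c'))) := by
        gcongr <;> first | exact hL | omega
    _ = _ := by ring

end Pt

def gg (la kp u w : ℝ) : ℝ := (1 + u) * (1 + kp * (u + w)) / (1 + la * u * w)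
def qq (μ la kp h u t w : ℝ) : ℝ := ((1 + w) ^2 - h * (1 + w) + μ * h * (1 + w) ^2 * (1 + u + t)) *
  ((1 + kp * (u + w)) * (1 + kp * (t + w)) / ((1 + la * u * w) * (1 + la * t * w)))

namespace Pt

lemma bg : Bd 1 4 (fun p => gg p.la (kp p) p.u p.w -
    (1 + p.u + kp p * p.w + (kp p - p.la * p.w) * p.u - p.la * p.w * p.u ^2)) := by
  have key : (fun p => gg p.la (kp p) p.u p.w -
    (1 + p.u + kp p * p.w + (kp p - p.la * p.w) * p.u - p.la * p.w * p.u ^2)) =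
    kp * (u + w) * u + (kp * (u + w) + la * u * w * (-kp * (u + w) + la * u * w)) *0
    - (1 + u) * (la * u * w) * (kp * (u + w) - la * u * w) * Q0⁻¹ := by
    funext p
    have := p.Q0h
    have e : gg p.la (kp p) p.u p.w = (1 + p.u) * (1 + kp p * (p.u + p.w)) * (Q0 p)⁻¹ := by
      rw [← div_eq_mul_inv]; rfl
    have e2 : Q0 p =1 + p.la * p.u * p.w := rfl
    have m : Q0 p * (Q0 p)⁻¹ =1 := mul_inv_cancel₀ (by linarith)
    rw [e]
    simp only [Pi.mul_apply, Pi.add_apply, Pi.sub_apply, Pi.inv_apply, Pi.one_apply, Pi.neg_apply,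
      Pi.zero_apply]
    linear_combination (1 + p.u) * (1 + kp p * (p.u + p.w) - p.la * p.u * p.w) * m
      - (1 + p.u) * (1 + kp p * (p.u + p.w) - p.la * p.u * p.w) * (Q0 p)⁻¹ * e2
  rw [key]
  refine ((((bkp.mul bsig).mul bu)).add ?_).sub ?_
  · rw [mul_zero]; exact (bnum 0).mul (be1) |>.congr (by ext; simp) |>.of
  · exact ((((b1.add bu.of).mul ((bla.mul bu).mul bw)).mul
      (((bkp.mul bsig).of).sub ((bla.mul bu).mul bw))).mul (binv Q0h)).of

lemma bA2 : Bd 1 4 (kp * w + (1 + kp - la * w) * (e1 - w * (μ * h)) -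
    la * w * (s + e2 - w * w * (μ * h))) := by
  have key : kp * w + (1 + kp - la * w) * (e1 - w * (μ * h)) -
    la * w * (s + e2 - w * w * (μ * h)) =
    (1 + kp - la * w) * e1 - kp * (w * (μ * h)) + (la * w) * (w * (μ * h)) - la * w * e2
     + (la * w) * (w * w * (μ * h)) := by
    unfold kp; ring
  rw [key]
  have bmh : Bd 1 2 (μ * h) := bμ.mul bh
  exact (((((((b1.add bkp.of).sub (bla.mul bw).of).mul be1).of).sub
    (bkp.mul (bw.mul bmh)).of).add ((bla.mul bw).mul (bw.mul bmh)).of).sub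
    ((bla.mul bw).mul be2).of).add ((bla.mul bw).mul ((bw.mul bw).mul bmh)).of

def Q0t : Pt → ℝ := 1 + la * t * w
lemma Q0th (p : Pt) :1 /2 ≤ Q0t p := p.sw.Q0h
def Nn : Pt → ℝ := kp * (u + t +2 * w) - la * (u + t) * w +
  (kp * kp * (u + w) * (t + w) - (la * u * w) * (la * t * w))
def XX : Pt → ℝ := Nn * (Q0⁻¹ * Q0t⁻¹)

lemma bsum3 : Bd 0 1 (u + t +2 * w) := (bu.add bt).add (b2.mul bw)

lemma bNn : Bd 1 2 Nn :=
  ((bkp.mul bsum3).of.sub ((bla.mul (bu.add bt)).mul bw)).add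
    ((((bkp.mul bkp).mul bsig).mul (bt.add bw)).of.sub
      ((((bla.mul bu).mul bw).mul ((bla.mul bt).mul bw)).of))

lemma bXX : Bd 1 2 XX := bNn.mul ((binv Q0h).mul (binv Q0th))

lemma bX1 : Bd 1 4 (XX - (kp * (u + t +2 * w) - la * (u + t) * w)) := by
  have e : XX - (kp * (u + t +2 * w) - la * (u + t) * w) =
      (kp * kp * (u + w) * (t + w) - (la * u * w) * (la * t * w)) +
      Nn * ((-(la * u * w) * Q0t - la * t * w) * (Q0⁻¹ * Q0t⁻¹)) := by
    have m1 := minv Q0h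
    have m2 := minv Q0th
    have e1 : Q0 =1 + la * u * w := rfl
    have e2 : Q0t =1 + la * t * w := rfl
    have e3 : Nn = kp * (u + t +2 * w) - la * (u + t) * w +
      (kp * kp * (u + w) * (t + w) - (la * u * w) * (la * t * w)) := rfl
    unfold XX
    have e4 : -(la * u * w) * Q0t - la * t * w =1 - Q0 * Q0t := by rw [e1, e2]; ring
    rw [e4]
    linear_combination e3 + Nn * (m1 * Q0t * Q0t⁻¹ + m2)
  rw [e]
  exact ((((bkp.mul bkp).mul bsig).mul (bt.add bw)).of.sub
      ((((bla.mul bu).mul bw).mul ((bla.mul bt).mul bw)).of)).add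
    (bNn.mul ((((((bla.mul bu).mul bw).neg.mul
      (b1.add ((bla.mul bt).mul bw).of : Bd 0 0 Q0t))).sub ((bla.mul bt).mul bw)).mul
        ((binv Q0h).mul (binv Q0th)))).of

lemma bqq : Bd 1 4 (fun p => qq p.μ p.la (kp p) p.h p.u p.t p.w -
    ((1 + p.w) ^2 - p.h * (1 + p.w) + (kp p + p.μ * p.h) * (p.u + p.t +2 * p.w) + p.μ * p.h
      - p.la * (p.u + p.t) * (p.w +2 * p.w ^2))) := by
  have key : (fun p => qq p.μ p.la (kp p) p.h p.u p.t p.w -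
    ((1 + p.w) ^2 - p.h * (1 + p.w) + (kp p + p.μ * p.h) * (p.u + p.t +2 * p.w) + p.μ * p.h
      - p.la * (p.u + p.t) * (p.w +2 * p.w ^2))) =
    (1 + w) * (1 + w) * (XX - (kp * (u + t +2 * w) - la * (u + t) * w)) +
    (w * (2 + w)) * (kp * (u + t +2 * w)) - la * (u + t) * w * (w * w) +
    (-(h * (1 + w)) + μ * h * ((1 + w) * (1 + w) * (1 + u + t))) * XX +
    μ * h * (w * w * (1 + u + t) +2 * w * (u + t)) := by
    funext p
    have e : qq p.μ p.la (kp p) p.h p.u p.t p.w = ((1 + p.w) ^2 - p.h * (1 + p.w) +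
      p.μ * p.h * (1 + p.w) ^2 * (1 + p.u + p.t)) * (1 + XX p) := by
      have e1 : Q0 p =1 + p.la * p.u * p.w := rfl
      have e2 : Q0t p =1 + p.la * p.t * p.w := rfl
      have h1 := p.Q0h
      have h2 := p.Q0th
      have n1 : Q0 p ≠ 0 := by linarith
      have n2 : Q0t p ≠ 0 := by linarith
      unfold qq
      congr 1
      have e3 : XX p = (kp p * (p.u + p.t +2 * p.w) - p.la * (p.u + p.t) * p.w +
        (kp p * kp p * (p.u + p.w) * (p.t + p.w) - (p.la * p.u * p.w) * (p.la * p.t * p.w)))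
        * ((Q0 p)⁻¹ * (Q0t p)⁻¹) := rfl
      rw [e3, ← e1, ← e2, div_eq_iff (mul_ne_zero n1 n2)]
      field_simp
      rw [e1, e2]; ring
    rw [e]
    simp only [Pi.mul_apply, Pi.add_apply, Pi.sub_apply, Pi.one_apply, Pi.neg_apply,
      Pi.ofNat_apply]
    ring
  rw [key]
  have bmh : Bd 1 2 (μ * h) := bμ.mul bh
  have b1w : Bd 0 0 (1 + w) := b1.add bw.of
  have b1ut : Bd 0 0 (1 + u + t) := (b1.add bu.of).add bt.of
  have but : Bd 0 1 (u + t) := bu.add bt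
  refine (((((b1w.mul b1w).mul bX1).add
    ((bw.mul (b2.add bw.of)).mul (bkp.mul bsum3)).of).sub
    (((bla.mul but).mul bw).mul (bw.mul bw)).of).add ?_).add ?_
  · exact ((((bh.mul b1w).neg).add (bmh.mul ((b1w.mul b1w).mul b1ut)).of).mul bXX).of
  · exact (bmh.mul (((bw.mul bw).mul b1ut).add ((b2.mul bw).mul but))).of

def Et : Pt → ℝ := (1 + kp * (u + t)) * (1 + la * u * t)⁻¹

lemma bEt : Bd 1 2 (Et -1) := by
  have hh : ∀ p, 1 /2 ≤ (1 + la * u * t) p := fun p =>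
    half ((p.aux_ab (p.absL p.hu) (p.absL p.ht)).trans (by norm_num))
  have e : Et -1 = (kp * (u + t) - la * u * t) * (1 + la * u * t)⁻¹ := by
    have m := minv hh
    unfold Et; linear_combination m
  rw [e]
  exact ((bkp.mul (bu.add bt)).of.sub ((bla.mul bu).mul bt)).mul (binv hh)

def WW : Pt → ℝ := (1 - μ * h) * (1 - h + μ * h + (kp + μ * h) * (u + t)) +
  (2 - h +2 * (kp + μ * h) - la * (u + t)) * (e1 - (u + t) * (μ * h)) +
  (1 -2 * la * (u + t)) * (s + e2 - (u * u + t * t) * (μ * h)) + h * Et -1 - s + la * s * (u + t)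

lemma bWW : Bd 1 4 WW := by
  have e : WW = - (μ * h) * (- h + μ * h + (kp + μ * h) * (u + t)) +
   (2 - h +2 * (kp + μ * h) - la * (u + t)) * e1 +
   (h -2 * (kp + μ * h) + la * (u + t)) * ((u + t) * (μ * h)) +
   (1 -2 * la * (u + t)) * (e2 - (u * u + t * t) * (μ * h)) + h * (Et -1) := by
    unfold WW
    have : kp = la * s + μ * h := rfl
    linear_combination (u + t) * this
  rw [e]
  have bmh : Bd 1 2 (μ * h) := bμ.mul bh
  have but : Bd 0 1 (u + t) := bu.add bt
  have b3 : Bd 0 2 (- h + μ * h + (kp + μ * h) * (u + t)) :=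
    (bh.neg.add bmh.of).add ((bkp.add bmh).mul but).of
  have bla2 : Bd 0 1 (la * (u + t)) := (bla.mul but).of
  refine ((((?_ : Bd 1 4 _).add ?_).add ?_).add ?_).add ?_
  · exact bmh.neg.mul b3
  · exact ((((b2.sub bh.of).add (b2.mul (bkp.add bmh)).of).sub bla2.of).mul be1).of
  · exact ((((bh.of.sub (b2.mul (bkp.add bmh)).of).add bla2)).mul (but.mul bmh)).of
  · refine ((b1.sub ((b2.mul bla).mul but).of).mul (be2.sub
      (((bu.mul bu).add (bt.mul bt)).mul bmh).of)).of
  · exact (bh.mul bEt).of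

def Ga : Pt → ℝ := s - la * s * (u + t)
def aA : Pt → ℝ := μ * (1 + (u - h))
def aB : Pt → ℝ := μ * (1 + (t - h))
lemma Ah (p : Pt) :1 /2 ≤ (1 - aA) p := by
  have h1 := p.Q3h
  have h2 := p.hrel
  have h3 := p.hμ
  have h4 := (abs_le.1 (p.la1x (p.absLh p.hu))).2
  have h5 := p.μ1
  have h6 : p.μ * (p.u - p.h) ≤1 /10 := by
    have := (abs_le.1 (p.la1x (p.absLh p.hu)))
    rcases le_or_gt 0 (p.u - p.h) with h | h
    · have : p.μ ≤ p.la := by nlinarith [p.la0]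
      nlinarith
    · nlinarith
  show 1 /2 ≤1 - p.μ * (1 + (p.u - p.h))
  nlinarith

def ZZ : Pt → ℝ := (1 - aB) * (1 - aA)⁻¹ * (1 + ka * (u - t)) * ((1 - aA) - aA * Ga)
  - ((1 - aB) - aB * Ga)

lemma baA : Bd 1 0 aA := bμ.mul (b1.add bup.of)
lemma baB : Bd 1 0 aB := bμ.mul (b1.add btp.of)
lemma bGa : Bd 0 2 Ga := bs.sub ((bla.mul bs).mul (bu.add bt)).of

lemma bZZ : Bd 2 4 ZZ := by
  have e : ZZ = ((μ * s * (u - t)) * (2 * h * la + la * (u - h) * (la * (t - h)))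
      - ka * (u - t) * Ga * ((1 - aB) * aA)) * (1 - aA)⁻¹ := by
    have m := minv Ah
    have r := rel
    have hA :1 - aA = (1 - μ) * (1 - la * (u - h)) := by
      unfold aA; linear_combination (-(u - h)) * r
    have hB :1 - aB = (1 - μ) * (1 - la * (t - h)) := by
      unfold aB; linear_combination (-(t - h)) * r
    have e1 : (1 - μ) * ka = la * s := by
      unfold ka; linear_combination (-la * s) * r
    have e2 : (1 - μ) * la = μ := by linear_combination -r
    have k1 : (1 - aA) * (1 - aB) * ka = μ * s * ((1 - la * (u - h)) * (1 - la * (t - h))) := by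
      rw [hA, hB]
      linear_combination ((1 - μ) * (1 - la * (u - h)) * (1 - la * (t - h))) * e1 +
        (s * (1 - la * (u - h)) * (1 - la * (t - h))) * e2
    have k2 : (1 - aB) * aA - (1 - aA) * aB = μ * (u - t) := by unfold aA aB; ring
    have hG : Ga = s - la * s * (u + t) := rfl
    have k3 : (1 - aA) * (1 - aB) * ka * (u - t) - Ga * (μ * (u - t)) =
      (μ * s * (u - t)) * (2 * h * la + la * (u - h) * (la * (t - h))) := by
      rw [k1, hG]; ring
    rw [← k3, ← k2]
    unfold ZZ
    linear_combination ((1 - aB) - aB * Ga) * m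
  rw [e]
  have hd : Bd 0 1 (u - t) := bu.sub bt
  refine ((((bμ.mul bs).mul hd).mul (((b2.mul bh).mul bla).of.add
    ((bla.mul bup).mul (bla.mul btp)).of : Bd 1 1 _)).sub
    ((((bka.mul hd).mul bGa).mul ((b1.sub baB.of).mul baA)).of)).mul (binv Ah) |>.of

def yy : Pt → ℝ := ka * (u - t) + (u - t) * (h - u - t) * ((1 + la) * (1 + la)) * (μ * h * (μ * h))

lemma yy1 (p : Pt) : |yy p| ≤1 /5 := by
  have h1 : |p.u - p.t| ≤2 * p.ε := (abs_sub _ _).trans (by linarith [p.hu, p.ht])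
  have h2 := p.kax h1
  have h3 : |p.h - p.u - p.t| ≤3 * p.L ^2 := by
    have a := abs_le.1 p.hu; have b := abs_le.1 p.ht
    have := p.hL2; have := p.h0; have := p.hεL; have := p.hL
    rw [abs_le]; constructor <;> nlinarith
  have := p.hμ; have := p.L0; have := p.la0; have := p.h0
  have l1 : (1 + p.la) ≤2 := by linarith [p.la2, p.μ1]
  have e : yy p = ka p * (p.u - p.t) + (p.u - p.t) * (p.h - p.u - p.t) *
    ((1 + p.la) * (1 + p.la)) * (p.μ * p.h * (p.μ * p.h)) := rfl
  have h4 : |(p.u - p.t) * (p.h - p.u - p.t) *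
    ((1 + p.la) * (1 + p.la)) * (p.μ * p.h * (p.μ * p.h))| ≤1 /10 := by
    rw [abs_mul, abs_mul, abs_mul, abs_of_nonneg (show 0 ≤ (1 + p.la) * (1 + p.la) by positivity),
      abs_of_nonneg (show 0 ≤ p.μ * p.h * (p.μ * p.h) by positivity)]
    calc |p.u - p.t| * |p.h - p.u - p.t| * ((1 + p.la) * (1 + p.la)) * (p.μ * p.h * (p.μ * p.h))
        ≤ (2 * p.L ^2) * (3 * p.L ^2) * (2 *2) * (p.μ * p.L ^2 * (p.μ * p.L ^2)) := by
          have := p.hL2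
          have : |p.u - p.t| ≤2 * p.L ^2 := by nlinarith [p.hεL, p.hL]
          gcongr
      _ =24 * ((p.μ * p.L ^4) * (p.μ * p.L ^4)) := by ring
      _ ≤24 * ((1 /100) * (1 /100)) := by
          have := p.hμL
          gcongr
      _ ≤ _ := by norm_num
  rw [e]
  exact (abs_add_le _ _).trans (by linarith)

lemma byy : Bd 1 3 yy := by
  have hd : Bd 0 1 (u - t) := bu.sub bt
  have bmh : Bd 1 2 (μ * h) := bμ.mul bh
  exact (bka.mul hd).add (((hd.mul ((bh.of.sub bu).sub bt)).mul ((b1.add bla.of).mul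
    (b1.add bla.of))).mul (bmh.mul bmh)).of

lemma bRH : Bd 2 4 (fun p => Real.exp (yy p) - (1 + ka p * (p.u - p.t))) := by
  have hd : Bd 0 1 (u - t) := bu.sub bt
  have bmh : Bd 1 2 (μ * h) := bμ.mul bh
  obtain ⟨C, c, hC, hb⟩ := (byy.mul byy).of (j := 2) (k := 4)
  have h1 : Bd 2 4 (fun p => Real.exp (yy p) -1 - yy p) := ⟨C, c, hC, fun p => by
    refine (Real.abs_exp_sub_one_sub_id_le (p.yy1.trans (by norm_num))).trans ?_
    refine le_trans (le_abs_self _) ?_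
    rw [pow_two]; exact hb p⟩
  have h2 : Bd 2 4 ((u - t) * (h - u - t) * ((1 + la) * (1 + la)) * (μ * h * (μ * h))) :=
    (((hd.mul ((bh.of.sub bu).sub bt)).mul ((b1.add bla.of).mul
    (b1.add bla.of))).mul (bmh.mul bmh)).of
  refine (h1.add h2).congr ?_
  funext p
  simp only [yy, Pi.mul_apply, Pi.add_apply, Pi.sub_apply, Pi.one_apply]
  ring

end Pt

structure Stg where
  (n : ℕ) (d ε L : ℝ) (C : Fin n → ℤ) (ρ : ℤ)
  n2 :2 ≤ n
  d1 :1 ≤ d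
  ε0 :0 < ε
  hρ :1 ≤ ρ
  hC0 : ∀ i, 0 ≤ C i
  hCs : ∑ i, (C i : ℝ) = n * d +1
  hwin : ∀ i, |(C i : ℝ) - d| + (ρ +2) ≤ ε * d /2
  hh :1 / d ≤ ε ^2
  hρ2 :8 * (ρ +1) * (1 / d) ^2 ≤ ε ^4
  hL :1 ≤ L
  hεL : ε ≤ L
  hμL : d / ((n : ℝ) -1) * L ^4 ≤1 /1000

namespace Stg
variable (S : Stg)

def ν : ℝ := (S.n : ℝ) -1
def μ : ℝ := S.d / ((S.n : ℝ) -1)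
def la : ℝ := S.μ / (1 - S.μ)
def h : ℝ := 1 / S.d
def e (x : ℤ) : ℝ := x / S.d -1
def s : ℝ := (∑ i, (S.e (S.C i)) ^2) / S.ν
def kp : ℝ := S.la * S.s + S.μ * S.h
def ka : ℝ := S.la * S.s * (1 + S.la)
def F (x z : ℤ) : ℝ := phi S.μ S.la S.kp (S.e x) (S.e z)
def U (x z y : ℤ) : ℝ := S.F x z * S.F y z * (1 -1 / (z : ℝ) + S.μ * S.h * (1 + S.e x + S.e y))
def Ro (x y : ℤ) : ℝ := rho S.la S.ka S.h (S.e x) (S.e y)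
def W (x : ℤ) : Prop := |S.e x| ≤ S.ε

lemma dpos :0 < S.d := lt_of_lt_of_le one_pos S.d1
lemma νpos :0 < S.ν := by
  have : (2:ℝ) ≤ S.n := mod_cast S.n2
  unfold ν; linarith
lemma μpos :0 < S.μ := div_pos S.dpos S.νpos
lemma Lpos :0 < S.L := lt_of_lt_of_le one_pos S.hL
lemma μ1 : S.μ ≤1 /1000 := by
  have h1 :1 ≤ S.L ^4 := one_le_pow₀ S.hL
  have : S.μ * S.L ^4 ≤1 /1000 := S.hμL
  nlinarith [S.μpos]
lemma hrel : S.μ + S.μ * S.la = S.la := by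
  have := S.μ1
  unfold la; field_simp [show 1 - S.μ ≠ 0 by linarith]; ring
lemma hpos :0 < S.h := one_div_pos.2 S.dpos
lemma hd : S.h * S.d =1 := by unfold h; field_simp [S.dpos.ne']
lemma μν : S.μ * S.ν = S.d := by unfold μ; exact div_mul_cancel₀ _ S.νpos.ne'
lemma μh : S.μ * S.h * S.ν =1 := by
  have := S.μν; have := S.hd
  calc S.μ * S.h * S.ν = S.h * (S.μ * S.ν) := by ring
    _ =1 := by rw [S.μν, S.hd]
lemma e_sub (x : ℤ) : S.e (x -1) = S.e x - S.h := by
  unfold e h; push_cast; ring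
lemma ed (x : ℤ) : (x : ℝ) = S.d * (1 + S.e x) := by
  unfold e; field_simp [S.dpos.ne']; ring
lemma e1 {x : ℤ} (hx :0 ≤ x) :0 ≤1 + S.e x := by
  have := S.ed x
  have h1 : (0:ℝ) ≤ x := mod_cast hx
  rw [this] at h1
  exact nonneg_of_mul_nonneg_right h1 S.dpos
lemma e1' {x : ℤ} (hx :1 ≤ x) :0 <1 + S.e x := by
  have := S.ed x
  have h1 : (0:ℝ) < x := mod_cast hx
  rw [this] at h1
  exact pos_of_mul_pos_right h1 S.dpos.le

lemma eC (i : Fin S.n) : |S.e (S.C i)| ≤ S.ε /2 := by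
  have h1 := S.hwin i
  have h3 : (1:ℝ) ≤ S.ρ := mod_cast S.hρ
  have : S.e (S.C i) = ((S.C i : ℝ) - S.d) / S.d := by unfold e; field_simp [S.dpos.ne']
  rw [this, abs_div, abs_of_pos S.dpos, div_le_iff₀ S.dpos]; linarith

lemma s0 :0 ≤ S.s := div_nonneg (sum_nonneg fun _ _ => sq_nonneg _) S.νpos.le
lemma sε : S.s ≤ S.ε ^2 := by
  have hν : (S.n : ℝ) ≤2 * S.ν := by
    have : (2:ℝ) ≤ S.n := mod_cast S.n2
    unfold ν; linarith
  unfold s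
  rw [div_le_iff₀ S.νpos]
  calc ∑ i, (S.e (S.C i)) ^2 ≤ ∑ _i : Fin S.n, (S.ε /2) ^2 :=
        sum_le_sum fun i _ => sq_le_sq' (by linarith [(abs_le.1 (S.eC i)).1])
          (abs_le.1 (S.eC i)).2
    _ = S.n * (S.ε /2) ^2 := by simp
    _ ≤ (2 * S.ν) * (S.ε /2) ^2 := by gcongr
    _ ≤ _ := by nlinarith [S.νpos, mul_nonneg S.νpos.le (sq_nonneg S.ε)]

/-- the point with given degrees -/
def pt {x z y : ℤ} (hx : S.W x) (hz : S.W z) (hy : S.W y) (f1 f2 : ℝ)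
    (hf1 : |f1| ≤ S.μ * S.ε ^4 * S.L) (hf2 : |f2| ≤ S.μ * S.ε ^4 * S.L) : Pt where
  μ := S.μ
  la := S.la
  h := S.h
  s := S.s
  ε := S.ε
  L := S.L
  u := S.e x
  w := S.e z
  t := S.e y
  e1 := f1
  e2 := f2
  hμ := S.μpos
  hrel := S.hrel
  hL := S.hL
  hμL := le_trans S.hμL (by norm_num)
  hε := S.ε0
  hεL := S.hεL
  h0 := S.hpos.le
  hh := S.hh
  s0 := S.s0
  hs := S.sε
  hu := hx
  hw := hz
  ht := hy
  he1 := hf1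
  he2 := hf2

lemma z0 : |(0:ℝ)| ≤ S.μ * S.ε ^4 * S.L := by
  have := S.μpos; have := S.ε0; have := S.Lpos
  rw [abs_zero]; positivity

def p0 {x z y : ℤ} (hx : S.W x) (hz : S.W z) (hy : S.W y) : Pt := S.pt hx hz hy 0 0 S.z0 S.z0

-- numeric bounds
lemma Ynum {x z : ℤ} (hx : S.W x) (hz : S.W z) : |S.la * S.e x * S.e z| ≤1 /10 :=
  (S.p0 hx hz hx).aux_ab ((S.p0 hx hz hx).absL hx) ((S.p0 hx hz hx).absL hz)
lemma Xnum {x z : ℤ} (hx : S.W x) (hz : S.W z) : |S.kp * (S.e x + S.e z)| ≤12 /100 :=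
  (S.p0 hx hz hx).kpx ((S.p0 hx hz hx).addL ((S.p0 hx hz hx).absL hx) ((S.p0 hx hz hx).absL hz))

lemma F_low {x z : ℤ} (hx : S.W x) (hz : S.W z) (hx0 :0 ≤ x) (hz0 :0 ≤ z) :
    8 /10 * (S.μ * (1 + S.e x) * (1 + S.e z)) ≤ S.F x z ∧
      S.F x z ≤125 /100 * (S.μ * (1 + S.e x) * (1 + S.e z)) := by
  have h1 := abs_le.1 (S.Ynum hx hz)
  have h2 := abs_le.1 (S.Xnum hx hz)
  have h3 :0 ≤ S.μ * (1 + S.e x) * (1 + S.e z) :=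
    mul_nonneg (mul_nonneg S.μpos.le (S.e1 hx0)) (S.e1 hz0)
  unfold F phi
  set A := S.μ * (1 + S.e x) * (1 + S.e z)
  have hY :0 <1 + S.la * S.e x * S.e z := by linarith
  rw [div_mul_eq_mul_div A (1 + S.la * S.e x * S.e z), le_div_iff₀ hY, div_le_iff₀ hY]
  constructor <;> nlinarith

lemma Fnn {x z : ℤ} (hx : S.W x) (hz : S.W z) (hx0 :0 ≤ x) (hz0 :0 ≤ z) :0 ≤ S.F x z := by
  have h3 :0 ≤ S.μ * (1 + S.e x) * (1 + S.e z) :=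
    mul_nonneg (mul_nonneg S.μpos.le (S.e1 hx0)) (S.e1 hz0)
  linarith [(S.F_low hx hz hx0 hz0).1]

lemma F0 (z : ℤ) : S.F 0 z =0 := by unfold F phi e; simp
lemma Fsym (x z : ℤ) : S.F x z = S.F z x := by
  unfold F phi
  rw [show S.μ * (1 + S.e x) * (1 + S.e z) = S.μ * (1 + S.e z) * (1 + S.e x) by ring,
    show S.la * S.e x * S.e z = S.la * S.e z * S.e x by ring, add_comm (S.e x) (S.e z)]

lemma Fτ {x z : ℤ} (hx : S.W x) (hz : S.W z) (hx0 :0 ≤ x) (hz0 :0 ≤ z) :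
    S.F x z ≤5 * (S.μ * S.L ^2) := by
  have h1 := (abs_le.1 hx).2
  have h2 := (abs_le.1 hz).2
  have := S.hεL; have := S.hL; have := S.μpos
  have a1 :1 + S.e x ≤2 * S.L := by linarith
  have a2 :1 + S.e z ≤2 * S.L := by linarith
  have := S.e1 hx0; have := S.e1 hz0
  calc S.F x z ≤125 /100 * (S.μ * (1 + S.e x) * (1 + S.e z)) := (S.F_low hx hz hx0 hz0).2
    _ ≤125 /100 * (S.μ * (2 * S.L) * (2 * S.L)) := by gcongr
    _ = _ := by ring

lemma Fmono {x z : ℤ} (hx : S.W x) (hz : S.W z) (hz' : S.W (z -1)) (hx0 :0 ≤ x) (hz0 :1 ≤ z) :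
    S.F x (z -1) ≤2 * S.F x z := by
  have h1 := (S.F_low hx hz hx0 (by omega)).1
  have h2 := (S.F_low hx hz' hx0 (by omega)).2
  have h3 : S.μ * (1 + S.e x) * (1 + S.e (z -1)) ≤ S.μ * (1 + S.e x) * (1 + S.e z) := by
    refine mL ?_ (mul_nonneg S.μpos.le (S.e1 hx0))
    rw [S.e_sub]; linarith [S.hpos]
  have h4 :0 ≤ S.μ * (1 + S.e x) * (1 + S.e z) :=
    mul_nonneg (mul_nonneg S.μpos.le (S.e1 hx0)) (S.e1 (by omega))
  linarith

lemma Ubd {x z y : ℤ} (hx : S.W x) (hz : S.W z) (hy : S.W y) (hx0 :0 ≤ x) (hz0 :0 ≤ z)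
    (hy0 :0 ≤ y) : |S.U x z y| ≤2 * (S.F x z * S.F y z) := by
  have n1 := mul_nonneg (S.Fnn hx hz hx0 hz0) (S.Fnn hy hz hy0 hz0)
  unfold U
  rw [abs_mul, abs_of_nonneg n1, mul_comm]
  refine mR ?_ n1
  have a1 := abs_le.1 hx; have a2 := abs_le.1 hy
  have := S.hεL; have hL := S.hL; have := S.μpos; have := S.hpos
  have hh : S.h ≤1 := by unfold h; rw [div_le_one S.dpos]; exact S.d1
  have b0 := S.e1 hx0; have b1 := S.e1 hy0
  have hz1 :0 ≤1 / (z:ℝ) ∧ 1 / (z:ℝ) ≤1 := by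
    rcases hz0.lt_or_eq with h | h
    · have : (1:ℝ) ≤ z := mod_cast h
      exact ⟨by positivity, by rw [div_le_one (by linarith)]; exact this⟩
    · rw [← h]; simp
  have hm : S.μ * S.h * |1 + S.e x + S.e y| ≤1 /100 := by
    have : |1 + S.e x + S.e y| ≤3 * S.L := by rw [abs_le]; constructor <;> linarith
    have hL4 : S.L ≤ S.L ^4 := le_self_pow₀ hL (by norm_num)
    have h9 : S.μ * S.L ^4 ≤1 /1000 := S.hμL
    calc S.μ * S.h * |1 + S.e x + S.e y| ≤ S.μ *1 * (3 * S.L ^4) := by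
          gcongr; linarith
      _ =3 * (S.μ * S.L ^4) := by ring
      _ ≤ _ := by linarith
  have hq : |S.μ * S.h * (1 + S.e x + S.e y)| ≤1 /100 := by
    rw [abs_mul, abs_of_pos (by positivity)]; exact hm
  have := abs_le.1 hq
  rw [abs_le]; constructor <;> linarith [hz1.1, hz1.2]

lemma la1 {x : ℤ} (hx : S.W x) : |S.la * (S.e x - S.h)| ≤1 /10 :=
  (S.p0 hx hx hx).la1x ((S.p0 hx hx hx).absLh hx)
lemma ka1 {x y : ℤ} (hx : S.W x) (hy : S.W y) : |S.ka * (S.e x - S.e y)| ≤1 /10 :=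
  (S.p0 hx hx hy).kax ((abs_sub _ _).trans (by
    have := abs_le.1 hx; have := abs_le.1 hy
    show |S.e x| + |S.e y| ≤2 * S.ε
    have h1 : |S.e x| ≤ S.ε := hx
    have h2 : |S.e y| ≤ S.ε := hy
    linarith))

lemma HR {x y : ℤ} (hx : S.W x) (hy : S.W y) (hx1 :1 ≤ x) (hy1 :1 ≤ y) :
    (x : ℝ) ≤2 * (S.Ro x y * y) := by
  have h1 := abs_le.1 (S.la1 hx)
  have h2 := abs_le.1 (S.la1 hy)
  have h3 := abs_le.1 (S.ka1 hx hy)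
  have ex := S.e1' hx1
  have ey := S.e1' hy1
  have := S.dpos
  rw [S.ed x]
  conv_rhs => rw [S.ed y]
  unfold Ro rho
  have k : (1 + S.e x) * (1 - S.la * (S.e y - S.h)) / ((1 + S.e y) * (1 - S.la * (S.e x - S.h)))
      * (1 + S.ka * (S.e x - S.e y)) * (S.d * (1 + S.e y)) =
      S.d * (1 + S.e x) * (((1 - S.la * (S.e y - S.h)) * (1 + S.ka * (S.e x - S.e y))) /
        (1 - S.la * (S.e x - S.h))) := by
    have :1 - S.la * (S.e x - S.h) ≠ 0 := by linarith
    field_simp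
  rw [k]
  have k2 :1 /2 ≤ ((1 - S.la * (S.e y - S.h)) * (1 + S.ka * (S.e x - S.e y))) /
        (1 - S.la * (S.e x - S.h)) := by
    rw [le_div_iff₀ (by linarith)]
    nlinarith
  have :0 < S.d * (1 + S.e x) := by positivity
  nlinarith

end Stg

namespace Stg
variable (S : Stg)

lemma eW (x : ℤ) (r : ℝ) (hr : |(x : ℝ) - S.d| ≤ r * S.d) : |S.e x| ≤ r := by
  have : S.e x = ((x : ℝ) - S.d) / S.d := by unfold e; field_simp [S.dpos.ne']
  rw [this, abs_div, abs_of_pos S.dpos, div_le_iff₀ S.dpos]; exact hr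

lemma ball1 {D : Fin S.n → ℤ} (h : Ball S.C S.ρ D) (i : Fin S.n) :
    |(D i : ℝ) - S.C i| ≤ S.ρ := by
  have : |D i - S.C i| ≤ S.ρ :=
    (single_le_sum (f := fun i => |D i - S.C i|) (fun _ _ => abs_nonneg _) (mem_univ i)).trans h.2
  exact_mod_cast this

lemma ballW {D : Fin S.n → ℤ} (h : Ball S.C S.ρ D) (i : Fin S.n) (k : ℤ) (hk :0 ≤ k) (hk2 : k ≤2) :
    |S.e (D i - k)| ≤ S.ε /2 := by
  refine S.eW _ _ ?_
  have h1 := S.ball1 h i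
  have h2 := S.hwin i
  have k1 : (0:ℝ) ≤ k := mod_cast hk
  have k2 : (k:ℝ) ≤2 := mod_cast hk2
  have := abs_le.1 h1
  have := neg_abs_le ((S.C i : ℝ) - S.d)
  have := le_abs_self ((S.C i : ℝ) - S.d)
  push_cast
  rw [abs_le]; constructor <;> linarith

lemma bW0 {D : Fin S.n → ℤ} (h : Ball S.C S.ρ D) (i : Fin S.n) : S.W (D i) := by
  have := S.ballW h i 0 le_rfl (by norm_num)
  rw [sub_zero] at this
  exact this.trans (by linarith [S.ε0])
lemma bW1 {D : Fin S.n → ℤ} (h : Ball S.C S.ρ D) (i : Fin S.n) : S.W (D i -1) :=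
  (S.ballW h i 1 (by norm_num) (by norm_num)).trans (by linarith [S.ε0])
lemma bW2 {D : Fin S.n → ℤ} (h : Ball S.C S.ρ D) (i : Fin S.n) : S.W (D i -1 -1) := by
  have := S.ballW h i 2 (by norm_num) (by norm_num)
  rw [show D i -2 = D i -1 -1 by ring] at this
  exact this.trans (by linarith [S.ε0])

def f1 (D : Fin S.n → ℤ) : ℝ := (∑ i, S.e (D i)) * (S.μ * S.h)
def f2 (D : Fin S.n → ℤ) : ℝ := (∑ i, S.e (D i) ^2) * (S.μ * S.h) - S.s

lemma s_eq : S.s = (∑ i, S.e (S.C i) ^2) * (S.μ * S.h) := by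
  unfold s
  rw [div_eq_iff S.νpos.ne', mul_assoc, S.μh, mul_one]

lemma e_diff (x y : ℤ) : S.e x - S.e y = S.h * ((x:ℝ) - y) := by
  unfold e h; ring

lemma sumabs {D : Fin S.n → ℤ} (h : Ball S.C S.ρ D) : ∑ i, |(D i : ℝ) - S.C i| ≤ S.ρ := by
  exact_mod_cast h.2

lemma hf1 {D : Fin S.n → ℤ} (h : Ball S.C S.ρ D) : |S.f1 D| ≤ S.μ * S.ε ^4 * S.L := by
  have hμ := S.μpos; have hh := S.hpos; have hε := S.ε0; have hL := S.hL
  have e1 : ∑ i, S.e (D i) = S.h * (∑ i, ((D i : ℝ) - S.C i) +1) := by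
    rw [sum_sub_distrib, S.hCs]
    unfold Stg.e Stg.h
    rw [sum_sub_distrib, ← sum_div]
    simp
    field_simp [S.dpos.ne']; ring
  have b : |∑ i, ((D i : ℝ) - S.C i) +1| ≤ S.ρ +1 := by
    refine (abs_add_le _ _).trans ?_
    rw [abs_one]
    linarith [(abs_sum_le_sum_abs (fun i => (D i : ℝ) - S.C i) univ), S.sumabs h]
  have r := S.hρ2
  have hhd :1 / S.d = S.h := rfl
  rw [hhd] at r
  unfold f1
  rw [e1, abs_mul, abs_mul, abs_of_pos hh, abs_of_pos (by positivity :0 < S.μ * S.h)]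
  calc S.h * |∑ i, ((D i : ℝ) - S.C i) +1| * (S.μ * S.h) ≤ S.h * (S.ρ +1) * (S.μ * S.h) := by gcongr
    _ = S.μ * ((S.ρ +1) * S.h ^2) := by ring
    _ ≤ S.μ * S.ε ^4 := by
        have : (0:ℝ) ≤ S.ρ := mod_cast (zero_le_one.trans S.hρ)
        have : (0:ℝ) ≤ (S.ρ +1) * S.h ^2 := by positivity
        gcongr; linarith
    _ ≤ _ := le_mul_of_one_le_right (by positivity) hL

lemma hf2 {D : Fin S.n → ℤ} (h : Ball S.C S.ρ D) : |S.f2 D| ≤ S.μ * S.ε ^4 * S.L := by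
  have hμ := S.μpos; have hh := S.hpos; have hε := S.ε0; have hL := S.hL; have hεL := S.hεL
  have e1 : S.f2 D = (∑ i, S.h * ((D i : ℝ) - S.C i) * (S.e (D i) + S.e (S.C i))) * (S.μ * S.h) := by
    unfold f2
    rw [S.s_eq, ← sub_mul, ← sum_sub_distrib]
    congr 1
    refine sum_congr rfl fun i _ => ?_
    rw [← S.e_diff]; ring
  have r := S.hρ2
  have hhd :1 / S.d = S.h := rfl
  rw [hhd] at r
  have b : |∑ i, S.h * ((D i : ℝ) - S.C i) * (S.e (D i) + S.e (S.C i))| ≤ S.h * S.ρ * S.ε := by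
    calc |∑ i, S.h * ((D i : ℝ) - S.C i) * (S.e (D i) + S.e (S.C i))|
        ≤ ∑ i, |S.h * ((D i : ℝ) - S.C i) * (S.e (D i) + S.e (S.C i))| := abs_sum_le_sum_abs _ _
      _ ≤ ∑ i, S.h * |(D i : ℝ) - S.C i| * S.ε := by
          refine sum_le_sum fun i _ => ?_
          rw [abs_mul, abs_mul, abs_of_pos hh]
          gcongr
          have a1 := S.ballW h i 0 le_rfl (by norm_num)
          rw [sub_zero] at a1
          have a2 := S.eC i
          exact (abs_add_le _ _).trans (by linarith)
      _ = S.h * (∑ i, |(D i : ℝ) - S.C i|) * S.ε := by rw [mul_sum, sum_mul]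
      _ ≤ _ := by gcongr; exact S.sumabs h
  rw [e1, abs_mul, abs_of_pos (by positivity :0 < S.μ * S.h)]
  have : (0:ℝ) ≤ S.ρ := mod_cast (zero_le_one.trans S.hρ)
  calc _ ≤ S.h * S.ρ * S.ε * (S.μ * S.h) := by gcongr
    _ = S.μ * (S.ρ * S.h ^2) * S.ε := by ring
    _ ≤ S.μ * S.ε ^4 * S.L := by
        have : (0:ℝ) ≤ S.ρ * S.h ^2 := by positivity
        have : (0:ℝ) ≤ S.h ^2 := by positivity
        gcongr; linarith

lemma HA' : ∃ C : ℝ, ∃ c : ℕ, 0 ≤ C ∧ ∀ S : Stg, ∀ x y z : ℤ, 1 ≤ x → S.W x → 1 ≤ y → S.W y →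
    1 ≤ z → S.W z →
    |S.F x z * (1 - S.F (y -1) (z -1)) - S.Ro x y * (1 - S.F (x -1) (z -1)) * S.F y z| ≤
      C * (S.μ * S.ε ^4 * S.L ^ c) * S.F x z := by
  obtain ⟨C, c, hC, h⟩ := Pt.HA_bd
  refine ⟨C, c, hC, fun S x y z hx wx hy wy hz wz => ?_⟩
  have := h (S.p0 wx wz wy) (S.e1 (by omega)) (S.e1' hy) (S.e1 (by omega))
  unfold F Ro
  rw [S.e_sub, S.e_sub, S.e_sub]
  exact this

lemma HC' : ∃ C : ℝ, ∃ c : ℕ, 0 ≤ C ∧ ∀ S : Stg, ∀ x z y : ℤ, 1 ≤ x → S.W x → 1 ≤ z → S.W z →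
    0 ≤ y → S.W y →
    |S.U x z y * (1 - S.F (x -1) (z -1)) - S.F x z * (S.F y (z -1) - S.U (x -1) (z -1) y)| ≤
      C * (S.μ * S.ε ^4 * S.L ^ c) * (S.F x z * S.F y z) := by
  obtain ⟨C, c, hC, h⟩ := Pt.HC_bd
  refine ⟨C, c, hC, fun S x z y hx wx hz wz hy wy => ?_⟩
  have z1 : (1:ℝ) ≤ z := mod_cast hz
  have ezz := S.ed z
  have hd := S.hd
  have dp := S.dpos
  have := h (S.p0 wx wz wy) (1 / (z:ℝ)) (1 / ((z -1 : ℤ) : ℝ)) (S.e1 (by omega)) (S.e1 hy)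
    (S.e1 (by omega)) (by positivity) (by rw [div_le_one (by linarith)]; exact z1) ?_ ?_ ?_
  · unfold U F
    rw [S.e_sub, S.e_sub]
    exact this
  · show 1 / (z:ℝ) ≤4 * S.ε ^2
    have hh : S.h ≤ S.ε ^2 := S.hh
    by_cases hε :1 /2 ≤ S.ε
    · have :1 / (z:ℝ) ≤1 := by rw [div_le_one (by linarith)]; exact z1
      nlinarith
    · push Not at hε
      have := (abs_le.1 wz).1
      have a :1 / (z:ℝ) ≤2 * S.h := by
        rw [div_le_iff₀ (by linarith), ezz]
        calc (1:ℝ) ≤2 * (1 + S.e z) := by linarith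
          _ =2 * (1 + S.e z) * (S.h * S.d) := by rw [hd, mul_one]
          _ = _ := by ring
      linarith [sq_nonneg S.ε]
  · show 1 / (z:ℝ) * (1 + S.e z) = S.h
    have :1 + S.e z = z * S.h := by rw [ezz, mul_right_comm, mul_comm S.d, hd, one_mul]
    rw [this]; field_simp
  · by_cases h1 : z =1
    · left; rw [h1]; simp
    · right
      show 1 / ((z -1 : ℤ) : ℝ) * (1 + (S.e z - S.h)) = S.h
      have :1 + (S.e z - S.h) = ((z -1 : ℤ) : ℝ) * S.h := by
        rw [← S.e_sub, S.ed (z -1), mul_right_comm, mul_comm S.d, hd, one_mul]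
      rw [this]
      have : ((z -1 : ℤ) : ℝ) ≠ 0 := by
        have : z -1 ≠ 0 := by omega
        exact_mod_cast this
      field_simp

end Stg

lemma sumquad {ι : Type*} (T : Finset ι) (g u : ι → ℝ) (a b c E : ℝ)
    (h : ∀ i ∈ T, |g i - (a + b * u i + c * u i ^2)| ≤ E) :
    |∑ i ∈ T, g i - (a * T.card + b * ∑ i ∈ T, u i + c * ∑ i ∈ T, u i ^2)| ≤ T.card * E := by
  have : ∑ i ∈ T, g i - (a * T.card + b * ∑ i ∈ T, u i + c * ∑ i ∈ T, u i ^2) =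
      ∑ i ∈ T, (g i - (a + b * u i + c * u i ^2)) := by
    rw [sum_sub_distrib, sum_add_distrib, sum_add_distrib, mul_sum,
      mul_sum]
    simp; ring
  rw [this]
  calc _ ≤ ∑ i ∈ T, |g i - (a + b * u i + c * u i ^2)| := abs_sum_le_sum_abs _ _
    _ ≤ ∑ _i ∈ T, E := sum_le_sum h
    _ = _ := by simp

namespace Stg
variable (S : Stg)

lemma card1 (v : Fin S.n) : (((univ.erase v : Finset (Fin S.n)).card : ℕ) : ℝ) = S.ν := by
  rw [card_erase_of_mem (mem_univ _)]
  simp only [card_univ, Fintype.card_fin]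
  have := S.n2
  rw [Nat.cast_sub (by omega)]; simp [ν]
lemma card2 (a b : Fin S.n) (hab : a ≠ b) :
    ((((univ.erase a).erase b : Finset (Fin S.n)).card : ℕ) : ℝ) = S.ν -1 := by
  rw [card_erase_of_mem (by simp [hab.symm]), Nat.cast_sub, S.card1]; · simp
  rw [card_erase_of_mem (mem_univ _)]
  simp only [card_univ, Fintype.card_fin]
  have := S.n2
  omega

lemma HA2' : ∃ C : ℝ, ∃ c : ℕ, 0 ≤ C ∧ ∀ S : Stg, ∀ D, Ball S.C S.ρ D → ∀ v,
    |∑ b ∈ univ.erase v, S.F (D b) (D v) - D v| ≤ C * (S.μ * S.ε ^4 * S.L ^ c) * D v := by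
  obtain ⟨C, c, hC, h⟩ := Pt.bg
  obtain ⟨C', c', hC', h'⟩ := Pt.bA2
  refine ⟨C + C', c + c', by positivity, fun S D hD v => ?_⟩
  have hμ := S.μpos; have hε := S.ε0; have hL := S.hL; have hL0 := S.Lpos; have hν := S.νpos
  set w := S.e (D v) with hw
  have hg : ∀ b, S.F (D b) (D v) = S.μ * (1 + w) * gg S.la S.kp (S.e (D b)) w := fun b => by
    unfold F phi gg; rw [← hw]; ring
  have hsq := sumquad (univ.erase v) (fun b => gg S.la S.kp (S.e (D b)) w) (fun b => S.e (D b))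
    (1 + S.kp * w) (1 + S.kp - S.la * w) (-(S.la * w)) (C * (S.μ * S.ε ^4 * S.L ^ c)) (fun b _ => by
      have := h (S.p0 (S.bW0 hD b) (S.bW0 hD v) (S.bW0 hD v))
      have e1 : C * (S.μ * S.ε ^4 * S.L ^ c) = C * (S.μ ^1 * S.ε ^4 * S.L ^ c) := by rw [pow_one]
      rw [e1]
      refine le_trans (le_of_eq ?_) this
      show |gg S.la S.kp (S.e (D b)) w - _| = |gg S.la S.kp (S.e (D b)) w -
        (1 + S.e (D b) + S.kp * w + (S.kp - S.la * w) * S.e (D b) - S.la * w * S.e (D b) ^2)|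
      congr 2; ring)
  have hA := h' (S.pt (S.bW0 hD v) (S.bW0 hD v) (S.bW0 hD v) (S.f1 D) (S.f2 D) (S.hf1 hD) (S.hf2 hD))
  have hA : |S.kp * w + (1 + S.kp - S.la * w) * (S.f1 D - w * (S.μ * S.h)) -
    S.la * w * (S.s + S.f2 D - w * w * (S.μ * S.h))| ≤ C' * (S.μ ^1 * S.ε ^4 * S.L ^ c') := hA
  rw [pow_one] at hA
  rw [S.card1] at hsq
  have m := S.μh
  have s1 : ∑ b ∈ univ.erase v, S.e (D b) = S.ν * (S.f1 D - w * (S.μ * S.h)) := by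
    have : ∑ b ∈ univ.erase v, S.e (D b) = ∑ b, S.e (D b) - w := by
      rw [← add_sum_erase _ _ (mem_univ v)]; ring
    rw [this]; unfold f1
    calc _ = (∑ b, S.e (D b) - w) * (S.μ * S.h * S.ν) := by rw [m, mul_one]
      _ = _ := by ring
  have s2 : ∑ b ∈ univ.erase v, S.e (D b) ^2 = S.ν * (S.s + S.f2 D - w * w * (S.μ * S.h)) := by
    have : ∑ b ∈ univ.erase v, S.e (D b) ^2 = ∑ b, S.e (D b) ^2 - w ^2 := by
      rw [← add_sum_erase _ _ (mem_univ v)]; ring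
    rw [this]; unfold f2
    calc _ = (∑ b, S.e (D b) ^2 - w ^2) * (S.μ * S.h * S.ν) := by rw [m, mul_one]
      _ = _ := by ring
  rw [s1, s2] at hsq
  have dv := S.ed (D v)
  rw [← S.μν, ← hw] at dv
  rw [sum_congr rfl (fun b _ => hg b), ← mul_sum, dv]
  set G := ∑ b ∈ univ.erase v, gg S.la S.kp (S.e (D b)) w
  set A := S.kp * w + (1 + S.kp - S.la * w) * (S.f1 D - w * (S.μ * S.h)) -
    S.la * w * (S.s + S.f2 D - w * w * (S.μ * S.h)) with hAdef
  have w1 :0 ≤1 + w := S.e1 (hD.1 v)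
  have hG : |G - S.ν| ≤ S.ν * ((C + C') * (S.μ * S.ε ^4 * S.L ^ (c + c'))) := by
    have : G - S.ν = (G - ((1 + S.kp * w) * S.ν + (1 + S.kp - S.la * w) *
        (S.ν * (S.f1 D - w * (S.μ * S.h))) + -(S.la * w) *
          (S.ν * (S.s + S.f2 D - w * w * (S.μ * S.h))))) + S.ν * A := by rw [hAdef]; ring
    rw [this]
    refine (abs_add_le _ _).trans ((add_le_add hsq (le_of_eq (abs_mul _ _))).trans ?_)
    rw [abs_of_pos hν, ← mul_add]
    refine mL ?_ hν.le
    calc _ ≤ C * (S.μ * S.ε ^4 * S.L ^ (c + c')) + C' * (S.μ * S.ε ^4 * S.L ^ (c + c')) := by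
          refine add_le_add ?_ (hA.trans ?_) <;> gcongr <;> first | exact hL | omega
      _ = _ := by ring
  rw [show S.μ * (1 + w) * G - S.μ * S.ν * (1 + w) = S.μ * (1 + w) * (G - S.ν) by ring, abs_mul,
    abs_of_nonneg (mul_nonneg hμ.le w1)]
  calc _ ≤ S.μ * (1 + w) * (S.ν * ((C + C') * (S.μ * S.ε ^4 * S.L ^ (c + c')))) :=
        mL hG (mul_nonneg hμ.le w1)
    _ = _ := by ring

lemma U_qq (x z y : ℤ) : S.U x z y = S.μ ^2 * (1 + S.e x) * (1 + S.e y) *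
    qq S.μ S.la S.kp S.h (S.e x) (S.e y) (S.e z) := by
  unfold U F phi qq
  have k : (1 + S.e z) * (1 + S.e z) * (1 -1 / (z:ℝ)) = (1 + S.e z) ^2 - S.h * (1 + S.e z) := by
    have :1 + S.e z = z * S.h := by
      rw [S.ed z, mul_right_comm, mul_comm S.d, S.hd, one_mul]
    rw [this]
    rcases eq_or_ne (z:ℝ) 0 with h | h
    · rw [h]; simp
    · field_simp
  set w := S.e z
  set u := S.e x
  set t := S.e y
  calc _ = S.μ ^2 * (1 + u) * (1 + t) * ((1 + w) * (1 + w) * (1 -1 / (z:ℝ)) +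
      S.μ * S.h * (1 + w) ^2 * (1 + u + t)) * ((1 + S.kp * (u + w)) / (1 + S.la * u * w) *
        ((1 + S.kp * (t + w)) / (1 + S.la * t * w))) := by ring
    _ = _ := by rw [k, div_mul_div_comm]; ring

lemma co' : ∃ C : ℝ, ∃ c : ℕ, 0 ≤ C ∧ ∀ S : Stg, ∀ D, Ball S.C S.ρ D → ∀ a b, a ≠ b → ∃ g : ℝ,
    |g| ≤ C * (S.μ * S.ε ^4 * S.L ^ c) ∧ co S.F S.U D a b = S.μ ^2 * S.ν * (1 + S.e (D a)) *
      (1 + S.e (D b)) * (1 + (S.s - S.la * S.s * (S.e (D a) + S.e (D b))) + g) := by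
  obtain ⟨C, c, hC, h⟩ := Pt.bqq
  obtain ⟨C', c', hC', h'⟩ := Pt.bWW
  refine ⟨C + C', c + c', by positivity, fun S D hD a b hab => ?_⟩
  have hμ := S.μpos; have hε := S.ε0; have hL := S.hL; have hL0 := S.Lpos; have hν := S.νpos
  set u := S.e (D a) with hu
  set t := S.e (D b) with ht
  have hsq := sumquad ((univ.erase a).erase b) (fun v => qq S.μ S.la S.kp S.h u t (S.e (D v)))
    (fun v => S.e (D v)) (1 - S.h + S.μ * S.h + (S.kp + S.μ * S.h) * (u + t))
    (2 - S.h +2 * (S.kp + S.μ * S.h) - S.la * (u + t)) (1 -2 * S.la * (u + t))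
    (C * (S.μ * S.ε ^4 * S.L ^ c)) (fun v _ => by
      have := h (S.p0 (S.bW0 hD a) (S.bW0 hD v) (S.bW0 hD b))
      have e1 : C * (S.μ * S.ε ^4 * S.L ^ c) = C * (S.μ ^1 * S.ε ^4 * S.L ^ c) := by rw [pow_one]
      rw [e1]
      refine le_trans (le_of_eq ?_) this
      show |qq S.μ S.la S.kp S.h u t (S.e (D v)) - _| = |qq S.μ S.la S.kp S.h u t (S.e (D v)) -
        ((1 + S.e (D v)) ^2 - S.h * (1 + S.e (D v)) + (S.kp + S.μ * S.h) * (u + t +2 * S.e (D v))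
          + S.μ * S.h - S.la * (u + t) * (S.e (D v) +2 * S.e (D v) ^2))|
      congr 2; ring)
  have hW := h' (S.pt (S.bW0 hD a) (S.bW0 hD b) (S.bW0 hD b) (S.f1 D) (S.f2 D) (S.hf1 hD) (S.hf2 hD))
  set Ett := (1 + S.kp * (u + t)) * (1 + S.la * u * t)⁻¹ with hEt
  have hW : |(1 - S.μ * S.h) * (1 - S.h + S.μ * S.h + (S.kp + S.μ * S.h) * (u + t)) +
      (2 - S.h +2 * (S.kp + S.μ * S.h) - S.la * (u + t)) * (S.f1 D - (u + t) * (S.μ * S.h)) +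
      (1 -2 * S.la * (u + t)) * (S.s + S.f2 D - (u * u + t * t) * (S.μ * S.h)) + S.h * Ett -1 - S.s
        + S.la * S.s * (u + t)| ≤ C' * (S.μ ^1 * S.ε ^4 * S.L ^ c') := hW
  rw [pow_one] at hW
  rw [S.card2 a b hab] at hsq
  have m := S.μh
  have m' : S.ν * (S.μ * S.h) =1 := by rw [mul_comm]; exact m
  have mb : b ∈ univ.erase a := by simp [hab.symm]
  have s1 : ∑ v ∈ (univ.erase a).erase b, S.e (D v) = S.ν * (S.f1 D - (u + t) * (S.μ * S.h)) := by
    have : ∑ v ∈ (univ.erase a).erase b, S.e (D v) = ∑ v, S.e (D v) - (u + t) := by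
      rw [← add_sum_erase _ _ (mem_univ a), ← add_sum_erase _ _ mb]; ring
    rw [this]; unfold f1
    calc _ = (∑ b, S.e (D b) - (u + t)) * (S.μ * S.h * S.ν) := by rw [m, mul_one]
      _ = _ := by ring
  have s2 : ∑ v ∈ (univ.erase a).erase b, S.e (D v) ^2 =
      S.ν * (S.s + S.f2 D - (u * u + t * t) * (S.μ * S.h)) := by
    have : ∑ v ∈ (univ.erase a).erase b, S.e (D v) ^2 = ∑ v, S.e (D v) ^2 - (u * u + t * t) := by
      rw [← add_sum_erase _ _ (mem_univ a), ← add_sum_erase _ _ mb]; ring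
    rw [this]; unfold f2
    calc _ = (∑ b, S.e (D b) ^2 - (u * u + t * t)) * (S.μ * S.h * S.ν) := by rw [m, mul_one]
      _ = _ := by ring
  rw [s1, s2, show S.ν -1 = S.ν * (1 - S.μ * S.h) by rw [mul_sub, m', mul_one]] at hsq
  have hF : S.F (D a) (D b) = S.μ ^2 * S.ν * (1 + u) * (1 + t) * (S.h * Ett) := by
    unfold F phi
    rw [← hu, ← ht, hEt]
    calc _ = S.μ * (1 + u) * (1 + t) * (1 + S.kp * (u + t)) * (1 + S.la * u * t)⁻¹ *
        (S.μ * S.h * S.ν) := by rw [m]; ring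
      _ = _ := by ring
  set Q := ∑ v ∈ (univ.erase a).erase b, qq S.μ S.la S.kp S.h u t (S.e (D v)) with hQ
  have hco : co S.F S.U D a b = S.μ ^2 * S.ν * (1 + u) * (1 + t) * (S.h * Ett + Q * (S.μ * S.h)) := by
    unfold co
    rw [hF, sum_congr rfl (fun v _ => S.U_qq (D a) (D v) (D b)), ← mul_sum, ← hu, ← ht,
      ← hQ]
    calc _ = S.μ ^2 * S.ν * (1 + u) * (1 + t) * (S.h * Ett) + S.μ ^2 * (1 + u) * (1 + t) * Q *
        (S.μ * S.h * S.ν) := by rw [m, mul_one]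
      _ = _ := by ring
  refine ⟨S.h * Ett + Q * (S.μ * S.h) - (1 + (S.s - S.la * S.s * (u + t))), ?_, by rw [hco]; ring⟩
  set V := (1 - S.h + S.μ * S.h + (S.kp + S.μ * S.h) * (u + t)) * (S.ν * (1 - S.μ * S.h)) +
    (2 - S.h +2 * (S.kp + S.μ * S.h) - S.la * (u + t)) * (S.ν * (S.f1 D - (u + t) * (S.μ * S.h))) +
    (1 -2 * S.la * (u + t)) * (S.ν * (S.s + S.f2 D - (u * u + t * t) * (S.μ * S.h))) with hV
  have hVv : V * (S.μ * S.h) = (1 - S.μ * S.h) * (1 - S.h + S.μ * S.h + (S.kp + S.μ * S.h) * (u + t)) +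
      (2 - S.h +2 * (S.kp + S.μ * S.h) - S.la * (u + t)) * (S.f1 D - (u + t) * (S.μ * S.h)) +
      (1 -2 * S.la * (u + t)) * (S.s + S.f2 D - (u * u + t * t) * (S.μ * S.h)) := by
    set X := (1 - S.μ * S.h) * (1 - S.h + S.μ * S.h + (S.kp + S.μ * S.h) * (u + t)) +
      (2 - S.h +2 * (S.kp + S.μ * S.h) - S.la * (u + t)) * (S.f1 D - (u + t) * (S.μ * S.h)) +
      (1 -2 * S.la * (u + t)) * (S.s + S.f2 D - (u * u + t * t) * (S.μ * S.h)) with hX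
    have : V = X * S.ν := by rw [hV, hX]; ring
    rw [this, mul_assoc, m', mul_one]
  have hh := S.hpos
  have hE : |(Q - V) * (S.μ * S.h)| ≤ C * (S.μ * S.ε ^4 * S.L ^ c) := by
    rw [abs_mul, abs_of_pos (by positivity :0 < S.μ * S.h)]
    have k1 : (1 - S.μ * S.h) ≤1 := by linarith [mul_pos hμ hh]
    calc _ ≤ S.ν * (1 - S.μ * S.h) * (C * (S.μ * S.ε ^4 * S.L ^ c)) * (S.μ * S.h) := by gcongr
      _ ≤ S.ν *1 * (C * (S.μ * S.ε ^4 * S.L ^ c)) * (S.μ * S.h) := by gcongr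
      _ = (S.ν * (S.μ * S.h)) * (C * (S.μ * S.ε ^4 * S.L ^ c)) := by ring
      _ = _ := by rw [m', one_mul]
  rw [← hVv] at hW
  rw [show S.h * Ett + Q * (S.μ * S.h) - (1 + (S.s - S.la * S.s * (u + t))) =
    (Q - V) * (S.μ * S.h) + (V * (S.μ * S.h) + S.h * Ett -1 - S.s + S.la * S.s * (u + t)) by ring]
  refine (abs_add_le _ _).trans ((add_le_add hE hW).trans ?_)
  calc _ ≤ C * (S.μ * S.ε ^4 * S.L ^ (c + c')) + C' * (S.μ * S.ε ^4 * S.L ^ (c + c')) := by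
        refine add_le_add ?_ ?_ <;> gcongr <;> first | exact hL | omega
    _ = _ := by ring

end Stg

namespace Stg
variable (S : Stg)

lemma HBalg {μ ν la s h u t ka g1 g2 : ℝ} (hrel : μ + μ * la = la) (h1 :1 - μ ≠ 0)
    (ht :1 + t ≠ 0) (ha :1 - la * (u - h) ≠ 0) :
    rho la ka h u t * (μ * ν * (1 + t) - μ ^2 * ν * (1 + (u - h)) * (1 + t) *
        (1 + (s - la * s * ((u - h) + t)) + g1)) - (μ * ν * (1 + u) - μ ^2 * ν * (1 + u) *
        (1 + (t - h)) * (1 + (s - la * s * (u + (t - h))) + g2)) =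
    μ * ν * (1 + u) * (((1 - μ * (1 + (t - h))) * (1 - μ * (1 + (u - h)))⁻¹ * (1 + ka * (u - t)) *
      ((1 - μ * (1 + (u - h))) - μ * (1 + (u - h)) * (s - la * s * (u + t)))
      - ((1 - μ * (1 + (t - h))) - μ * (1 + (t - h)) * (s - la * s * (u + t)))) -
      (1 - μ * (1 + (t - h))) * (1 - μ * (1 + (u - h)))⁻¹ * (1 + ka * (u - t)) *
        (μ * (1 + (u - h)) * (g1 + la * s * h)) + μ * (1 + (t - h)) * (g2 + la * s * h)) := by
  have k : ∀ x, 1 - μ * (1 + x) = (1 - μ) * (1 - la * x) := fun x => by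
    linear_combination (-x) * hrel
  have kk : (1 - μ * (1 + (t - h))) * (1 - μ * (1 + (u - h)))⁻¹ =
      (1 - la * (t - h)) * (1 - la * (u - h))⁻¹ := by
    rw [k, k]; field_simp
  have r : rho la ka h u t * (1 + t) = (1 + u) * ((1 - μ * (1 + (t - h))) *
      (1 - μ * (1 + (u - h)))⁻¹) * (1 + ka * (u - t)) := by
    rw [kk]; unfold rho; field_simp
  set R := (1 - μ * (1 + (t - h))) * (1 - μ * (1 + (u - h)))⁻¹
  linear_combination (μ * ν - μ ^2 * ν * (1 + (u - h)) * (1 + (s - la * s * ((u - h) + t)) + g1)) * r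

lemma HB' : ∃ C : ℝ, ∃ c : ℕ, 0 ≤ C ∧ ∀ S : Stg, ∀ D, Ball S.C (S.ρ -1) D → ∀ a b, a ≠ b →
    1 ≤ D a → 1 ≤ D b →
    |S.Ro (D a) (D b) * (D b - co S.F S.U (D - ee a) a b) - (D a - co S.F S.U (D - ee b) a b)| ≤
      C * (S.μ ^2 * S.ε ^4 * S.L ^ c) * D a := by
  obtain ⟨C1, c1, hC1, H1⟩ := co'
  obtain ⟨C2, c2, hC2, H2⟩ := Pt.bZZ
  obtain ⟨C3, c3, hC3, H3⟩ := Pt.baA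
  obtain ⟨C4, c4, hC4, H4⟩ := Pt.baB
  obtain ⟨C5, c5, hC5, H5⟩ := (Pt.bla.mul Pt.bs).mul Pt.bh
  refine ⟨C2 +3 * C3 * (C1 + C5) + C4 * (C1 + C5), c1 + c2 + c3 + c4 + c5, by positivity,
    fun S D hD a b hab ha hb => ?_⟩
  have hμ := S.μpos; have hε := S.ε0; have hL := S.hL; have hL0 := S.Lpos; have hν := S.νpos
  have hμ1 := S.μ1
  have B1 : Ball S.C S.ρ (D - ee a) := by have := hD.sub1 ha; rwa [sub_add_cancel] at this
  have B2 : Ball S.C S.ρ (D - ee b) := by have := hD.sub1 hb; rwa [sub_add_cancel] at this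
  have B0 : Ball S.C S.ρ D := hD.mono (by omega)
  obtain ⟨g1, hg1, e1⟩ := H1 S _ B1 a b hab
  obtain ⟨g2, hg2, e2⟩ := H1 S _ B2 a b hab
  have q1 : (D - ee a) a = D a -1 := by simp [ee_apply]
  have q2 : (D - ee a) b = D b := by simp [ee_apply, hab, hab.symm]
  have q3 : (D - ee b) b = D b -1 := by simp [ee_apply]
  have q4 : (D - ee b) a = D a := by simp [ee_apply, hab, hab.symm]
  rw [q1, q2, S.e_sub] at e1
  rw [q3, q4, S.e_sub] at e2
  have wa := S.bW0 B0 a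
  have wb := S.bW0 B0 b
  have da := S.ed (D a); have db := S.ed (D b)
  have ua := S.e1' ha; have tb := S.e1' hb
  have ua' :0 ≤1 + S.e (D a -1) := S.e1 (by omega)
  have tb' :0 ≤1 + S.e (D b -1) := S.e1 (by omega)
  rw [S.e_sub] at ua' tb'
  rw [← S.μν] at da db
  have z2 := H2 (S.p0 wa wa wb)
  have z3 := H3 (S.p0 wa wa wb)
  have z4 := H4 (S.p0 wa wa wb)
  have z5 := H5 (S.p0 wa wa wb)
  have zA := (S.p0 wa wa wb).Ah
  have hka := abs_le.1 (S.ka1 wa wb)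
  have hla := abs_le.1 (S.la1 wa)
  set u := S.e (D a) with hu
  set t := S.e (D b) with ht
  have z2 : |((1 - S.μ * (1 + (t - S.h))) * (1 - S.μ * (1 + (u - S.h)))⁻¹ * (1 + S.ka * (u - t)) *
      ((1 - S.μ * (1 + (u - S.h))) - S.μ * (1 + (u - S.h)) * (S.s - S.la * S.s * (u + t)))
      - ((1 - S.μ * (1 + (t - S.h))) - S.μ * (1 + (t - S.h)) * (S.s - S.la * S.s * (u + t))))| ≤
    C2 * (S.μ ^2 * S.ε ^4 * S.L ^ c2) := z2
  have z3 : |S.μ * (1 + (u - S.h))| ≤ C3 * (S.μ ^1 * S.ε ^0 * S.L ^ c3) := z3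
  have z4 : |S.μ * (1 + (t - S.h))| ≤ C4 * (S.μ ^1 * S.ε ^0 * S.L ^ c4) := z4
  have z5 : |S.la * S.s * S.h| ≤ C5 * (S.μ ^1 * S.ε ^4 * S.L ^ c5) := z5
  have zA :1 /2 ≤1 - S.μ * (1 + (u - S.h)) := zA
  rw [pow_zero, mul_one, pow_one] at z3 z4
  rw [pow_one] at z5
  rw [e1, e2]
  have hR : S.Ro (D a) (D b) = rho S.la S.ka S.h u t := rfl
  rw [hR, da, db, HBalg S.hrel (by linarith) tb.ne' (by linarith), abs_mul,
    abs_of_nonneg (by positivity :0 ≤ S.μ * S.ν * (1 + u)), mul_comm]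
  refine mR ?_ (by positivity)
  have hr : |(1 - S.μ * (1 + (t - S.h))) * (1 - S.μ * (1 + (u - S.h)))⁻¹ * (1 + S.ka * (u - t))| ≤3 := by
    rw [abs_mul, abs_mul, abs_inv, abs_of_pos (by linarith :0 <1 - S.μ * (1 + (u - S.h)))]
    have k1 : |1 - S.μ * (1 + (t - S.h))| ≤1 := by
      have i := H4
      have zB := (S.p0 wb wb wa).Ah
      have zB :1 /2 ≤1 - S.μ * (1 + (t - S.h)) := zB
      rw [abs_of_pos (by linarith)]
      linarith [mul_nonneg hμ.le tb']
    have k2 : (1 - S.μ * (1 + (u - S.h)))⁻¹ ≤2 := by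
      rw [show (2:ℝ) = (1/2)⁻¹ by norm_num]; exact inv_anti₀ (by norm_num) zA
    have k3 : |1 + S.ka * (u - t)| ≤3 /2 := by rw [abs_le]; constructor <;> linarith
    have k4 :0 ≤ (1 - S.μ * (1 + (u - S.h)))⁻¹ := inv_nonneg.2 (by linarith)
    calc _ ≤1 *2 * (3 /2 : ℝ) := by gcongr
      _ =3 := by norm_num
  set N := c1 + c2 + c3 + c4 + c5 with hN
  have pw : ∀ {i}, i ≤ N → S.L ^ i ≤ S.L ^ N := fun hi => pow_le_pow_right₀ hL hi
  have g1' : ∀ g, |g| ≤ C1 * (S.μ * S.ε ^4 * S.L ^ c1) →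
      |g + S.la * S.s * S.h| ≤ (C1 + C5) * (S.μ * S.ε ^4 * S.L ^ (c1 + c5)) := fun g hg => by
    refine (abs_add_le _ _).trans ((add_le_add hg z5).trans ?_)
    rw [add_mul]
    refine add_le_add ?_ ?_ <;> gcongr <;> first | exact hL | omega
  refine (abs_add_le _ _).trans ?_
  refine (add_le_add_left (abs_sub _ _) _).trans ?_
  rw [abs_mul (_ * _ * _), abs_mul (S.μ * (1 + (u - S.h))), abs_mul (S.μ * (1 + (t - S.h)))]
  have G1 := g1' g1 hg1
  have G2 := g1' g2 hg2
  calc _ ≤ C2 * (S.μ ^2 * S.ε ^4 * S.L ^ c2) +3 * ((C3 * (S.μ * S.L ^ c3)) *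
        ((C1 + C5) * (S.μ * S.ε ^4 * S.L ^ (c1 + c5)))) + (C4 * (S.μ * S.L ^ c4)) *
        ((C1 + C5) * (S.μ * S.ε ^4 * S.L ^ (c1 + c5))) := by gcongr
    _ = C2 * (S.μ ^2 * S.ε ^4 * S.L ^ c2) +3 * C3 * (C1 + C5) *
        (S.μ ^2 * S.ε ^4 * S.L ^ (c3 + (c1 + c5))) + C4 * (C1 + C5) *
        (S.μ ^2 * S.ε ^4 * S.L ^ (c4 + (c1 + c5))) := by rw [pow_add _ c3, pow_add _ c4]; ring
    _ ≤ C2 * (S.μ ^2 * S.ε ^4 * S.L ^ N) +3 * C3 * (C1 + C5) *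
        (S.μ ^2 * S.ε ^4 * S.L ^ N) + C4 * (C1 + C5) *
        (S.μ ^2 * S.ε ^4 * S.L ^ N) := by
        gcongr <;> first | exact hL | omega
    _ = _ := by ring

/-- the degree bound used for realizability -/
def dl : ℕ := ⌊S.d * (1 + S.ε /2)⌋₊

lemma dl_le {D : Fin S.n → ℤ} (h : Ball S.C S.ρ D) (i : Fin S.n) : D i ≤ (S.dl : ℤ) := by
  have h1 := S.ballW h i 0 le_rfl (by norm_num)
  rw [sub_zero] at h1
  have h2 := S.ed (D i)
  have h3 : ((D i).toNat : ℝ) ≤ S.d * (1 + S.ε /2) := by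
    have : ((D i).toNat : ℝ) = (D i : ℝ) := by
      have := Int.toNat_of_nonneg (h.1 i); exact_mod_cast this
    rw [this, h2]
    have := S.dpos
    gcongr; exact (abs_le.1 h1).2
  have := Nat.le_floor h3
  have h4 := Int.toNat_of_nonneg (h.1 i)
  unfold dl; omega

lemma dl_num {D : Fin S.n → ℤ} (h : Ball S.C S.ρ D) :
    3 * ((S.dl : ℝ) * (S.dl +1)) ≤12 /1000 * (S.d * S.ν) ∧ 99 /100 * (S.d * S.ν) ≤ ∑ i, (D i : ℝ) := by
  have hd := S.d1; have hL := S.hL; have hε := S.hεL; have ε0 := S.ε0; have hν := S.νpos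
  have hd0 := S.dpos
  have f : (S.dl : ℝ) ≤ S.d * (1 + S.ε /2) := Nat.floor_le (by positivity)
  have f1 : (S.dl : ℝ) ≤3 /2 * (S.d * S.L) := by nlinarith
  have dL :1 ≤ S.d * S.L := by nlinarith
  have hm := S.hμL
  rw [div_mul_eq_mul_div, div_le_iff₀ (show (0:ℝ) < (S.n:ℝ) -1 from hν)] at hm
  have hm : S.d * S.L ^4 ≤1 /1000 * S.ν := hm
  have l2 : S.L ^2 ≤ S.L ^4 := pow_le_pow_right₀ hL (by norm_num)
  have l1 : S.L ≤ S.L ^4 := le_self_pow₀ hL (by norm_num)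
  constructor
  · have : (S.dl : ℝ) +1 ≤5 /2 * (S.d * S.L) := by linarith
    calc 3 * ((S.dl : ℝ) * (S.dl +1)) ≤3 * (3 /2 * (S.d * S.L) * (5 /2 * (S.d * S.L))) := by gcongr
      _ =45 /4 * (S.d * (S.d * S.L ^2)) := by ring
      _ ≤45 /4 * (S.d * (S.d * S.L ^4)) := by gcongr
      _ ≤45 /4 * (S.d * (1 /1000 * S.ν)) := by gcongr
      _ ≤ _ := by nlinarith [mul_pos hd0 hν]
  · have a1 : ∑ i, (D i : ℝ) = ∑ i, ((D i : ℝ) - S.C i) + (S.n * S.d +1) := by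
      rw [← S.hCs, ← sum_add_distrib]; simp
    have a2 := neg_abs_le (∑ i, ((D i : ℝ) - S.C i))
    have a3 := abs_sum_le_sum_abs (fun i => (D i : ℝ) - S.C i) univ
    have a4 := S.sumabs h
    have hn : (S.n : ℝ) = S.ν +1 := by unfold ν; ring
    have i0 :0 < S.n := by have := S.n2; omega
    have a5 := S.hwin ⟨0, i0⟩
    have a6 := abs_nonneg ((S.C ⟨0, i0⟩ : ℝ) - S.d)
    have a7 : (S.ρ : ℝ) ≤ S.d * S.L ^4 := by nlinarith
    have a8 : S.ν ≤ S.d * S.ν := le_mul_of_one_le_left hν.le hd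
    rw [a1, hn]
    linarith

lemma hN' {D : Fin S.n → ℤ} (h : Ball S.C S.ρ D) (he : Even (∑ i, D i)) :0 < NN D := by
  refine realize D S.dl h.1 (S.dl_le h) he ?_
  have ⟨h1, h2⟩ := S.dl_num h
  have := mul_pos S.dpos S.νpos
  have :3 * ((S.dl : ℝ) * (S.dl +1)) < ∑ i, (D i : ℝ) := by linarith
  exact_mod_cast this

lemma HI' {D : Fin S.n → ℤ} (h : Ball S.C S.ρ D) (he : Even (∑ i, D i)) (a v : Fin S.n) (hav : a ≠ v) :
    Pp D a v ≤2 * S.F (D a) (D v) := by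
  have hN := S.hN' h he
  have sb := switch_bound D S.dl (S.dl_le h) hav
  have ⟨h1, h2⟩ := S.dl_num h
  have hp := mul_pos S.dpos S.νpos
  have sb : (NE D a v : ℝ) * (∑ i, (D i:ℝ) -2 * ((S.dl:ℝ) * (S.dl +1))) ≤
    D a * D v * (NN D - NE D a v) := mod_cast sb
  have fl := (S.F_low (S.bW0 h a) (S.bW0 h v) (h.1 a) (h.1 v)).1
  have hN : (0:ℝ) < NN D := mod_cast hN
  have da : (0:ℝ) ≤ D a := mod_cast h.1 a
  have dv : (0:ℝ) ≤ D v := mod_cast h.1 v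
  have ne0 : (0:ℝ) ≤ NE D a v := Nat.cast_nonneg _
  have k : S.μ * (1 + S.e (D a)) * (1 + S.e (D v)) = D a * D v / (S.d * S.ν) := by
    rw [S.ed (D a), S.ed (D v)]
    have := S.dpos; have := S.νpos
    unfold μ ν at *
    field_simp
  rw [k] at fl
  unfold Pp
  have g : (NE D a v : ℝ) / NN D ≤16 /10 * (D a * D v / (S.d * S.ν)) := by
    rw [div_le_iff₀ hN, ← mul_div_assoc, div_mul_eq_mul_div, le_div_iff₀ hp]
    have e1 : (NE D a v : ℝ) * (9 /10 * (S.d * S.ν)) ≤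
        NE D a v * (∑ i, (D i:ℝ) -2 * ((S.dl:ℝ) * (S.dl +1))) := by
      gcongr; linarith
    have e2 : (D a : ℝ) * D v * (NN D - NE D a v) ≤ D a * D v * NN D := by
      gcongr; linarith
    have : (0:ℝ) ≤ D a * D v * NN D := by positivity
    linarith
  linarith

theorem ctr : ∃ C0 : ℝ, ∃ c0 : ℕ, 1 ≤ C0 ∧ ∀ S : Stg, ∀ τ η : ℝ, τ = C0 * S.μ * S.L ^ c0 →
    η = C0 * S.μ * S.ε ^4 * S.L ^ c0 → τ ≤1 /3000 → η ≤1 /100 →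
    Ctr S.C S.ρ (fun x => S.W x ∧ S.W (x -1)) S.F S.U S.Ro τ η := by
  obtain ⟨C1, c1, hC1, H1⟩ := HA'
  obtain ⟨C2, c2, hC2, H2⟩ := HC'
  obtain ⟨C3, c3, hC3, H3⟩ := HA2'
  obtain ⟨C4, c4, hC4, H4⟩ := HB'
  refine ⟨5 + C1 + C2 + C3 + C4, 2 + c1 + c2 + c3 + c4, by linarith, ?_⟩
  set C0 := 5 + C1 + C2 + C3 + C4 with hC0
  set N := 2 + c1 + c2 + c3 + c4 with hN
  intro S τ η hτ hη hτ1 hη1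
  have hμ := S.μpos; have hε := S.ε0; have hL := S.hL; have hL0 := S.Lpos
  have p0 :0 < C0 := by linarith
  have pw : ∀ {i}, i ≤ N → S.L ^ i ≤ S.L ^ N := fun hi => pow_le_pow_right₀ hL hi
  have big : ∀ {C : ℝ} {c : ℕ}, 0 ≤ C → C ≤ C0 → c ≤ N → C * (S.μ * S.ε ^4 * S.L ^ c) ≤ η := by
    intro C c hC hCC hc
    have := pw hc
    rw [hη]
    calc _ ≤ C0 * (S.μ * S.ε ^4 * S.L ^ N) := by gcongr
      _ = _ := by ring
  constructor
  · rw [hτ]; positivity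
  · exact hτ1
  · rw [hη]; positivity
  · exact hη1
  · exact fun D hD i => ⟨S.bW0 hD i, S.bW1 hD i⟩
  · exact fun D hD i => ⟨S.bW1 hD i, S.bW2 hD i⟩
  · exact fun D hD he => S.hN' hD he
  · exact fun x z h1 h2 h3 h4 => S.Fnn h2.1 h4.1 h1 h3
  · intro x z h1 h2 h3 h4
    have := pw (show 2 ≤ N by omega)
    rw [hτ]
    calc _ ≤5 * (S.μ * S.L ^2) := S.Fτ h2.1 h4.1 h1 h3
      _ ≤ C0 * (S.μ * S.L ^ N) := by gcongr; linarith
      _ = _ := by ring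
  · exact S.F0
  · exact S.Fsym
  · exact fun x z h1 h2 h3 h4 => S.Fmono h2.1 h4.1 h4.2 h1 h3
  · exact fun x z y h1 h2 h3 h4 h5 h6 => S.Ubd h2.1 h4.1 h6.1 h1 h3 h5
  · intro x y z h1 h2 h3 h4 h5 h6
    refine (H1 S x y z h1 h2.1 h3 h4.1 h5 h6.1).trans ?_
    exact mR (big hC1 (by linarith) (by omega))
      (S.Fnn h2.1 h6.1 (by omega) (by omega))
  · exact fun x y h1 h2 h3 h4 => S.HR h2.1 h4.1 h1 h3
  · intro x z y h1 h2 h3 h4 h5 h6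
    refine (H2 S x z y h1 h2.1 h3 h4.1 h5 h6.1).trans ?_
    exact mR (big hC2 (by linarith) (by omega))
      (mul_nonneg (S.Fnn h2.1 h4.1 (by omega) (by omega)) (S.Fnn h6.1 h4.1 (by omega) (by omega)))
  · intro D hD v
    refine (H3 S D hD v).trans ?_
    exact mR (big hC3 (by linarith) (by omega))
      (mod_cast hD.1 v)
  · intro D hD a b hab ha hb
    refine (H4 S D hD a b hab ha hb).trans ?_
    refine mR ?_ (mod_cast hD.1 a)
    have := pw (show c4 ≤ N by omega)
    have hN1 :1 ≤ S.L ^ N := one_le_pow₀ hL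
    have hC01 :1 ≤ C0 := by linarith
    rw [hτ, hη]
    calc _ ≤ (C0 *1) * (S.μ ^2 * S.ε ^4 * (S.L ^ N *1)) := by rw [mul_one, mul_one]; gcongr; linarith
      _ ≤ (C0 * C0) * (S.μ ^2 * S.ε ^4 * (S.L ^ N * S.L ^ N)) := by gcongr
      _ = _ := by ring
  · exact fun D hD he a v hav => S.HI' hD he a v hav

end Stg

def X2 (n : ℕ) (d : ℝ) (D : Fin n → ℤ) : ℝ :=
  (∑ i, ((D i : ℝ) - d) ^2) / (((n : ℝ) -1) * d * (1 - d / ((n : ℝ) -1)))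
def lH (n : ℕ) (d : ℝ) (D : Fin n → ℤ) : ℝ :=
  ∑ i, Real.log ((n -1).choose (D i).toNat) - X2 n d D ^2 /4
def Tl (n : ℕ) (d : ℝ) (D : Fin n → ℤ) : ℝ := Real.log (NN D) - lH n d D

lemma logabs {z : ℝ} (zp :1 /2 ≤ z) : |Real.log z| ≤2 * |z -1| := by
  have f1 : Real.log z ≤ z -1 := Real.log_le_sub_one_of_pos (by linarith)
  have f2 :1 - z⁻¹ ≤ Real.log z := Real.one_sub_inv_le_log_of_pos (by linarith)
  have f3 : -(2 * |z -1|) ≤1 - z⁻¹ := by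
    have :1 - z⁻¹ = (z -1) * z⁻¹ := by field_simp
    rw [this]
    have : z⁻¹ ≤2 := by rw [show (2:ℝ) = (1/2)⁻¹ by norm_num]; exact inv_anti₀ (by norm_num) zp
    have i0 :0 < z⁻¹ := inv_pos.2 (by linarith)
    calc -(2 * |z -1|) ≤ -(z⁻¹ * |z -1|) := by gcongr
      _ ≤ (z -1) * z⁻¹ := by nlinarith [neg_abs_le (z -1)]
  have f4 := le_abs_self (z -1)
  have f5 := abs_nonneg (z -1)
  rw [abs_le]; constructor <;> linarith

namespace Stg
variable (S : Stg)

set_option maxHeartbeats 800000 in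
theorem step0 : ∃ C0 : ℝ, ∃ c0 : ℕ, 1 ≤ C0 ∧ ∀ S : Stg, ∀ k : ℕ, Real.log S.n ≤ k → (4 * k +3 : ℤ) ≤ S.ρ →
    C0 * S.μ * S.L ^ c0 ≤1 → Even (∑ i, S.C i +1) → ∀ a b, a ≠ b → 1 ≤ S.C a → 1 ≤ S.C b →
    0 < NN (S.C - ee a) ∧ 0 < NN (S.C - ee b) ∧
    |Real.log (NN (S.C - ee a)) - Real.log (NN (S.C - ee b)) -
      Real.log (rho S.la 0 S.h (S.e (S.C a)) (S.e (S.C b)) *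
        Real.exp (S.ka * (S.e (S.C a) - S.e (S.C b)) + (S.e (S.C a) - S.e (S.C b)) *
          (S.h - S.e (S.C a) - S.e (S.C b)) * ((1 + S.la) * (1 + S.la)) * (S.μ * S.h * (S.μ * S.h))))| ≤
      C0 * (S.μ ^2 * S.ε ^4 * S.L ^ c0) := by
  obtain ⟨C1, c1, hC1, H1⟩ := ctr
  obtain ⟨C2, c2, hC2, H2⟩ := Pt.bRH
  refine ⟨3000 * C1 ^2 +4 * C2 +3000 * C1, 4 +2 * c1 + c2, by nlinarith, ?_⟩
  set C0 := 3000 * C1 ^2 +4 * C2 +3000 * C1 with hC0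
  set N := 4 +2 * c1 + c2 with hN
  intro S k hk hρ hsm hodd a b hab ha hb
  have hμ := S.μpos; have hε := S.ε0; have hL := S.hL; have hL0 := S.Lpos; have hεL := S.hεL
  have hμ1 := S.μ1; have hν := S.νpos
  have pw : ∀ {i}, i ≤ N → S.L ^ i ≤ S.L ^ N := fun hi => pow_le_pow_right₀ hL hi
  have hC1p :0 < C1 := by linarith
  have t1 : C1 * S.μ * S.L ^ c1 ≤1 /3000 := by
    have :3000 * (C1 * S.μ * S.L ^ c1) ≤ C0 * S.μ * S.L ^ N := by
      have := pw (show c1 ≤ N by omega)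
      calc _ = (3000 * C1) * S.μ * S.L ^ c1 := by ring
        _ ≤ _ := by gcongr; linarith [sq_nonneg C1]
    linarith
  have t2 : C1 * S.μ * S.ε ^4 * S.L ^ c1 ≤1 /100 := by
    have :3000 * (C1 * S.μ * S.ε ^4 * S.L ^ c1) ≤ C0 * S.μ * S.L ^ N := by
      have := pw (show 4 + c1 ≤ N by omega)
      calc _ ≤3000 * (C1 * S.μ * S.L ^4 * S.L ^ c1) := by gcongr
        _ = (3000 * C1) * S.μ * S.L ^ (4 + c1) := by rw [pow_add]; ring
        _ ≤ _ := by gcongr; linarith [sq_nonneg C1]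
    linarith
  have n2 : (2:ℝ) ≤ S.n := mod_cast S.n2
  have k1 :1 ≤ k := by
    have :0 < Real.log S.n := Real.log_pos (by linarith)
    have : (0:ℝ) < k := by linarith
    exact_mod_cast this
  have H := H1 S _ _ rfl rfl t1 t2
  obtain ⟨r1, r2, r3, r4⟩ := ratio H k k1 (mod_cast hρ) S.hC0 hodd hab ha hb
  refine ⟨r1, r2, ?_⟩
  set τ := C1 * S.μ * S.L ^ c1 with hτ
  set η := C1 * S.μ * S.ε ^4 * S.L ^ c1 with hη
  have τ0 :0 < τ := by positivity
  have η0 :0 < η := by positivity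
  -- the contraction term
  have hgeo : (140 * τ) ^ k ≤ η := by
    have e3 :140 * τ ≤ Real.exp (-3) := by
      have :140 * τ ≤140 /3000 := by linarith
      refine this.trans ?_
      have h1 : Real.exp 3 ≤2.7182818286 ^3 := by
        rw [show (3:ℝ) =1 * (3:ℕ) by norm_num, Real.exp_mul, Real.rpow_natCast]
        exact pow_le_pow_left₀ (Real.exp_pos _).le Real.exp_one_lt_d9.le 3
      rw [Real.exp_neg, le_inv_comm₀ (by norm_num) (Real.exp_pos _)]
      refine h1.trans (by norm_num)
    have nn : (140 * τ) ^ k ≤ ((S.n:ℝ) ^3)⁻¹ := by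
      calc (140 * τ) ^ k ≤ Real.exp (-3) ^ k := by gcongr
        _ = Real.exp (-(3 * k)) := by rw [← Real.exp_nat_mul]; congr 1; ring
        _ ≤ Real.exp (-(3 * Real.log S.n)) := by gcongr
        _ = _ := by
          rw [Real.exp_neg, show 3 * Real.log S.n = Real.log S.n * (3:ℕ) by push_cast; ring,
            Real.exp_mul, Real.exp_log (by linarith), Real.rpow_natCast]
    have ε2 : S.h ^2 ≤ S.ε ^4 := by
      calc S.h ^2 ≤ (S.ε ^2) ^2 := pow_le_pow_left₀ S.hpos.le S.hh 2
        _ = _ := by ring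
    have m1 : ((S.n:ℝ) ^2)⁻¹ ≤ S.μ * S.h ^2 := by
      have : S.μ * S.h ^2 = (S.ν * S.d)⁻¹ := by
        unfold μ h ν at *
        have := S.dpos
        field_simp
      rw [this]
      refine inv_anti₀ (mul_pos hν S.dpos) ?_
      have dν : S.d ≤ S.ν := by rw [← S.μν]; nlinarith
      have : S.ν ≤ S.n := by unfold ν; linarith
      nlinarith
    have m2 : S.μ * S.h ^2 ≤ η := by
      have := one_le_pow₀ (n := c1) hL
      calc S.μ * S.h ^2 ≤1 * S.μ * S.ε ^4 *1 := by rw [one_mul, mul_one]; gcongr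
        _ ≤ η := by rw [hη]; gcongr
    refine nn.trans (le_trans ?_ (m1.trans m2))
    refine inv_anti₀ (by positivity) ?_
    exact pow_le_pow_right₀ (by linarith) (by norm_num)
  set x := (NN (S.C - ee a) : ℝ) / NN (S.C - ee b) with hx
  set R := S.Ro (S.C a) (S.C b) with hR
  have r5 : |x - R| ≤689 * (τ * η) * R := by
    refine r4.trans ?_
    have :13 * τ * (20 * (140 * τ) ^ k +33 * η) ≤13 * τ * (20 * η +33 * η) := by gcongr
    calc _ ≤13 * τ * (20 * η +33 * η) * R := by gcongr
      _ = _ := by ring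
  have τη : τ * η ≤ C1 ^2 * (S.μ ^2 * S.ε ^4 * S.L ^ N) := by
    have := pw (show c1 + c1 ≤ N by omega)
    calc τ * η = C1 ^2 * (S.μ ^2 * S.ε ^4 * S.L ^ (c1 + c1)) := by rw [hτ, hη, pow_add]; ring
      _ ≤ _ := by gcongr
  have wa : S.W (S.C a) := (S.eC a).trans (by linarith)
  have wb : S.W (S.C b) := (S.eC b).trans (by linarith)
  have z := H2 (S.p0 wa wa wb)
  have y1 := Pt.yy1 (S.p0 wa wa wb)
  have l1 := abs_le.1 (S.la1 wa); have l2 := abs_le.1 (S.la1 wb)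
  have ka1 := abs_le.1 (S.ka1 wa wb)
  have ea := S.e1' ha; have eb := S.e1' hb
  set u := S.e (S.C a) with hu
  set t := S.e (S.C b) with ht
  set y := S.ka * (u - t) + (u - t) * (S.h - u - t) * ((1 + S.la) * (1 + S.la)) *
    (S.μ * S.h * (S.μ * S.h)) with hy
  have z : |Real.exp y - (1 + S.ka * (u - t))| ≤ C2 * (S.μ ^2 * S.ε ^4 * S.L ^ c2) := z
  have y1 : |y| ≤1 /5 := y1
  set B := S.μ ^2 * S.ε ^4 * S.L ^ N with hB
  have z' : |Real.exp y - (1 + S.ka * (u - t))| ≤ C2 * B := z.trans (by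
    have := pw (show c2 ≤ N by omega)
    rw [hB]; gcongr)
  have ey :4 /5 ≤ Real.exp y := by linarith [Real.add_one_le_exp y, (abs_le.1 y1).1]
  set b0 := rho S.la 0 S.h u t with hb0
  have hb0e : b0 = (1 + u) * (1 - S.la * (t - S.h)) / ((1 + t) * (1 - S.la * (u - S.h))) := by
    rw [hb0]; unfold rho; ring
  have b0p :0 < b0 := by
    rw [hb0e]
    exact div_pos (mul_pos ea (by linarith)) (mul_pos eb (by linarith))
  have hRe : R = b0 * (1 + S.ka * (u - t)) := by rw [hb0e]; rfl
  have B0 :0 < B := by positivity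
  -- relative error
  have rel : |x / (b0 * Real.exp y) -1| ≤ (1000 * C1 ^2 +2 * C2) * B := by
    rw [div_sub_one (by positivity), abs_div, abs_of_pos (by positivity :0 < b0 * Real.exp y),
      div_le_iff₀ (by positivity)]
    have q1 : |x - b0 * Real.exp y| ≤ |x - R| + |R - b0 * Real.exp y| := abs_sub_le _ _ _
    have q2 : |R - b0 * Real.exp y| ≤ b0 * (C2 * B) := by
      rw [hRe, ← mul_sub, abs_mul, abs_of_pos b0p, abs_sub_comm]; gcongr
    have q3 : |x - R| ≤ b0 * (800 * C1 ^2 * B) := by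
      refine r5.trans ?_
      rw [hRe]
      calc 689 * (τ * η) * (b0 * (1 + S.ka * (u - t))) ≤689 * (C1 ^2 * B) * (b0 * (11 /10)) := by
            gcongr <;> linarith
        _ =689 *11 /10 * (C1 ^2 * B * b0) := by ring
        _ ≤800 * (C1 ^2 * B * b0) := by gcongr; norm_num
        _ = _ := by ring
    have q4 : (1000 * C1 ^2 +2 * C2) * B * (b0 * (4 /5)) ≤
        (1000 * C1 ^2 +2 * C2) * B * (b0 * Real.exp y) := by gcongr
    have :0 ≤ b0 * (C2 * B) := by positivity
    linarith
  have small : (1000 * C1 ^2 +2 * C2) * B ≤1 /2 := by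
    have i1 : (2000 * C1 ^2 +4 * C2) * B ≤ C0 * S.μ * S.L ^ N := by
      have g0 : S.ε ^4 ≤ S.L ^4 := by gcongr
      have h9 : S.μ * S.L ^4 ≤1 /1000 := S.hμL
      calc (2000 * C1 ^2 +4 * C2) * B ≤ C0 * B := by gcongr; linarith [sq_nonneg C1]
        _ = C0 * S.μ * (S.μ * S.ε ^4) * S.L ^ N := by rw [hB]; ring
        _ ≤ C0 * S.μ * (S.μ * S.L ^4) * S.L ^ N := by gcongr
        _ ≤ C0 * S.μ *1 * S.L ^ N := by gcongr; linarith
        _ = _ := by ring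
    linarith
  have xp :0 < x := by rw [hx]; positivity
  have n1 : (0:ℝ) < NN (S.C - ee a) := mod_cast r1
  have n2 : (0:ℝ) < NN (S.C - ee b) := mod_cast r2
  rw [← Real.log_div n1.ne' n2.ne', ← hx, ← Real.log_div xp.ne' (by positivity)]
  set z := x / (b0 * Real.exp y)
  have rz := abs_le.1 rel
  have zp :1 /2 ≤ z := by linarith
  have := logabs zp
  refine this.trans ?_
  calc 2 * |z -1| ≤2 * ((1000 * C1 ^2 +2 * C2) * B) := by gcongr
    _ = (2 * (1000 * C1 ^2 +2 * C2)) * B := by ring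
    _ ≤ C0 * B := by gcongr; linarith [sq_nonneg C1]

lemma base_eq (x y : ℤ) : rho S.la 0 S.h (S.e x) (S.e y) =
    (x * ((S.n:ℝ) - y)) / (y * ((S.n:ℝ) - x)) := by
  have hμ1 := S.μ1
  have k : ∀ z : ℤ, (S.n:ℝ) - z = S.ν * (1 - S.μ) * (1 - S.la * (S.e z - S.h)) := fun z => by
    have e : (S.n:ℝ) = S.ν + S.μ * S.h * S.ν := by rw [S.μh]; unfold ν; ring
    rw [e, S.ed z, ← S.μν]
    linear_combination (-(S.ν * (S.e z - S.h))) * S.hrel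
  rw [k x, k y]
  conv_rhs => rw [S.ed x, S.ed y]
  unfold rho
  have h1 :1 - S.μ ≠ 0 := by linarith
  have h2 := S.νpos.ne'; have h3 := S.dpos.ne'
  rw [zero_mul, add_zero, mul_one,
    show S.d * (1 + S.e x) * (S.ν * (1 - S.μ) * (1 - S.la * (S.e y - S.h))) =
      (S.d * S.ν * (1 - S.μ)) * ((1 + S.e x) * (1 - S.la * (S.e y - S.h))) by ring,
    show S.d * (1 + S.e y) * (S.ν * (1 - S.μ) * (1 - S.la * (S.e x - S.h))) =
      (S.d * S.ν * (1 - S.μ)) * ((1 + S.e y) * (1 - S.la * (S.e x - S.h))) by ring,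
    mul_div_mul_left _ _ (by positivity)]

end Stg

lemma sum_ee_f {n : ℕ} (f : ℤ → ℝ) (C : Fin n → ℤ) (a : Fin n) :
    ∑ i, f ((C - ee a) i) = ∑ i, f (C i) - f (C a) + f (C a -1) := by
  rw [← add_sum_erase _ _ (mem_univ a),
    ← add_sum_erase _ (fun i => f (C i)) (mem_univ a)]
  have : ∑ x ∈ univ.erase a, f ((C - ee a) x) = ∑ x ∈ univ.erase a, f (C x) :=
    sum_congr rfl fun i hi => by
      have : i ≠ a := (mem_erase.1 hi).1
      simp [ee_apply, this]
  rw [this]; simp [ee_apply]; ring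

lemma choose_log {n : ℕ} {x : ℤ} (h1 :1 ≤ x) (h2 : x < n) :
    Real.log ((n -1).choose (x -1).toNat) - Real.log ((n -1).choose x.toNat) =
      Real.log (x / ((n:ℝ) - x)) := by
  obtain ⟨k, rfl⟩ : ∃ k : ℕ, x = k +1 := ⟨(x -1).toNat, by omega⟩
  have e1 : ((k:ℤ) +1 -1).toNat = k := by omega
  have e2 : ((k:ℤ) +1).toNat = k +1 := by omega
  rw [e1, e2]
  have hk : k +1 ≤ n -1 := by omega
  have p1 : (0:ℝ) < (n -1).choose k := mod_cast Nat.choose_pos (by omega)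
  have p2 : (0:ℝ) < (n -1).choose (k +1) := mod_cast Nat.choose_pos hk
  have h := Nat.choose_succ_right_eq (n -1) k
  have h' : ((n -1).choose (k +1) : ℝ) * (k +1) = (n -1).choose k * ((n:ℝ) - (k +1)) := by
    have : ((n -1 - k : ℕ) : ℝ) = (n:ℝ) - (k +1) := by
      rw [Nat.cast_sub (by omega), Nat.cast_sub (by omega)]; push_cast; ring
    rw [← this]; exact_mod_cast h
  rw [← Real.log_div p1.ne' p2.ne']
  congr 1
  have : (0:ℝ) < (n:ℝ) - (k +1) := by
    have : (k:ℝ) +1 < n := mod_cast h2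
    linarith
  push_cast
  rw [div_eq_div_iff p2.ne' this.ne']
  linarith

namespace Stg
variable (S : Stg)

lemma C_lt (i : Fin S.n) : S.C i < S.n := by
  have h1 := S.hwin i
  have h3 : (1:ℝ) ≤ S.ρ := mod_cast S.hρ
  have h4 := le_abs_self ((S.C i : ℝ) - S.d)
  have hm := S.hμL
  have hν := S.νpos
  rw [div_mul_eq_mul_div, div_le_iff₀ (show (0:ℝ) < (S.n:ℝ) -1 from hν)] at hm
  have hL := S.hL; have := S.hεL; have hd := S.dpos
  have l1 : S.L ≤ S.L ^4 := le_self_pow₀ hL (by norm_num)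
  have a1 : S.ε * S.d ≤ S.d * S.L ^4 := by nlinarith
  have a2 : S.d ≤ S.d * S.L ^4 := by nlinarith
  have : (S.C i : ℝ) < S.n := by linarith
  exact_mod_cast this

lemma X2_ee (a : Fin S.n) : X2 S.n S.d (S.C - ee a) =
    (S.s + (S.h * S.h -2 * S.h * S.e (S.C a)) * (S.μ * S.h)) * (S.d * (1 + S.la)) := by
  unfold X2
  rw [sum_ee_f (fun x => ((x:ℝ) - S.d) ^2)]
  have e : ∀ i, ((S.C i : ℝ) - S.d) ^2 = S.d ^2 * S.e (S.C i) ^2 := fun i => by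
    rw [S.ed (S.C i)]; ring
  have q : ∑ i, ((S.C i : ℝ) - S.d) ^2 = S.d ^2 * (S.s * S.ν) := by
    rw [sum_congr rfl (fun i _ => e i), ← mul_sum]
    unfold s; rw [div_mul_cancel₀ _ S.νpos.ne']
  rw [q]
  have la :1 + S.la =1 / (1 - S.μ) := by
    have := S.μ1
    unfold la; field_simp [show 1 - S.μ ≠ 0 by linarith]; ring
  have mu : S.d / ((S.n:ℝ) -1) = S.μ := rfl
  have nu : (S.n:ℝ) -1 = S.ν := rfl
  have mh : S.μ * S.h =1 / S.ν := by rw [eq_div_iff S.νpos.ne']; exact S.μh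
  rw [mu, nu, la, mh]
  have h1 :1 - S.μ ≠ 0 := by have := S.μ1; linarith
  have h2 := S.νpos.ne'; have h3 := S.dpos.ne'
  rw [div_eq_iff (by positivity)]
  push_cast
  rw [S.ed (S.C a)]
  unfold h
  field_simp
  ring

lemma lH_diff (a b : Fin S.n) (ha :1 ≤ S.C a) (hb :1 ≤ S.C b) :
    lH S.n S.d (S.C - ee a) - lH S.n S.d (S.C - ee b) =
    Real.log (rho S.la 0 S.h (S.e (S.C a)) (S.e (S.C b)) *
        Real.exp (S.ka * (S.e (S.C a) - S.e (S.C b)) + (S.e (S.C a) - S.e (S.C b)) *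
          (S.h - S.e (S.C a) - S.e (S.C b)) * ((1 + S.la) * (1 + S.la)) * (S.μ * S.h * (S.μ * S.h)))) := by
  have hca := S.C_lt a; have hcb := S.C_lt b
  have ra : (0:ℝ) < (S.n:ℝ) - S.C a := by
    have : (S.C a : ℝ) < S.n := mod_cast hca
    linarith
  have rb : (0:ℝ) < (S.n:ℝ) - S.C b := by
    have : (S.C b : ℝ) < S.n := mod_cast hcb
    linarith
  have pa : (0:ℝ) < S.C a := mod_cast ha
  have pb : (0:ℝ) < S.C b := mod_cast hb
  rw [S.base_eq, Real.log_mul (by positivity) (Real.exp_pos _).ne', Real.log_exp,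
    mul_div_mul_comm, mul_comm, div_mul_div_comm, mul_comm ((S.n:ℝ) - S.C b)]
  unfold lH
  rw [sum_ee_f (fun x => Real.log ((S.n -1).choose x.toNat)),
    sum_ee_f (fun x => Real.log ((S.n -1).choose x.toNat))]
  have ca := choose_log ha hca
  have cb := choose_log hb hcb
  have e : (S.C a * ((S.n:ℝ) - S.C b)) / (((S.C b : ℤ):ℝ) * ((S.n:ℝ) - S.C a)) =
      (S.C a / ((S.n:ℝ) - S.C a)) / (S.C b / ((S.n:ℝ) - S.C b)) := by field_simp
  have e2 : Real.log ((S.C a * ((S.n:ℝ) - S.C b)) / (((S.C b : ℤ):ℝ) * ((S.n:ℝ) - S.C a))) =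
      Real.log (S.C a / ((S.n:ℝ) - S.C a)) - Real.log (S.C b / ((S.n:ℝ) - S.C b)) := by
    rw [e, Real.log_div (by positivity) (by positivity)]
  have e3 : Real.log ((S.C a * ((S.n:ℝ) - S.C b)) / (((S.n:ℝ) - S.C a) * ((S.C b : ℤ):ℝ))) =
      Real.log (S.C a / ((S.n:ℝ) - S.C a)) - Real.log (S.C b / ((S.n:ℝ) - S.C b)) := by
    rw [← e2, mul_comm ((S.n:ℝ) - S.C a)]
  have X := S.X2_ee a
  have Y := S.X2_ee b
  have yk : S.ka * (S.e (S.C a) - S.e (S.C b)) + (S.e (S.C a) - S.e (S.C b)) *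
          (S.h - S.e (S.C a) - S.e (S.C b)) * ((1 + S.la) * (1 + S.la)) * (S.μ * S.h * (S.μ * S.h)) =
      - (X2 S.n S.d (S.C - ee a) ^2 /4 - X2 S.n S.d (S.C - ee b) ^2 /4) := by
    rw [X, Y]
    unfold ka
    have l : S.la = S.μ * (1 + S.la) := by linarith [S.hrel]
    have hd := S.hd
    set lb := 1 + S.la
    rw [l]
    set u := S.e (S.C a); set t := S.e (S.C b)
    have k : S.h * S.h * (S.d * S.d) =1 := by
      calc _ = (S.h * S.d) * (S.h * S.d) := by ring
        _ =1 := by rw [hd]; ring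
    linear_combination (-(u - t) * lb * lb * (S.μ * S.s +(S.h - u - t) * (S.μ * S.h * (S.μ * S.h)))) * k
  rw [e3, yk]; linarith

theorem step : ∃ C0 : ℝ, ∃ c0 : ℕ, 1 ≤ C0 ∧ ∀ S : Stg, ∀ k : ℕ, Real.log S.n ≤ k → (4 * k +3 : ℤ) ≤ S.ρ →
    C0 * S.μ * S.L ^ c0 ≤1 → Even (∑ i, S.C i +1) → ∀ a b, a ≠ b → 1 ≤ S.C a → 1 ≤ S.C b →
    0 < NN (S.C - ee a) ∧ 0 < NN (S.C - ee b) ∧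
    |Tl S.n S.d (S.C - ee a) - Tl S.n S.d (S.C - ee b)| ≤ C0 * (S.μ ^2 * S.ε ^4 * S.L ^ c0) := by
  obtain ⟨C0, c0, h0, H⟩ := step0
  refine ⟨C0, c0, h0, fun S k h1 h2 h3 h4 a b hab ha hb => ?_⟩
  obtain ⟨r1, r2, r3⟩ := H S k h1 h2 h3 h4 a b hab ha hb
  refine ⟨r1, r2, ?_⟩
  rw [← S.lH_diff a b ha hb] at r3
  unfold Tl
  rwa [show Real.log (NN (S.C - ee a)) - lH S.n S.d (S.C - ee a) - (Real.log (NN (S.C - ee b)) -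
    lH S.n S.d (S.C - ee b)) = Real.log (NN (S.C - ee a)) - Real.log (NN (S.C - ee b)) -
    (lH S.n S.d (S.C - ee a) - lH S.n S.d (S.C - ee b)) by ring]

end Stg

structure Prm (n m : ℕ) (d r ε L : ℝ) (k : ℕ) : Prop where
  hd : n * d =2 * m
  n2 :2 ≤ n
  d1 :1 ≤ d
  ε0 :0 < ε
  hr : r +1 + (4 * k +3 +2) ≤ ε * d /2
  hh :1 / d ≤ ε ^2
  hρ2 :8 * ((4 * k +3) +1) * (1 / d) ^2 ≤ ε ^4
  hL :1 ≤ L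
  hεL : ε ≤ L
  hμL : d / ((n : ℝ) -1) * L ^4 ≤1 /1000
  hk : Real.log n ≤ k

def Win {n : ℕ} (m : ℕ) (d r : ℝ) (D : Fin n → ℤ) : Prop :=
  (∀ i, 0 ≤ D i) ∧ ∑ i, D i =2 * m ∧ ∀ i, |(D i : ℝ) - d| ≤ r

def Prm.stg {n m : ℕ} {d r ε L : ℝ} {k : ℕ} (P : Prm n m d r ε L k) (C : Fin n → ℤ)
    (h0 : ∀ i, 0 ≤ C i) (hs : ∑ i, C i =2 * m +1) (hw : ∀ i, |(C i : ℝ) - d| ≤ r +1) : Stg where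
  n := n
  d := d
  ε := ε
  L := L
  C := C
  ρ := 4 * k +3
  n2 := P.n2
  d1 := P.d1
  ε0 := P.ε0
  hρ := by omega
  hC0 := h0
  hCs := by rw [P.hd]; exact_mod_cast hs
  hwin := fun i => by push_cast; linarith [hw i, P.hr]
  hh := P.hh
  hρ2 := by push_cast; exact P.hρ2
  hL := P.hL
  hεL := P.hεL
  hμL := P.hμL

section
variable {n m : ℕ} {d r ε L : ℝ} {k : ℕ}

lemma Prm.addW {D : Fin n → ℤ} (hD : Win m d r D) (b : Fin n) :
    (∀ i, 0 ≤ (D + ee b) i) ∧ ∑ i, (D + ee b) i =2 * m +1 ∧ ∀ i, |((D + ee b) i : ℝ) - d| ≤ r +1 := by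
  refine ⟨fun i => ?_, ?_, fun i => ?_⟩
  · have := hD.1 i
    simp only [Pi.add_apply, ee_apply]; split_ifs <;> omega
  · have := hD.2.1
    simp only [Pi.add_apply, sum_add_distrib, this]; simp [ee_apply]
  · have := abs_le.1 (hD.2.2 i)
    simp only [Pi.add_apply, ee_apply]
    split_ifs <;> push_cast <;> rw [abs_le] <;> constructor <;> linarith

lemma Prm.pos (P : Prm n m d r ε L k) {D : Fin n → ℤ} (hD : Win m d r D) :0 < NN D := by
  have i0 :0 < n := by have := P.n2; omega
  obtain ⟨h1, h2, h3⟩ := Prm.addW hD ⟨0, i0⟩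
  have he : Even (∑ i, D i) := by rw [hD.2.1]; exact even_two_mul _
  refine (P.stg _ h1 h2 h3).hN' (D := D) ⟨hD.1, ?_⟩ he
  · show ∑ i, |D i - (D + ee ⟨0, i0⟩) i| ≤ (4 * k +3 : ℤ)
    have : ∀ i, |D i - (D + ee ⟨0, i0⟩) i| = ee ⟨0, i0⟩ i := fun i => by
      simp only [Pi.add_apply, ee_apply]; split_ifs <;> simp
    rw [sum_congr rfl (fun i _ => this i)]
    simp [ee_apply]; omega

lemma exists_lt_of_sum {D D' : Fin n → ℤ} (hs : ∑ i, D i = ∑ i, D' i) (hne : D ≠ D') :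
    ∃ a, D' a < D a := by
  by_contra h
  push Not at h
  apply hne
  have := (sum_eq_sum_iff_of_le (fun i _ => h i)).1 hs
  exact funext fun i => this i (mem_univ i)

end

theorem tele : ∃ C0 : ℝ, ∃ c0 : ℕ, 1 ≤ C0 ∧ ∀ (n m : ℕ) (d r ε L : ℝ) (k : ℕ), Prm n m d r ε L k →
    C0 * (d / ((n : ℝ) -1)) * L ^ c0 ≤1 → ∀ D D' : Fin n → ℤ, Win m d r D → Win m d r D' →
    |Tl n d D - Tl n d D'| ≤ (∑ i, |(D i : ℝ) - D' i|) *
      (C0 * ((d / ((n : ℝ) -1)) ^2 * ε ^4 * L ^ c0)) := by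
  obtain ⟨C0, c0, h0, H⟩ := Stg.step
  refine ⟨C0, c0, h0, fun n m d r ε L k P hsm => ?_⟩
  set B := C0 * ((d / ((n : ℝ) -1)) ^2 * ε ^4 * L ^ c0) with hB
  have B0 :0 ≤ B := by
    have := P.ε0; have := P.hL
    positivity
  suffices key : ∀ N : ℕ, ∀ D D' : Fin n → ℤ, ∑ i, |D i - D' i| ≤ N → Win m d r D → Win m d r D' →
      |Tl n d D - Tl n d D'| ≤ ((∑ i, |D i - D' i| : ℤ) : ℝ) * B by
    intro D D' hD hD'
    have := key (∑ i, |D i - D' i|).toNat D D' (Int.self_le_toNat _) hD hD'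
    push_cast at this
    exact this
  intro N
  induction N with
  | zero =>
    intro D D' hN hD hD'
    have : D = D' := by
      have := (sum_eq_zero_iff_of_nonneg (fun i _ => abs_nonneg (D i - D' i))).1
        (le_antisymm (by simpa using hN) (sum_nonneg fun i _ => abs_nonneg _))
      exact funext fun i => by
        have := this i (mem_univ i)
        rwa [abs_eq_zero, sub_eq_zero] at this
    rw [this]; simp
  | succ N ih =>
    intro D D' hN hD hD'
    by_cases hne : D = D'
    · rw [hne]; simp
    obtain ⟨a, ha⟩ := exists_lt_of_sum (hD.2.1.trans hD'.2.1.symm) hne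
    obtain ⟨b, hb⟩ := exists_lt_of_sum (hD'.2.1.trans hD.2.1.symm) (Ne.symm hne)
    have hab : a ≠ b := by rintro rfl; omega
    obtain ⟨c1, c2, c3⟩ := Prm.addW hD b
    have e1 : D + ee b - ee b = D := by simp
    set D2 := D + ee b - ee a with hD2
    have qa : D2 a = D a -1 := by simp [hD2, ee_apply, hab]
    have qb : D2 b = D b +1 := by simp [hD2, ee_apply, hab.symm]
    have qo : ∀ i, i ≠ a → i ≠ b → D2 i = D i := fun i h1 h2 => by simp [hD2, ee_apply, h1, h2]
    have st := H (P.stg _ c1 c2 c3) k P.hk le_rfl hsm (by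
      show Even (∑ i, (D + ee b) i +1)
      rw [c2]; exact ⟨m +1, by ring⟩) a b hab
      (by show 1 ≤ (D + ee b) a
          have := hD'.1 a
          simp [ee_apply, hab]; omega)
      (by show 1 ≤ (D + ee b) b
          have := hD.1 b
          simp [ee_apply]; omega)
    have st := st.2.2
    have st : |Tl n d D2 - Tl n d (D + ee b - ee b)| ≤ B := st
    rw [e1] at st
    have w2 : Win m d r D2 := by
      refine ⟨fun i => ?_, ?_, fun i => ?_⟩
      · by_cases h1 : i = a
        · have := hD'.1 a; rw [h1, qa]; omega
        by_cases h2 : i = b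
        · have := hD.1 b; rw [h2, qb]; omega
        · rw [qo i h1 h2]; exact hD.1 i
      · rw [hD2, sum_ee, c2]; ring
      · by_cases h1 : i = a
        · rw [h1, qa]
          have k1 := abs_le.1 (hD.2.2 a); have k2 := abs_le.1 (hD'.2.2 a)
          have k3 : (D' a : ℝ) ≤ D a -1 := mod_cast (by omega : D' a ≤ D a -1)
          push_cast; rw [abs_le]; constructor <;> linarith
        by_cases h2 : i = b
        · rw [h2, qb]
          have k1 := abs_le.1 (hD.2.2 b); have k2 := abs_le.1 (hD'.2.2 b)
          have k3 : (D b : ℝ) +1 ≤ D' b := mod_cast (by omega : D b +1 ≤ D' b)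
          push_cast; rw [abs_le]; constructor <;> linarith
        · rw [qo i h1 h2]; exact hD.2.2 i
    have dist : ∑ i, |D2 i - D' i| ≤ ∑ i, |D i - D' i| -1 := by
      have : ∀ i, |D2 i - D' i| ≤ |D i - D' i| - (ee a i : ℤ) := fun i => by
        by_cases h1 : i = a
        · rw [h1, qa, abs_of_nonneg (by omega), abs_of_nonneg (by omega)]; simp [ee_apply]
        by_cases h2 : i = b
        · rw [h2, qb, abs_of_nonpos (by omega), abs_of_nonpos (by omega)]
          simp [ee_apply, hab.symm]; omega
        · rw [qo i h1 h2]; simp [ee_apply, h1]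
      refine (sum_le_sum fun i _ => this i).trans ?_
      rw [sum_sub_distrib]; simp [ee_apply]
    have I := ih D2 D' (by push_cast at hN; omega) w2 hD'
    have dist' : ((∑ i, |D2 i - D' i| : ℤ) : ℝ) ≤ ((∑ i, |D i - D' i| : ℤ) : ℝ) -1 := by
      exact_mod_cast dist
    calc |Tl n d D - Tl n d D'| ≤ |Tl n d D - Tl n d D2| + |Tl n d D2 - Tl n d D'| := abs_sub_le _ _ _
      _ ≤ B + (((∑ i, |D i - D' i| : ℤ) : ℝ) -1) * B := by
          rw [abs_sub_comm]
          refine add_le_add st (I.trans ?_)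
          gcongr
      _ = _ := by ring

set_option linter.unusedSectionVars false

section Ran
variable {β : Type*} [DecidableEq β]

/-- Expectation over a uniform `M`-subset of `Ω`. -/
def Ex (Ω : Finset β) (M : ℕ) (f : Finset β → ℝ) : ℝ :=
  (∑ S ∈ powersetCard M Ω, f S) / ((#Ω).choose M : ℝ)

variable {Ω : Finset β} {M : ℕ} {f g : Finset β → ℝ}

lemma Ex_add : Ex Ω M (fun S => f S + g S) = Ex Ω M f + Ex Ω M g := by
  simp only [Ex, sum_add_distrib, add_div]

lemma Ex_smul (c : ℝ) : Ex Ω M (fun S => c * f S) = c * Ex Ω M f := by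
  simp only [Ex, ← mul_sum, mul_div_assoc]

lemma Ex_sum {ι : Type*} (s : Finset ι) (f : ι → Finset β → ℝ) :
    Ex Ω M (fun S => ∑ i ∈ s, f i S) = ∑ i ∈ s, Ex Ω M (f i) := by
  simp only [Ex, sum_div]; rw [sum_comm]

lemma Ex_mono (h : ∀ S ∈ powersetCard M Ω, f S ≤ g S) : Ex Ω M f ≤ Ex Ω M g :=
  div_le_div_of_nonneg_right (sum_le_sum h) (Nat.cast_nonneg _)

lemma Ex_const (hM : M ≤ #Ω) (c : ℝ) : Ex Ω M (fun _ => c) = c := by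
  have : ((#Ω).choose M : ℝ) ≠ 0 := mod_cast (Nat.choose_pos hM).ne'
  simp only [Ex, sum_const, card_powersetCard, nsmul_eq_mul]; field_simp

/-- ratio of falling factorials -/
def aa (M N t : ℕ) : ℝ := (M.descFactorial t : ℝ) / (N.descFactorial t : ℝ)

lemma Ex_sub {T : Finset β} (hT : T ⊆ Ω) (hM : M ≤ #Ω) :
    Ex Ω M (fun S => if T ⊆ S then 1 else 0) = aa M (#Ω) (#T) := by
  have h0 : ((#Ω).choose M : ℝ) ≠ 0 := mod_cast (Nat.choose_pos hM).ne'
  have h1 : ((#Ω).descFactorial (#T) : ℝ) ≠ 0 := by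
    exact_mod_cast (Nat.descFactorial_pos.2 (card_le_card hT)).ne'
  rw [Ex, aa, ← sum_filter, sum_const, nsmul_eq_mul, mul_one, div_eq_div_iff h0 h1]
  rcases le_or_gt (#T) M with h | h
  · rw [card_filter_powersetCard_subset _ _ _ hT h]
    have := Nat.choose_mul (n := #Ω) (k := M) h
    rw [Nat.descFactorial_eq_factorial_mul_choose, Nat.descFactorial_eq_factorial_mul_choose]
    have t : ((#Ω).choose M : ℝ) * M.choose (#T) = (#Ω).choose (#T) * (#Ω - #T).choose (M - #T) := by
      exact_mod_cast this
    push_cast; linear_combination -((#T).factorial : ℝ) * t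
  · rw [Nat.descFactorial_eq_zero_iff_lt.2 h, filter_eq_empty_iff.2]
    · simp
    · intro S hS hTS
      have := card_le_card hTS; rw [(mem_powersetCard.1 hS).2] at this; omega

lemma aa_le (N M t : ℕ) (hM : M ≤ N) (ht : t ≤ N) : aa M N t ≤ ((M : ℝ) / N) ^ t := by
  have key : ∀ s, M.descFactorial s * N ^ s ≤ N.descFactorial s * M ^ s := by
    intro s
    induction s with
    | zero => simp
    | succ s ih =>
      rw [Nat.descFactorial_succ, Nat.descFactorial_succ, pow_succ, pow_succ]
      have : (M - s) * N ≤ (N - s) * M := by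
        rw [Nat.sub_mul, Nat.sub_mul, mul_comm M N]
        exact Nat.sub_le_sub_left (Nat.mul_le_mul_left _ hM) _
      calc _ = ((M - s) * N) * (M.descFactorial s * N ^ s) := by ring
        _ ≤ ((N - s) * M) * (N.descFactorial s * M ^ s) := Nat.mul_le_mul this ih
        _ = _ := by ring
  have h1 : (0 : ℝ) < (N.descFactorial t : ℝ) := mod_cast Nat.descFactorial_pos.2 ht
  rcases Nat.eq_zero_or_pos N with rfl | hN
  · obtain rfl : t =0 := by omega
    simp [aa]
  have h2 : (0 : ℝ) < (N : ℝ) ^ t := by positivity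
  rw [aa, div_pow, div_le_div_iff₀ h1 h2, mul_comm ((M : ℝ) ^ t)]
  exact_mod_cast key t

lemma choose_inter (S A : Finset β) (k : ℕ) :
    ((#(S ∩ A)).choose k : ℝ) = ∑ T ∈ powersetCard k A, if T ⊆ S then (1 : ℝ) else 0 := by
  rw [← sum_filter, sum_const, nsmul_eq_mul, mul_one, ← card_powersetCard]
  congr 2; ext T; simp only [mem_powersetCard, mem_filter, subset_inter_iff]; tauto

lemma Ex_choose {A B : Finset β} (hA : A ⊆ Ω) (hB : B ⊆ Ω) (hAB : Disjoint A B) (hM : M ≤ #Ω)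
    (k l : ℕ) : Ex Ω M (fun S => ((#(S ∩ A)).choose k : ℝ) * ((#(S ∩ B)).choose l : ℝ)) =
      (#A).choose k * (#B).choose l * aa M (#Ω) (k + l) := by
  simp only [choose_inter, sum_mul_sum]
  rw [Ex_sum]
  simp only [Ex_sum]
  rw [← card_powersetCard k A, ← card_powersetCard l B, mul_assoc, ← nsmul_eq_mul, ← sum_const]
  refine sum_congr rfl fun T hT => ?_
  rw [← nsmul_eq_mul, ← sum_const]
  refine sum_congr rfl fun U hU => ?_
  obtain ⟨t1, t2⟩ := mem_powersetCard.1 hT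
  obtain ⟨u1, u2⟩ := mem_powersetCard.1 hU
  have := Ex_sub (union_subset (t1.trans hA) (u1.trans hB)) hM
  rw [card_union_of_disjoint (disjoint_of_subset_left t1 (disjoint_of_subset_right u1 hAB)), t2, u2] at this
  rw [← this]; congr 1; funext S
  by_cases h1 : T ⊆ S <;> by_cases h2 : U ⊆ S <;> simp [h1, h2, union_subset_iff]

lemma Ex_pow {A : Finset β} (hA : A ⊆ Ω) (hM : M ≤ #Ω) {c : ℝ} (hc :0 ≤ c) :
    Ex Ω M (fun S => (1 + c) ^ #(S ∩ A)) ≤ (1 + c * (M / #Ω)) ^ #A := by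
  have e : ∀ S : Finset β, (1 + c) ^ #(S ∩ A) = ∑ T ∈ A.powerset, c ^ #T * if T ⊆ S then (1 : ℝ) else 0 := by
    intro S
    rw [← prod_const, prod_one_add]
    simp only [prod_const, mul_ite, mul_one, mul_zero]
    rw [← sum_filter]
    refine sum_congr ?_ fun _ _ => rfl
    ext T; simp only [mem_powerset, mem_filter, subset_inter_iff]; tauto
  simp only [e]
  rw [Ex_sum, ← prod_const, prod_one_add]
  refine sum_le_sum fun T hT => ?_
  have hT := (mem_powerset.1 hT).trans hA
  rw [Ex_smul, Ex_sub hT hM, prod_const, mul_pow]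
  exact mL (aa_le _ _ _ hM (card_le_card hT)) (by positivity)

lemma Ex_compl (hM : M ≤ #Ω) : Ex Ω M f = Ex Ω (#Ω - M) (fun S => f (Ω \ S)) := by
  rw [Ex, Ex, Nat.choose_symm hM]
  congr 1
  refine sum_nbij' (fun S => Ω \ S) (fun S => Ω \ S) ?_ ?_ ?_ ?_ ?_
  · intro S hS; obtain ⟨a, b⟩ := mem_powersetCard.1 hS
    exact mem_powersetCard.2 ⟨sdiff_subset, by rw [card_sdiff_of_subset a, b]⟩
  · intro S hS; obtain ⟨a, b⟩ := mem_powersetCard.1 hS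
    exact mem_powersetCard.2 ⟨sdiff_subset, by rw [card_sdiff_of_subset a, b]; omega⟩
  · intro S hS; exact Finset.sdiff_sdiff_eq_self (mem_powersetCard.1 hS).1
  · intro S hS; exact Finset.sdiff_sdiff_eq_self (mem_powersetCard.1 hS).1
  · intro S hS; rw [Finset.sdiff_sdiff_eq_self (mem_powersetCard.1 hS).1]

lemma Ex_exp {A : Finset β} (hA : A ⊆ Ω) (hM : M ≤ #Ω) (hΩ :0 < #Ω) (x : ℝ) :
    Ex Ω M (fun S => Real.exp (x * #(S ∩ A))) ≤ (1 + (Real.exp x -1) * (M / #Ω)) ^ #A := by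
  rcases le_total 0 x with h | h
  · have := Ex_pow (c := Real.exp x -1) hA hM (by linarith [Real.one_le_exp h])
    refine le_trans (le_of_eq ?_) this
    congr 1; funext S
    rw [mul_comm, Real.exp_nat_mul]; congr 1; ring
  · have := Ex_pow (M := #Ω - M) (c := Real.exp (-x) -1) hA (Nat.sub_le _ _)
      (by linarith [Real.one_le_exp (neg_nonneg.2 h)])
    have h2 : Ex Ω M (fun S => Real.exp (x * #(S ∩ A))) = Real.exp x ^ #A *
        Ex Ω (#Ω - M) (fun S => (1 + (Real.exp (-x) -1)) ^ #(S ∩ A)) := by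
      rw [Ex_compl hM, ← Ex_smul, Ex, Ex]
      congr 1
      refine sum_congr rfl fun S hS => ?_
      have hS := (mem_powersetCard.1 hS).1
      have e1 : (Ω \ S) ∩ A = A \ (S ∩ A) := by
        ext y; simp only [mem_inter, mem_sdiff]
        have := @hA y; tauto
      have e2 : #(A \ (S ∩ A)) = #A - #(S ∩ A) := card_sdiff_of_subset inter_subset_right
      rw [e1, e2, Nat.cast_sub (card_le_card inter_subset_right), add_sub_cancel, ← Real.exp_nat_mul,
        ← Real.exp_nat_mul, ← Real.exp_add]
      congr 1; ring
    rw [h2]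
    refine (mL this (by positivity)).trans (le_of_eq ?_)
    rw [← mul_pow]; congr 1
    have hN : (#Ω : ℝ) ≠ 0 := mod_cast hΩ.ne'
    rw [Nat.cast_sub hM, Real.exp_neg]
    have := (Real.exp_pos x).ne'
    field_simp; ring

/-- mgf of the centred count -/
lemma Ex_mgf {A : Finset β} (hA : A ⊆ Ω) (hM : M ≤ #Ω) (hΩ :0 < #Ω) {d : ℝ}
    (hd : d = #A * (M / #Ω)) {x : ℝ} (hx : |x| ≤1) :
    Ex Ω M (fun S => Real.exp (x * (#(S ∩ A) - d))) ≤ Real.exp (x ^2 * d) := by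
  have e : ∀ S : Finset β, Real.exp (x * (#(S ∩ A) - d)) = Real.exp (-(x * d)) * Real.exp (x * #(S ∩ A)) :=
    fun S => by rw [← Real.exp_add]; congr 1; ring
  simp only [e]
  rw [Ex_smul]
  have h1 := Ex_exp hA hM hΩ x
  have p0 : (0 : ℝ) ≤ M / #Ω := by positivity
  have p1 : (M : ℝ) / #Ω ≤1 := div_le_one_of_le₀ (mod_cast hM) (by positivity)
  have h2 : (1 + (Real.exp x -1) * (M / #Ω)) ^ #A ≤ Real.exp ((Real.exp x -1) * d) := by
    rw [show (Real.exp x -1) * d = #A * ((Real.exp x -1) * (M / #Ω)) by rw [hd]; ring, Real.exp_nat_mul]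
    refine pow_le_pow_left₀ ?_ ?_ _
    · nlinarith [Real.exp_pos x, mul_nonneg (Real.exp_pos x).le p0]
    · linarith [Real.add_one_le_exp ((Real.exp x -1) * (M / #Ω))]
  have d0 :0 ≤ d := by rw [hd]; positivity
  have h3 := (abs_le.1 (Real.abs_exp_sub_one_sub_id_le hx)).2
  calc _ ≤ Real.exp (-(x * d)) * Real.exp ((Real.exp x -1) * d) :=
        mL (h1.trans h2) (Real.exp_pos _).le
    _ = Real.exp ((Real.exp x -1 - x) * d) := by rw [← Real.exp_add]; congr 1; ring
    _ ≤ _ := Real.exp_le_exp.2 (mR h3 d0)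

lemma Ex_tail {A : Finset β} (hA : A ⊆ Ω) (hM : M ≤ #Ω) (hΩ :0 < #Ω) {d : ℝ}
    (hd : d = #A * (M / #Ω)) {x r : ℝ} (hx : |x| ≤1) (hx0 :0 ≤ x) :
    Ex Ω M (fun S => if |(#(S ∩ A) : ℝ) - d| ≤ r then 0 else 1) ≤2 * Real.exp (x ^2 * d - x * r) := by
  have h1 := Ex_mgf hA hM hΩ hd hx
  have h2 := Ex_mgf hA hM hΩ hd (x := -x) (by rwa [abs_neg])
  rw [neg_sq] at h2
  have : ∀ S ∈ powersetCard M Ω, (if |(#(S ∩ A) : ℝ) - d| ≤ r then (0 : ℝ) else 1) ≤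
      Real.exp (-(x * r)) * (Real.exp (x * (#(S ∩ A) - d)) + Real.exp (-x * (#(S ∩ A) - d))) := by
    intro S _
    split_ifs with h
    · positivity
    · push Not at h
      rw [mul_add, ← Real.exp_add, ← Real.exp_add]
      rcases le_total 0 ((#(S ∩ A) : ℝ) - d) with k | k
      · rw [abs_of_nonneg k] at h
        have := Real.one_le_exp (x := -(x * r) + x * (#(S ∩ A) - d)) (by nlinarith)
        linarith [Real.exp_pos (-(x * r) + -x * (#(S ∩ A) - d))]
      · rw [abs_of_nonpos k] at h
        have := Real.one_le_exp (x := -(x * r) + -x * (#(S ∩ A) - d)) (by nlinarith)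
        linarith [Real.exp_pos (-(x * r) + x * (#(S ∩ A) - d))]
  refine (Ex_mono this).trans ?_
  rw [Ex_smul, Ex_add]
  calc _ ≤ Real.exp (-(x * r)) * (Real.exp (x ^2 * d) + Real.exp (x ^2 * d)) :=
        mL (add_le_add h1 h2) (Real.exp_pos _).le
    _ = _ := by rw [sub_eq_add_neg, Real.exp_add]; ring

lemma Ex_four {A : Finset β} (hA : A ⊆ Ω) (hM : M ≤ #Ω) (hΩ :0 < #Ω) {d : ℝ}
    (hd : d = #A * (M / #Ω)) (d1 :1 ≤ d) :
    Ex Ω M (fun S => ((#(S ∩ A) : ℝ) - d) ^4) ≤150 * d ^2 := by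
  have s0 :0 < Real.sqrt d := Real.sqrt_pos.2 (by linarith)
  have s1 : Real.sqrt d ^2 = d := Real.sq_sqrt (by linarith)
  have sx : |(Real.sqrt d)⁻¹| ≤1 := by
    rw [abs_of_pos (by positivity)]
    exact inv_le_one_of_one_le₀ (Real.one_le_sqrt.2 d1)
  have h1 := Ex_mgf hA hM hΩ hd sx
  have h2 := Ex_mgf hA hM hΩ hd (x := -(Real.sqrt d)⁻¹) (by rwa [abs_neg])
  have e1 : (Real.sqrt d)⁻¹ ^2 * d =1 := by rw [inv_pow, s1]; field_simp
  rw [neg_sq, e1] at h2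
  rw [e1] at h1
  have : ∀ S ∈ powersetCard M Ω, ((#(S ∩ A) : ℝ) - d) ^4 ≤
      24 * d ^2 * (Real.exp ((Real.sqrt d)⁻¹ * (#(S ∩ A) - d)) + Real.exp (-(Real.sqrt d)⁻¹ * (#(S ∩ A) - d))) := by
    intro S _
    set y := (#(S ∩ A) : ℝ) - d
    set t := (Real.sqrt d)⁻¹ * y with ht
    have hy : y ^4 = d ^2 * t ^4 := by
      have : d ^2 * t ^4 = ((Real.sqrt d)⁻¹ ^2 * d) ^2 * y ^4 := by rw [ht]; ring
      rw [this, e1]; ring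
    have ht4 : t ^4 ≤24 * (Real.exp t + Real.exp (-t)) := by
      rcases le_total 0 t with h | h
      · have := Real.pow_div_factorial_le_exp t h 4
        norm_num [Nat.factorial] at this
        linarith [Real.exp_pos (-t)]
      · have := Real.pow_div_factorial_le_exp (-t) (by linarith) 4
        norm_num [Nat.factorial] at this
        have e : (-t) ^4 = t ^4 := by ring
        linarith [Real.exp_pos t]
    rw [hy, neg_mul, ← ht]
    nlinarith [mL ht4 (sq_nonneg d)]
  refine (Ex_mono this).trans ?_
  rw [Ex_smul, Ex_add]
  have e3 := Real.exp_one_lt_d9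
  have d2 :0 ≤ d ^2 := sq_nonneg d
  nlinarith [mL (add_le_add h1 h2) d2]

end Ran

/-- the `i`-th row of the grid -/
def row (n ν : ℕ) (i : Fin n) : Finset (Fin n × Fin ν) := univ.filter (fun p => p.1 = i)

lemma card_row (n ν : ℕ) (i : Fin n) : #(row n ν i) = ν := by
  have : row n ν i = {i} ×ˢ univ := by ext ⟨a, b⟩; simp [row, eq_comm]
  rw [this, card_product]; simp

lemma disj_row (n ν : ℕ) {i j : Fin n} (h : i ≠ j) : Disjoint (row n ν i) (row n ν j) := by
  rw [disjoint_left]; intro p hp hq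
  simp only [row, mem_filter] at hp hq; exact h (hp.2.symm.trans hq.2)

/-- row counts -/
def dB {n ν : ℕ} (S : Finset (Fin n × Fin ν)) (i : Fin n) : ℕ := #(S ∩ row n ν i)

lemma sum_dB {n ν : ℕ} (S : Finset (Fin n × Fin ν)) : ∑ i, dB S i = #S := by
  rw [card_eq_sum_card_fiberwise (f := Prod.fst) (t := univ) (by simp)]
  refine sum_congr rfl fun i _ => ?_
  rw [dB]; congr 1; ext p; simp [row]

lemma card_grid (n ν : ℕ) : #(univ : Finset (Fin n × Fin ν)) = n * ν := by simp

lemma aa_vals {M N : ℕ} (hM :4 ≤ M) (hN :4 ≤ N) : aa M N 0 =1 ∧ aa M N 1 = (M : ℝ) / N ∧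
    aa M N 2 = (M : ℝ) * (M -1) / (N * (N -1)) ∧
    aa M N 3 = (M : ℝ) * (M -1) * (M -2) / (N * (N -1) * (N -2)) ∧
    aa M N 4 = (M : ℝ) * (M -1) * (M -2) * (M -3) / (N * (N -1) * (N -2) * (N -3)) := by
  have h : ∀ K : ℕ, 4 ≤ K → ((K -1 : ℕ) : ℝ) = K -1 ∧ ((K -2 : ℕ) : ℝ) = K -2 ∧ ((K -3 : ℕ) : ℝ) = K -3 := by
    intro K hK
    exact ⟨by rw [Nat.cast_sub (by omega)]; simp, by rw [Nat.cast_sub (by omega)]; simp,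
      by rw [Nat.cast_sub (by omega)]; simp⟩
  obtain ⟨a1, a2, a3⟩ := h M hM
  obtain ⟨b1, b2, b3⟩ := h N hN
  refine ⟨by simp [aa], by simp [aa], ?_, ?_, ?_⟩ <;>
    simp only [aa, Nat.descFactorial_succ, Nat.descFactorial_zero, Nat.sub_zero, Nat.cast_mul, a1, a2, a3, b1, b2, b3, mul_one] <;> congr 1 <;> ring

/-- centred quadratic statistic -/
def ZZ (p ν : ℝ) (k : ℕ) : ℝ := p ^2 * ν * (ν -1) * (k.choose 0 : ℝ) -2 * p * (ν -1) * (k.choose 1 : ℝ) +2 * (k.choose 2 : ℝ)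

lemma ZZ_eq (p ν : ℝ) (k : ℕ) : ZZ p ν k = ((k : ℝ) - ν * p) ^2 - (1 -2 * p) * ((k : ℝ) - ν * p) - ν * p * (1 - p) := by
  rw [ZZ, Nat.cast_choose_two]; simp; ring

lemma c4_id (p N : ℝ) (h0 : N ≠ 0) (h1 : N -1 ≠ 0) (h2 : N -2 ≠ 0) (h3 : N -3 ≠ 0) :
    (p * N) * (p * N -1) * (p * N -2) * (p * N -3) / (N * (N -1) * (N -2) * (N -3))
    - 4 * p * ((p * N) * (p * N -1) * (p * N -2) / (N * (N -1) * (N -2)))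
    + 6 * p ^2 * ((p * N) * (p * N -1) / (N * (N -1))) -4 * p ^3 * (p * N / N) + p ^4
    = 3 * p * (1 - p) * ((N +6) * p * (1 - p) -2) / ((N -1) * (N -2) * (N -3)) := by
  field_simp; ring

lemma cov_le {n ν m : ℕ} (hn :4 ≤ n) (hν :3 ≤ ν) (hm :4 ≤2 * m) (hM :2 * m ≤ n * ν) {p : ℝ}
    (hp : p * (n * ν) =2 * m) {i j : Fin n} (hij : i ≠ j) :
    Ex (univ : Finset (Fin n × Fin ν)) (2 * m) (fun S => ZZ p ν (dB S i) * ZZ p ν (dB S j)) ≤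
      12 * (ν * p) ^2 / n ^2 := by
  have hN : (12 : ℝ) ≤ n * ν := mod_cast (by nlinarith :12 ≤ n * ν)
  have n0 : (4 : ℝ) ≤ n := mod_cast hn
  have ν0 : (3 : ℝ) ≤ ν := mod_cast hν
  have m0 : (4 : ℝ) ≤2 * m := mod_cast hm
  have m1 : (2 * m : ℝ) ≤ n * ν := mod_cast hM
  obtain ⟨N, hNe⟩ : ∃ N : ℝ, N = n * ν := ⟨_, rfl⟩
  rw [← hNe] at hN hp m1
  have p0 :0 ≤ p := by by_contra h; push Not at h; nlinarith
  have p1 : p ≤1 := by by_contra h; push Not at h; nlinarith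
  have E : ∀ k l : ℕ, Ex (univ : Finset (Fin n × Fin ν)) (2 * m)
      (fun S => ((dB S i).choose k : ℝ) * ((dB S j).choose l : ℝ)) =
      ν.choose k * ν.choose l * aa (2 * m) (n * ν) (k + l) := fun k l => by
    have := Ex_choose (M := 2 * m) (subset_univ _) (subset_univ _) (disj_row n ν hij) (by rw [card_grid]; exact hM) k l
    rw [card_row, card_row, card_grid] at this
    exact this
  have sp : (fun S : Finset (Fin n × Fin ν) => ZZ p ν (dB S i) * ZZ p ν (dB S j)) = fun S =>
      ∑ k ∈ range 3, ∑ l ∈ range 3, (![p ^2 * ν * (ν -1), -(2 * p * (ν -1)), 2] (Fin.ofNat 3 k) * ![p ^2 * ν * (ν -1), -(2 * p * (ν -1)), 2] (Fin.ofNat 3 l)) *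
        (((dB S i).choose k : ℝ) * ((dB S j).choose l : ℝ)) := by
    funext S
    simp only [sum_range_succ, sum_range_zero, ZZ]
    simp [Fin.ofNat]; ring
  rw [sp]
  simp only [Ex_sum, Ex_smul, E]
  obtain ⟨v0, v1, v2, v3, v4⟩ := aa_vals (M := 2 * m) (N := n * ν) hm (by nlinarith)
  push_cast at v1 v2 v3 v4
  rw [← hNe, ← hp] at v1 v2 v3 v4
  simp only [sum_range_succ, sum_range_zero]
  norm_num [Fin.ofNat, v0, v1, v2, v3, v4, Nat.cast_choose_two]
  have id := c4_id p N (by linarith) (by linarith) (by linarith) (by linarith)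
  have D0 :0 < (N -1) * (N -2) * (N -3) := mul_pos (mul_pos (by linarith) (by linarith)) (by linarith)
  have bd :3 * p * (1 - p) * ((N +6) * p * (1 - p) -2) / ((N -1) * (N -2) * (N -3)) ≤12 * p ^2 / N ^2 := by
    rw [div_le_div_iff₀ D0 (by positivity)]
    have q1 :3 * p * (1 - p) * ((N +6) * p * (1 - p) -2) ≤3 * p ^2 * (N +6) := by
      have e1 :0 ≤ p * (1 - p) := mul_nonneg p0 (by linarith)
      have e2 : (1 - p) * (1 - p) ≤1 := mul_le_one₀ (by linarith) (by linarith) (by linarith)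
      linarith [mL e2 (by positivity :0 ≤3 * p ^2 * (N +6))]
    have q2 : N ^2 * (N +6) ≤4 * ((N -1) * (N -2) * (N -3)) := by
      obtain ⟨t, ht⟩ : ∃ t, t = N -12 := ⟨_, rfl⟩
      have t0 :0 ≤ t := by linarith
      obtain rfl : N = t +12 := by linarith
      linarith [pow_nonneg t0 2, pow_nonneg t0 3]
    calc _ ≤3 * p ^2 * (N +6) * N ^2 := by gcongr
      _ =3 * p ^2 * (N ^2 * (N +6)) := by ring
      _ ≤3 * p ^2 * (4 * ((N -1) * (N -2) * (N -3))) := by gcongr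
      _ = _ := by ring
  have fin : (ν : ℝ) ^2 * (ν -1) ^2 * (12 * p ^2 / N ^2) ≤12 * (ν * p) ^2 / n ^2 := by
    have e : (12 : ℝ) * (ν * p) ^2 / n ^2 = ν ^4 * (12 * p ^2 / N ^2) := by
      rw [hNe]; field_simp
    rw [e]
    have e4 : (ν : ℝ) ^4 = ν ^2 * ν ^2 := by ring
    rw [e4]; gcongr <;> linarith
  refine le_trans (le_of_eq ?_) ((mL (id.trans_le bd) (by positivity :0 ≤ (ν : ℝ) ^2 * (ν -1) ^2)).trans fin)
  ring

/-- basic size assumptions for the normalisation -/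
structure Bas (n ν m : ℕ) (d : ℝ) : Prop where
  hν : ν +1 = n
  hn :4 ≤ n
  hd : (n : ℝ) * d =2 * m
  d1 :1 ≤ d
  hp : d ≤ ν /2

namespace Bas
variable {n ν m : ℕ} {d : ℝ}

lemma νr (h : Bas n ν m d) : (ν : ℝ) = n -1 := by rw [← h.hν]; push_cast; ring
lemma nr (h : Bas n ν m d) : (4 : ℝ) ≤ n := mod_cast h.hn
lemma νd (h : Bas n ν m d) : (ν : ℝ) * (d / ν) = d := by
  have a := h.νr; have b := h.nr; exact mul_div_cancel₀ _ (by linarith)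
lemma hM (h : Bas n ν m d) :2 * m ≤ n * ν := by
  have : (2 * m : ℝ) ≤ n * ν := by rw [← h.hd]; have := h.nr; have := h.hp; have := h.d1; gcongr; linarith
  exact_mod_cast this
lemma hM' (h : Bas n ν m d) :2 * m ≤ #(univ : Finset (Fin n × Fin ν)) := by rw [card_grid]; exact h.hM
lemma hΩ (h : Bas n ν m d) :0 < #(univ : Finset (Fin n × Fin ν)) := by
  rw [card_grid]; have := h.hν; have := h.hn; exact Nat.mul_pos (by omega) (by omega)
lemma dd (h : Bas n ν m d) (i : Fin n) :
    d = #(row n ν i) * ((2 * m : ℕ) / #(univ : Finset (Fin n × Fin ν)) : ℝ) := by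
  rw [card_row, card_grid]; push_cast; rw [← h.hd]
  have := h.νr; have := h.nr
  have : (ν : ℝ) ≠ 0 := by linarith
  field_simp

lemma four (h : Bas n ν m d) (i : Fin n) :
    Ex (univ : Finset (Fin n × Fin ν)) (2 * m) (fun S => ((dB S i : ℝ) - d) ^4) ≤150 * d ^2 :=
  Ex_four (subset_univ _) h.hM' h.hΩ (h.dd i) h.d1

lemma Zsq (h : Bas n ν m d) (i : Fin n) :
    Ex (univ : Finset (Fin n × Fin ν)) (2 * m) (fun S => ZZ (d / ν) ν (dB S i) * ZZ (d / ν) ν (dB S i)) ≤700 * d ^2 := by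
  have hν := h.νr; have hn := h.nr; have d1 := h.d1; have hp := h.hp
  have ν0 :0 < (ν : ℝ) := by linarith
  have p0 :0 ≤ d / ν := by positivity
  have p1 : d / ν ≤1 /2 := by rw [div_le_iff₀ ν0]; linarith
  have : ∀ S ∈ powersetCard (2 * m) (univ : Finset (Fin n × Fin ν)), ZZ (d / ν) ν (dB S i) * ZZ (d / ν) ν (dB S i) ≤
      (9 /2) * ((dB S i : ℝ) - d) ^4 + (3 /2 +3 * d ^2) := by
    intro S _
    rw [ZZ_eq, h.νd]
    set y := (dB S i : ℝ) - d
    set p := d / ν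
    have a1 : ((1 -2 * p) * y) ^2 ≤ y ^2 := by
      rw [mul_pow]; exact mul_le_of_le_one_left (sq_nonneg _) (pow_le_one₀ (by linarith) (by linarith))
    have a2 : (d * (1 - p)) ^2 ≤ d ^2 := by
      rw [mul_pow]; exact mul_le_of_le_one_right (sq_nonneg _) (pow_le_one₀ (by linarith) (by linarith))
    have a3 : y ^2 ≤ (y ^4 +1) /2 := by linarith [sq_nonneg (y ^2 -1)]
    have a4 : ∀ a b c : ℝ, (a - b - c) * (a - b - c) ≤3 * (a ^2 + b ^2 + c ^2) := fun a b c => by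
      linarith [sq_nonneg (a + b), sq_nonneg (a + c), sq_nonneg (b - c)]
    have := a4 (y ^2) ((1 -2 * p) * y) (d * (1 - p))
    linarith
  refine (Ex_mono this).trans ?_
  rw [Ex_add, Ex_smul, Ex_const h.hM']
  have :1 ≤ d ^2 := one_le_pow₀ d1
  linarith [h.four i]

lemma Zvar (h : Bas n ν m d) :
    Ex (univ : Finset (Fin n × Fin ν)) (2 * m) (fun S => (∑ i, ZZ (d / ν) ν (dB S i)) ^2) ≤712 * n * d ^2 := by
  have hν := h.νr; have hn := h.nr; have d1 := h.d1
  have : (fun S : Finset (Fin n × Fin ν) => (∑ i, ZZ (d / ν) ν (dB S i)) ^2) =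
      fun S => ∑ i, ∑ j, ZZ (d / ν) ν (dB S i) * ZZ (d / ν) ν (dB S j) := by
    funext S; rw [sq, sum_mul_sum]
  rw [this, Ex_sum]
  simp only [Ex_sum]
  have hm :4 ≤2 * m := by
    have : (4 : ℝ) ≤2 * m := by rw [← h.hd]; nlinarith
    exact_mod_cast this
  have b : ∀ i j : Fin n, Ex (univ : Finset (Fin n × Fin ν)) (2 * m) (fun S => ZZ (d / ν) ν (dB S i) * ZZ (d / ν) ν (dB S j)) ≤
      (if i = j then 700 * d ^2 else 0) +12 * d ^2 / n ^2 := by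
    intro i j
    have e0 :0 ≤12 * d ^2 / (n : ℝ) ^2 := by positivity
    split_ifs with hij
    · subst hij; linarith [h.Zsq i]
    · have := cov_le (ν := ν) h.hn (by have := h.hν; have := h.hn; omega) hm h.hM (p := d / ν) (by rw [← h.hd]; linear_combination (n : ℝ) * h.νd) hij
      rw [h.νd] at this; linarith
  refine (sum_le_sum fun i _ => sum_le_sum fun j _ => b i j).trans ?_
  simp only [sum_add_distrib, sum_ite_eq, mem_univ, if_true, sum_const, card_univ, Fintype.card_fin, nsmul_eq_mul]
  have e : (n : ℝ) * (n * (12 * d ^2 / n ^2)) =12 * d ^2 := by field_simp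
  rw [e]
  have : d ^2 ≤ n * d ^2 := le_mul_of_one_le_left (sq_nonneg _) (by linarith)
  linarith

lemma Xdev (h : Bas n ν m d) :
    Ex (univ : Finset (Fin n × Fin ν)) (2 * m) (fun S => |X2 n d (fun i => (dB S i : ℤ)) -1|) ≤20000 / Real.sqrt n := by
  have hν := h.νr; have hn := h.nr; have d1 := h.d1; have hp := h.hp
  have ν0 :0 < (ν : ℝ) := by linarith
  have p1 : d / ν ≤1 /2 := by rw [div_le_iff₀ ν0]; linarith
  have s0 :0 < Real.sqrt n := Real.sqrt_pos.2 (by linarith)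
  have s1 : Real.sqrt n * Real.sqrt n = n := Real.mul_self_sqrt (by linarith)
  set s := Real.sqrt n
  obtain ⟨q, hq⟩ : ∃ q, q =1 - d / (ν : ℝ) := ⟨_, rfl⟩
  have q0 :1 /2 ≤ q := by linarith
  have : ∀ S ∈ powersetCard (2 * m) (univ : Finset (Fin n × Fin ν)), |X2 n d (fun i => (dB S i : ℤ)) -1| ≤
      (s / (ν * d * q) ^2) * (∑ i, ZZ (d / ν) ν (dB S i)) ^2 + (1 / (2 * s) + s / ν ^2) := by
    intro S hS
    have hS : (∑ i, (dB S i : ℝ)) = n * d := by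
      have := sum_dB S; rw [(mem_powersetCard.1 hS).2] at this
      rw [h.hd]; exact_mod_cast this
    have e1 : ∑ i, ZZ (d / ν) ν (dB S i) = (∑ i, ((dB S i : ℝ) - d) ^2) - n * (d * q) := by
      simp only [ZZ_eq, h.νd]
      rw [sum_sub_distrib, sum_sub_distrib, ← mul_sum, sum_sub_distrib, hS]
      rw [hq]; simp only [sum_const, card_univ, Fintype.card_fin, nsmul_eq_mul]; ring
    have e2 : X2 n d (fun i => (dB S i : ℤ)) -1 = (∑ i, ZZ (d / ν) ν (dB S i)) / (ν * d * q) +1 / ν := by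
      rw [X2, ← hν, ← hq, e1]; push_cast
      have : (n : ℝ) = ν +1 := by linarith
      rw [this]; field_simp; ring
    rw [e2]
    set w := (∑ i, ZZ (d / ν) ν (dB S i)) / (ν * d * q) with hw
    have e3 : s / (ν * d * q) ^2 * (∑ i, ZZ (d / ν) ν (dB S i)) ^2 = s * w ^2 := by rw [hw, div_pow]; ring
    rw [e3]
    have a1 : |w +1 / ν| ≤1 / (2 * s) + s /2 * (w +1 / ν) ^2 := by
      have := sq_nonneg (s * |w +1 / ν| -1)
      rw [← sq_abs (w +1 / ν)]
      set y := |w +1 / ν|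
      have :0 ≤ (s * y -1) ^2 / (2 * s) := by positivity
      have e : (s * y -1) ^2 / (2 * s) = s /2 * y ^2 - y +1 / (2 * s) := by field_simp; ring
      linarith
    have a2 : (w +1 / ν) ^2 ≤2 * w ^2 +2 * (1 / ν) ^2 := by linarith [sq_nonneg (w -1 / ν)]
    have a3 := mL a2 (by positivity :0 ≤ s /2)
    have e5 : s / (ν : ℝ) ^2 = s * (1 / ν) ^2 := by field_simp
    rw [e5]; linarith
  refine (Ex_mono this).trans ?_
  rw [Ex_add, Ex_smul, Ex_const h.hM']
  have nν : (n : ℝ) ≤2 * ν := by linarith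
  have c1 : s / (ν * d * q) ^2 * (712 * n * d ^2) ≤12000 / s := by
    have : s / (ν * d * q) ^2 * (712 * n * d ^2) =712 * (n * s) / (ν * q) ^2 := by field_simp
    rw [this, div_le_div_iff₀ (by positivity) s0]
    have : (n /4 : ℝ) ≤ ν * q := by nlinarith
    have t := mul_self_le_mul_self (by positivity) this
    calc 712 * (n * s) * s =712 * n * (s * s) := by ring
      _ =11392 * (n /4 * (n /4)) := by rw [s1]; ring
      _ ≤12000 * (ν * q) ^2 := by rw [sq]; nlinarith
  have c2 : s / (ν : ℝ) ^2 ≤4 / s := by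
    rw [div_le_div_iff₀ (by positivity) s0, s1]; nlinarith
  have c3 := mL h.Zvar (by positivity :0 ≤ s / (ν * d * q) ^2)
  have e1 :1 / (2 * s) = (1 /2) / s := by field_simp
  have e2 :20000 / s =12000 / s + (1 /2) / s +4 / s +7995.5 / s := by rw [← add_div, ← add_div, ← add_div]; norm_num
  have :0 ≤7995.5 / s := by positivity
  linarith

lemma dev1 (h : Bas n ν m d) (i : Fin n) :
    Ex (univ : Finset (Fin n × Fin ν)) (2 * m) (fun S => |(dB S i : ℝ) - d|) ≤151 * Real.sqrt d := by
  have d1 := h.d1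
  have s0 :0 < Real.sqrt d := Real.sqrt_pos.2 (by linarith)
  have s1 : Real.sqrt d ^2 = d := Real.sq_sqrt (by linarith)
  have : ∀ S ∈ powersetCard (2 * m) (univ : Finset (Fin n × Fin ν)), |(dB S i : ℝ) - d| ≤
      (Real.sqrt d / d ^2) * ((dB S i : ℝ) - d) ^4 + Real.sqrt d := by
    intro S _
    have e : ((dB S i : ℝ) - d) ^4 = |(dB S i : ℝ) - d| ^4 := by rw [Even.pow_abs (by decide)]
    rw [e]; set y := |(dB S i : ℝ) - d|
    have : y / Real.sqrt d ≤ (y / Real.sqrt d) ^4 +1 := by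
      have t := abs_nonneg ((dB S i : ℝ) - d)
      have :0 ≤ y / Real.sqrt d := by positivity
      set t := y / Real.sqrt d
      rcases le_total t 1 with k | k
      · linarith [pow_nonneg this 4]
      · linarith [le_self_pow₀ k (by norm_num : (4 : ℕ) ≠ 0)]
    have e2 : (Real.sqrt d / d ^2) * y ^4 = Real.sqrt d * (y / Real.sqrt d) ^4 := by
      rw [div_pow, show Real.sqrt d ^4 = d ^2 by rw [← s1]; rw [s1]; nth_rewrite 2 [← s1]; ring]; ring
    rw [e2]
    have := mL this s0.le
    rw [mul_div_cancel₀ _ s0.ne'] at this; linarith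
  refine (Ex_mono this).trans ?_
  rw [Ex_add, Ex_smul, Ex_const h.hM']
  have c3 := mL (h.four i) (by positivity :0 ≤ Real.sqrt d / d ^2)
  have e : Real.sqrt d / d ^2 * (150 * d ^2) =150 * Real.sqrt d := by field_simp
  linarith
end Bas

def Om (n : ℕ) : Finset (Sym2 (Fin n)) := univ.filter (fun e => ¬ e.IsDiag)
def inc (n : ℕ) (i : Fin n) : Finset (Sym2 (Fin n)) := (Om n).filter (fun e => i ∈ e)

lemma card_inc {n ν : ℕ} (h : ν +1 = n) (i : Fin n) : #(inc n i) = ν := by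
  have : inc n i = (univ.erase i).image (fun j => s(i, j)) := by
    ext e
    simp only [inc, Om, mem_filter, mem_univ, true_and, mem_image, mem_erase, and_true]
    constructor
    · rintro ⟨h1, h2⟩
      obtain ⟨j, rfl⟩ := Sym2.mem_iff_exists.1 h2
      exact ⟨j, fun hj => h1 (by simp [hj]), rfl⟩
    · rintro ⟨j, h1, rfl⟩
      exact ⟨by simpa using h1.symm, by simp⟩
  have inj : Function.Injective (fun j : Fin n => s(i, j)) := fun a b hab => by
    have : a = b ∨ i = b ∧ a = i := by simpa using hab
    rcases this with h | ⟨h, k⟩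
    · exact h
    · rw [k, h]
  rw [this, card_image_of_injective _ inj, card_erase_of_mem (mem_univ _)]
  simp; omega

lemma Graphs_m (n m : ℕ) : (Graphs n).filter (fun E => E.card = m) = powersetCard m (Om n) := by
  ext E; simp only [mem_filter, mem_Graphs, mem_powersetCard, Om]
  refine and_congr_left' ⟨fun h e he => by simpa using h e he, fun h e he => by simpa using h he⟩

lemma deg_inc {n : ℕ} {E : Finset (Sym2 (Fin n))} (hE : E ⊆ Om n) (i : Fin n) : deg E i = #(E ∩ inc n i) := by
  rw [deg]; congr 1; ext e
  simp only [mem_filter, mem_inter, inc]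
  exact ⟨fun h => ⟨h.1, hE h.1, h.2⟩, fun h => ⟨h.1, h.2.2⟩⟩

lemma card_Om {n ν : ℕ} (h : ν +1 = n) : n * ν =2 * #(Om n) := by
  rw [← sum_deg (E := Om n) (mem_Graphs.2 fun e he => by simpa [Om] using he)]
  rw [sum_congr rfl (g := fun _ => ν)]
  · simp
  · intro i _
    rw [deg_inc (subset_refl _), ← card_inc h i]; congr 1
    exact inter_eq_right.2 (filter_subset _ _)

/-- window of natural sequences -/
def WW (n m : ℕ) (d r : ℝ) : Finset (Fin n → ℕ) := by
  classical exact
  (Fintype.piFinset fun _ : Fin n => range n).filter (fun D => ∑ i, D i =2 * m ∧ ∀ i, |(D i : ℝ) - d| ≤ r)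

lemma mem_WW {n m : ℕ} {d r : ℝ} {D : Fin n → ℕ} :
    D ∈ WW n m d r ↔ (∀ i, D i < n) ∧ ∑ i, D i =2 * m ∧ ∀ i, |(D i : ℝ) - d| ≤ r := by
  simp [WW]

lemma NN_nat {n m : ℕ} {D : Fin n → ℕ} (hD : ∑ i, D i =2 * m) :
    NN (fun i => (D i : ℤ)) = #((powersetCard m (Om n)).filter (fun E => ∀ i, deg E i = D i)) := by
  rw [NN, cnt_def, ← Graphs_m]
  congr 1; ext E
  simp only [mem_filter, and_true, Nat.cast_inj]
  constructor
  · rintro ⟨h1, h2⟩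
    refine ⟨⟨h1, ?_⟩, h2⟩
    have := sum_deg h1; simp only [h2, hD] at this; omega
  · rintro ⟨⟨h1, _⟩, h2⟩; exact ⟨h1, h2⟩

lemma Gsum {n ν m : ℕ} {d r : ℝ} (h : ν +1 = n) :
    (∑ E ∈ powersetCard m (Om n), if ∀ i, |(#(E ∩ inc n i) : ℝ) - d| ≤ r then (1 : ℝ) else 0) =
      ∑ D ∈ WW n m d r, (NN (fun i => (D i : ℤ)) : ℝ) := by
  classical
  rw [← sum_filter]
  rw [← sum_fiberwise_of_maps_to (g := fun E => deg E) (t := WW n m d r)]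
  · refine sum_congr rfl fun D hD => ?_
    rw [mem_WW] at hD
    rw [NN_nat hD.2.1, sum_const, nsmul_eq_mul, mul_one]
    congr 2; ext E
    simp only [mem_filter, mem_powersetCard]
    constructor
    · rintro ⟨⟨h1, _⟩, rfl⟩; exact ⟨h1, fun i => rfl⟩
    · rintro ⟨h1, h2⟩
      exact ⟨⟨h1, fun i => by rw [← deg_inc h1.1, h2]; exact hD.2.2 i⟩, funext h2⟩
  · intro E hE
    rw [mem_filter, mem_powersetCard] at hE
    obtain ⟨⟨h1, h2⟩, h3⟩ := hE
    refine mem_WW.2 ⟨fun i => ?_, ?_, fun i => ?_⟩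
    · rw [deg_inc h1]
      have := card_le_card (inter_subset_right : E ∩ inc n i ⊆ _)
      rw [card_inc h] at this; omega
    · rw [sum_deg (mem_Graphs.2 fun e he => by simpa [Om] using h1 he), h2]
    · rw [deg_inc h1]; exact h3 i

lemma card_fib {n ν : ℕ} (D : Fin n → ℕ) :
    #(univ.filter (fun S : Finset (Fin n × Fin ν) => dB S = D)) = ∏ i, ν.choose (D i) := by
  classical
  have : ∏ i, ν.choose (D i) = #(Fintype.piFinset fun i => powersetCard (D i) (univ : Finset (Fin ν))) := by
    simp [Fintype.card_piFinset]
  rw [this]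
  have cB : ∀ (S : Finset (Fin n × Fin ν)) i, dB S i = #(univ.filter fun j => (i, j) ∈ S) := fun S i => by
    rw [dB]
    have : S ∩ row n ν i = (univ.filter fun j => (i, j) ∈ S).map ⟨fun j : Fin ν => (i, j), fun a b h => by simpa using h⟩ := by
      ext ⟨a, b⟩; simp only [row, mem_inter, mem_filter, mem_univ, true_and, mem_map]
      constructor
      · rintro ⟨h, rfl⟩; exact ⟨b, h, rfl⟩
      · rintro ⟨j, h, e⟩; cases e; exact ⟨h, rfl⟩
    rw [this, card_map]
  refine card_nbij' (fun S i => univ.filter fun j => (i, j) ∈ S) (fun f => univ.filter fun p => p.2 ∈ f p.1) ?_ ?_ ?_ ?_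
  · intro S hS
    simp only [coe_filter, mem_univ, true_and, Set.mem_ofPred_eq] at hS
    simp [mem_powersetCard, ← hS, cB]
  · intro f hf
    have hf : ∀ i, #(f i) = D i := by simpa [mem_powersetCard] using hf
    simp only [coe_filter, mem_univ, true_and, Set.mem_ofPred_eq]
    funext i; rw [cB, ← hf i]; congr 1; ext j; simp
  · intro S _; ext ⟨a, b⟩; simp
  · intro f _; funext i; ext j; simp

lemma Bsum {n ν m : ℕ} {d r : ℝ} (h : ν +1 = n) (g : (Fin n → ℕ) → ℝ) :
    (∑ S ∈ powersetCard (2 * m) (univ : Finset (Fin n × Fin ν)),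
      if ∀ i, |(dB S i : ℝ) - d| ≤ r then g (dB S) else 0) =
      ∑ D ∈ WW n m d r, (∏ i, (ν.choose (D i) : ℝ)) * g D := by
  classical
  rw [← sum_filter]
  rw [← sum_fiberwise_of_maps_to (g := fun E => dB E) (t := WW n m d r)]
  · refine sum_congr rfl fun D hD => ?_
    rw [mem_WW] at hD
    have e1 : (∏ i, (ν.choose (D i) : ℝ)) = (#(univ.filter (fun S : Finset (Fin n × Fin ν) => dB S = D)) : ℝ) := by
      rw [card_fib]; push_cast; rfl
    rw [e1, ← nsmul_eq_mul, ← sum_const]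
    refine sum_congr ?_ ?_
    · ext S
      simp only [mem_filter, mem_powersetCard, mem_univ, true_and, subset_univ]
      constructor
      · rintro ⟨_, rfl⟩; rfl
      · rintro rfl; exact ⟨⟨by rw [← sum_dB]; exact hD.2.1, hD.2.2⟩, rfl⟩
    · intro S hS; rw [(mem_filter.1 hS).2]
  · intro E hE
    rw [mem_filter, mem_powersetCard] at hE
    obtain ⟨⟨h1, h2⟩, h3⟩ := hE
    refine mem_WW.2 ⟨fun i => ?_, ?_, h3⟩
    · have := card_le_card (inter_subset_right : E ∩ row n ν i ⊆ _)
      rw [card_row] at this; rw [dB]; omega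
    · rw [sum_dB, h2]

lemma Ex_abs {β : Type*} [DecidableEq β] {Ω : Finset β} {M : ℕ} (hM : M ≤ #Ω) {f g : Finset β → ℝ} {c : ℝ}
    (h : ∀ S ∈ powersetCard M Ω, |f S - c| ≤ g S) : |Ex Ω M f - c| ≤ Ex Ω M g := by
  have e := Ex_const (Ω := Ω) hM c
  have h1 : Ex Ω M f ≤ Ex Ω M (fun S => c + g S) := Ex_mono fun S hS => by linarith [(abs_le.1 (h S hS)).2]
  have h2 : Ex Ω M (fun _ => c) ≤ Ex Ω M (fun S => f S + g S) := Ex_mono fun S hS => by linarith [(abs_le.1 (h S hS)).1]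
  rw [Ex_add, e] at h1; rw [Ex_add, e] at h2
  rw [abs_le]; constructor <;> linarith

lemma exp_quad {X : ℝ} (hX :0 ≤ X) : |Real.exp ((1 - X ^2) /4) -1| ≤ |X -1| ∧ Real.exp ((1 - X ^2) /4) ≤2 := by
  have g1 : (1 - X ^2) /4 ≤1 /4 := by linarith [sq_nonneg X]
  have e2 : Real.exp ((1 - X ^2) /4) ≤2 := by
    have := Real.abs_exp_sub_one_le (x := 1 /4) (by rw [abs_of_pos] <;> norm_num)
    rw [abs_of_pos (by norm_num : (0:ℝ) <1 /4)] at this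
    linarith [(abs_le.1 this).2, Real.exp_le_exp.2 g1]
  refine ⟨?_, e2⟩
  rcases le_total X 1 with h | h
  · have g0 :0 ≤ (1 - X ^2) /4 := by nlinarith
    have := Real.abs_exp_sub_one_le (x := (1 - X ^2) /4) (by rw [abs_of_nonneg g0]; linarith)
    rw [abs_of_nonneg g0] at this
    rw [abs_sub_comm X, abs_of_nonneg (by linarith :0 ≤1 - X)]
    nlinarith
  · have g0 : (1 - X ^2) /4 ≤0 := by nlinarith
    rw [abs_of_nonpos (by linarith [Real.exp_le_one_iff.2 g0]), abs_of_nonneg (by linarith :0 ≤ X -1)]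
    rcases le_total X 3 with k | k
    · nlinarith [Real.add_one_le_exp ((1 - X ^2) /4)]
    · linarith [Real.exp_pos ((1 - X ^2) /4)]

namespace Bas
variable {n ν m : ℕ} {d : ℝ}

lemma X2_nonneg (h : Bas n ν m d) (D : Fin n → ℤ) :0 ≤ X2 n d D := by
  have hν := h.νr; have hn := h.nr; have d1 := h.d1; have hp := h.hp
  have ν0 :0 < (ν : ℝ) := by linarith
  have p1 : d / ν ≤1 /2 := by rw [div_le_iff₀ ν0]; linarith
  rw [X2, ← hν]
  refine div_nonneg (sum_nonneg fun _ _ => sq_nonneg _) (mul_nonneg (by positivity) (by linarith))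

lemma hMG (h : Bas n ν m d) : m ≤ #(Om n) := by have := h.hM; have := card_Om h.hν; omega
lemma hΩG (h : Bas n ν m d) :0 < #(Om n) := by
  have := h.hΩ; rw [card_grid] at this; have := card_Om h.hν; omega
lemma ddG (h : Bas n ν m d) (i : Fin n) : d = #(inc n i) * ((m : ℕ) / #(Om n) : ℝ) := by
  rw [card_inc h.hν]
  have e : (n : ℝ) * ν =2 * #(Om n) := mod_cast card_Om h.hν
  have := h.hΩG
  have o : (#(Om n) : ℝ) ≠ 0 := mod_cast this.ne'
  have hn := h.nr; have hd := h.hd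
  have n0 : (n : ℝ) ≠ 0 := by linarith
  field_simp
  refine mul_left_cancel₀ n0 ?_
  linear_combination (#(Om n) : ℝ) * hd - (m : ℝ) * e

/-- exact change of measure identity -/
lemma cpos (h : Bas n ν m d) :0 < ((#(univ : Finset (Fin n × Fin ν))).choose (2 * m) : ℝ) ∧ 0 < ((#(Om n)).choose m : ℝ) :=
  ⟨mod_cast Nat.choose_pos h.hM', mod_cast Nat.choose_pos h.hMG⟩

lemma ident (h : Bas n ν m d) {r : ℝ} (hpos : ∀ D : Fin n → ℤ, Win m d r D → 0 < NN D) :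
    ((#(Om n)).choose m : ℝ) * Ex (Om n) m (fun E => if ∀ i, |(#(E ∩ inc n i) : ℝ) - d| ≤ r then (1 : ℝ) else 0) =
    ((#(univ : Finset (Fin n × Fin ν))).choose (2 * m) : ℝ) *
      Ex (univ : Finset (Fin n × Fin ν)) (2 * m) (fun S => if ∀ i, |(dB S i : ℝ) - d| ≤ r then
        (fun D : Fin n → ℕ => Real.exp (Tl n d (fun i => (D i : ℤ)) - X2 n d (fun i => (D i : ℤ)) ^2 /4)) (dB S) else 0) := by
  obtain ⟨c1, c2⟩ := h.cpos
  rw [Ex, Ex, mul_div_cancel₀ _ c1.ne', mul_div_cancel₀ _ c2.ne', Gsum h.hν, Bsum h.hν (fun D : Fin n → ℕ => Real.exp (Tl n d (fun i => (D i : ℤ)) - X2 n d (fun i => (D i : ℤ)) ^2 /4))]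
  refine sum_congr rfl fun D hD => ?_
  obtain ⟨w1, w2, w3⟩ := mem_WW.1 hD
  have np := hpos (fun i => (D i : ℤ)) ⟨fun i => by positivity, (by show ∑ i, (D i : ℤ) =2 * m; exact_mod_cast w2), fun i => mod_cast w3 i⟩
  have nr : (0 : ℝ) < NN (fun i => (D i : ℤ)) := mod_cast np
  have cp : ∀ i, (0 : ℝ) < ν.choose (D i) := fun i => by
    have := w1 i; have := h.hν
    exact_mod_cast Nat.choose_pos (by omega)
  have eν : n -1 = ν := by have := h.hν; omega
  have : (∏ i, (ν.choose (D i) : ℝ)) = Real.exp (∑ i, Real.log (ν.choose (D i))) := by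
    rw [Real.exp_sum]; exact prod_congr rfl fun i _ => (Real.exp_log (cp i)).symm
  rw [this, ← Real.exp_add, Tl, lH, eν]
  simp only [Int.toNat_natCast]
  rw [show ∀ a b c : ℝ, a + (b - (a - c) - c) = b by intros; ring, Real.exp_log nr]

lemma norm0 (h : Bas n ν m d) {r B x τ e : ℝ} (hx0 :0 ≤ x) (hx1 : x ≤1) (hB :0 ≤ B)
    (hpos : ∀ D : Fin n → ℤ, Win m d r D → 0 < NN D)
    (htele : ∀ D D' : Fin n → ℤ, Win m d r D → Win m d r D' →
      |Tl n d D - Tl n d D'| ≤ (∑ i, |(D i : ℝ) - D' i|) * B)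
    {D0 : Fin n → ℤ} (w0 : Win m d r D0) (w1 : ∀ i, |(D0 i : ℝ) - d| ≤1) (hBr : n * (r +1) * B ≤1)
    (hτ : n * (2 * Real.exp (x ^2 * d - x * r)) ≤ τ)
    (he : τ +4 * B * (n * (151 * Real.sqrt d +1)) +20000 / Real.sqrt n ≤ e) (he2 : e ≤1 /2) :
    |Real.exp (Tl n d D0 -1 /4) * ((#(univ : Finset (Fin n × Fin ν))).choose (2 * m) : ℝ) / ((#(Om n)).choose m : ℝ) -1|
      ≤ 2 * (τ + e) := by
  obtain ⟨c1, c2⟩ := h.cpos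
  have hid := h.ident hpos
  have ax : |x| ≤1 := by rwa [abs_of_nonneg hx0]
  set cB := ((#(univ : Finset (Fin n × Fin ν))).choose (2 * m) : ℝ)
  set cG := ((#(Om n)).choose m : ℝ)
  -- graph side
  have hG : |Ex (Om n) m (fun E => if ∀ i, |(#(E ∩ inc n i) : ℝ) - d| ≤ r then (1 : ℝ) else 0) -1| ≤ τ := by
    have : ∀ E ∈ powersetCard m (Om n), |(if ∀ i, |(#(E ∩ inc n i) : ℝ) - d| ≤ r then (1 : ℝ) else 0) -1| ≤
        ∑ i, if |(#(E ∩ inc n i) : ℝ) - d| ≤ r then (0 : ℝ) else 1 := by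
      intro E _
      split_ifs with hh
      · simp only [sub_self, abs_zero]
        exact sum_nonneg fun i _ => by split_ifs <;> norm_num
      · push Not at hh
        obtain ⟨i, hi⟩ := hh
        rw [zero_sub, abs_neg, abs_one]
        refine le_trans ?_ (single_le_sum (f := fun i => if |(#(E ∩ inc n i) : ℝ) - d| ≤ r then (0 : ℝ) else 1)
          (fun j _ => by split_ifs <;> norm_num) (mem_univ i))
        simp [not_le.2 hi]
    refine (Ex_abs h.hMG this).trans ?_
    rw [Ex_sum]
    refine (sum_le_sum fun i _ => Ex_tail (filter_subset _ _) h.hMG h.hΩG (h.ddG i) ax hx0).trans ?_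
    simpa using hτ
  -- binomial side
  have hQ : |Ex (univ : Finset (Fin n × Fin ν)) (2 * m) (fun S => if ∀ i, |(dB S i : ℝ) - d| ≤ r then
        Real.exp ((Tl n d (fun i => (dB S i : ℤ)) - Tl n d D0) + (1 - X2 n d (fun i => (dB S i : ℤ)) ^2) /4) else 0) -1| ≤ e := by
    have : ∀ S ∈ powersetCard (2 * m) (univ : Finset (Fin n × Fin ν)), |(if ∀ i, |(dB S i : ℝ) - d| ≤ r then
        Real.exp ((Tl n d (fun i => (dB S i : ℤ)) - Tl n d D0) + (1 - X2 n d (fun i => (dB S i : ℤ)) ^2) /4) else 0) -1| ≤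
        (∑ i, if |(dB S i : ℝ) - d| ≤ r then (0 : ℝ) else 1) +
          (4 * B * (∑ i, (|(dB S i : ℝ) - d| +1)) + |X2 n d (fun i => (dB S i : ℤ)) -1|) := by
      intro S hS
      have t0 : ∀ i, 0 ≤ if |(dB S i : ℝ) - d| ≤ r then (0 : ℝ) else 1 := fun i => by split_ifs <;> norm_num
      have t1 :0 ≤ ∑ i, if |(dB S i : ℝ) - d| ≤ r then (0 : ℝ) else 1 := sum_nonneg fun i _ => t0 i
      have t2 :0 ≤ ∑ i, (|(dB S i : ℝ) - d| +1) := sum_nonneg fun i _ => by positivity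
      obtain ⟨q1, q2⟩ := exp_quad (h.X2_nonneg (fun i => (dB S i : ℤ)))
      set X := X2 n d (fun i => (dB S i : ℤ))
      by_cases hh : ∀ i, |(dB S i : ℝ) - d| ≤ r
      · rw [if_pos hh]
        have wS : Win m d r (fun i => (dB S i : ℤ)) := ⟨fun i => by positivity, by
          have := sum_dB S; rw [(mem_powersetCard.1 hS).2] at this
          show ∑ i, (dB S i : ℤ) =2 * m
          exact_mod_cast this, fun i => mod_cast hh i⟩
        have T := htele _ _ wS w0
        set ψ := Tl n d (fun i => (dB S i : ℤ)) - Tl n d D0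
        have b1 : ∑ i, |(((dB S i : ℤ) : ℤ) : ℝ) - D0 i| ≤ ∑ i, (|(dB S i : ℝ) - d| +1) :=
          sum_le_sum fun i _ => by
            have := abs_sub_le (((dB S i : ℤ) : ℤ) : ℝ) d (D0 i)
            rw [abs_sub_comm d] at this; push_cast at this ⊢; linarith [w1 i]
        have b2 : ∑ i, (|(dB S i : ℝ) - d| +1) ≤ n * (r +1) := by
          refine (sum_le_sum fun i _ => add_le_add_left (hh i) 1).trans ?_
          simp [mul_add]
        have b3 := T.trans (mR b1 hB)
        have b4 : |ψ| ≤1 := b3.trans ((mR b2 hB).trans hBr)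
        have b5 := Real.abs_exp_sub_one_le b4
        set G := Real.exp ((1 - X ^2) /4)
        have eq : Real.exp (ψ + (1 - X ^2) /4) -1 = G * (Real.exp ψ -1) + (G -1) := by
          rw [Real.exp_add]; ring
        rw [eq]
        have b6 : |G * (Real.exp ψ -1)| ≤2 * (2 * |ψ|) := by
          rw [abs_mul, abs_of_pos (Real.exp_pos _)]
          exact mul_le_mul q2 b5 (abs_nonneg _) (by norm_num)
        linarith [abs_add_le (G * (Real.exp ψ -1)) (G -1)]
      · rw [if_neg hh, zero_sub, abs_neg, abs_one]
        push Not at hh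
        obtain ⟨i, hi⟩ := hh
        have := single_le_sum (f := fun i => if |(dB S i : ℝ) - d| ≤ r then (0 : ℝ) else 1) (fun j _ => t0 j) (mem_univ i)
        simp only [not_le.2 hi, if_false] at this
        linarith [mul_nonneg (mul_nonneg (by norm_num : (0:ℝ) ≤4) hB) t2, abs_nonneg (X -1)]
    refine (Ex_abs h.hM' this).trans ?_
    rw [Ex_add, Ex_add, Ex_smul, Ex_sum, Ex_sum]
    have a1 := sum_le_sum fun i (_ : i ∈ univ) => Ex_tail (r := r) (subset_univ _) h.hM' h.hΩ (h.dd i) ax hx0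
    have a2 : ∑ i : Fin n, Ex (univ : Finset (Fin n × Fin ν)) (2 * m) (fun S => |(dB S i : ℝ) - d| +1) ≤ n * (151 * Real.sqrt d +1) := by
      refine (sum_le_sum (g := fun _ => 151 * Real.sqrt d +1) fun i _ => ?_).trans (by simp [mul_add])
      rw [Ex_add, Ex_const h.hM']; linarith [h.dev1 i]
    simp only [sum_const, card_univ, Fintype.card_fin, nsmul_eq_mul] at a1
    have a3 := mL a2 (by positivity :0 ≤4 * B)
    have a4 := a1.trans hτ
    have a5 := h.Xdev
    exact (add_le_add a4 (add_le_add a3 a5)).trans (by linarith)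
  have key : Ex (univ : Finset (Fin n × Fin ν)) (2 * m) (fun S => if ∀ i, |(dB S i : ℝ) - d| ≤ r then
        (fun D : Fin n → ℕ => Real.exp (Tl n d (fun i => (D i : ℤ)) - X2 n d (fun i => (D i : ℤ)) ^2 /4)) (dB S) else 0)
      = Real.exp (Tl n d D0 -1 /4) * Ex (univ : Finset (Fin n × Fin ν)) (2 * m) (fun S => if ∀ i, |(dB S i : ℝ) - d| ≤ r then
        Real.exp ((Tl n d (fun i => (dB S i : ℤ)) - Tl n d D0) + (1 - X2 n d (fun i => (dB S i : ℤ)) ^2) /4) else 0) := by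
    rw [← Ex_smul]; congr 1; funext S
    split_ifs
    · rw [← Real.exp_add]; congr 1; ring
    · ring
  rw [key] at hid
  set Q := Ex (univ : Finset (Fin n × Fin ν)) (2 * m) (fun S => if ∀ i, |(dB S i : ℝ) - d| ≤ r then
        Real.exp ((Tl n d (fun i => (dB S i : ℤ)) - Tl n d D0) + (1 - X2 n d (fun i => (dB S i : ℤ)) ^2) /4) else 0)
  set EG := Ex (Om n) m (fun E => if ∀ i, |(#(E ∩ inc n i) : ℝ) - d| ≤ r then (1 : ℝ) else 0)
  have Q1 :1 /2 ≤ Q := by linarith [(abs_le.1 hQ).1]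
  have eT : Real.exp (Tl n d D0 -1 /4) * cB / cG -1 = (EG - Q) / Q := by
    have : Q ≠ 0 := by linarith
    have e1 : Real.exp (Tl n d D0 -1 /4) * cB / cG * Q = EG := by
      rw [div_mul_eq_mul_div, div_eq_iff c2.ne']; linear_combination -hid
    rw [eq_div_iff this, sub_mul, e1, one_mul]
  rw [eT, abs_div, abs_of_pos (by linarith :0 < Q), div_le_iff₀ (by linarith)]
  have : |EG - Q| ≤ τ + e := by
    have := abs_sub_le EG 1 Q; rw [abs_sub_comm 1] at this; linarith
  have t0 :0 ≤ τ + e := (abs_nonneg _).trans this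
  nlinarith
end Bas

structure Big (C0 : ℝ) (c0 n m : ℕ) (d ℓ : ℝ) : Prop where
  hC :1 ≤ C0
  tele : ∀ (n m : ℕ) (d r ε L : ℝ) (k : ℕ), Prm n m d r ε L k →
    C0 * (d / ((n : ℝ) -1)) * L ^ c0 ≤1 → ∀ D D' : Fin n → ℤ, Win m d r D → Win m d r D' →
    |Tl n d D - Tl n d D'| ≤ (∑ i, |(D i : ℝ) - D' i|) *
      (C0 * ((d / ((n : ℝ) -1)) ^2 * ε ^4 * L ^ c0))
  hn :4 ≤ n
  hℓ : Real.log n = ℓ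
  ℓ1 :1 ≤ ℓ
  hlg :1000000 * (4 * C0 *45 ^ (c0 +4)) * ℓ ^ (c0 +6) ≤ Real.sqrt n
  hd : (n : ℝ) * d =2 * m
  d1 :1 ≤ d
  hμ : d / ((n : ℝ) -1) ≤1 / (1000 * C0 *45 ^ (c0 +4))

namespace Big
variable {C0 : ℝ} {c0 n m : ℕ} {d ℓ : ℝ}

lemma nr (h : Big C0 c0 n m d ℓ) : (4 : ℝ) ≤ n := mod_cast h.hn

lemma K0 (h : Big C0 c0 n m d ℓ) :1 ≤ C0 * (45 : ℝ) ^ c0 := by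
  have := one_le_pow₀ (show (1 : ℝ) ≤45 by norm_num) (n := c0)
  have := h.hC
  nlinarith

lemma small (h : Big C0 c0 n m d ℓ) {L : ℝ} (hL : ℓ ≤ d ∧ L =45 ∨ d < ℓ ∧ L =45 * ℓ) :
    1000 * C0 * (d / ((n : ℝ) -1)) * L ^ (c0 +4) ≤1 := by
  have n4 := h.nr; have l1 := h.ℓ1; have hC := h.hC; have d1 := h.d1
  rcases hL with ⟨_, rfl⟩ | ⟨hd, rfl⟩
  · have := h.hμ
    rw [le_div_iff₀ (by positivity)] at this
    linarith
  · have h1 : d / ((n : ℝ) -1) ≤2 * ℓ / n := by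
      rw [div_le_div_iff₀ (by linarith) (by linarith)]
      nlinarith
    have h2 :1000 * C0 * (d / ((n : ℝ) -1)) * (45 * ℓ) ^ (c0 +4) ≤1000 * C0 * (2 * ℓ / n) * (45 * ℓ) ^ (c0 +4) := by
      gcongr
    refine h2.trans ?_
    have e :1000 * C0 * (2 * ℓ / n) * (45 * ℓ) ^ (c0 +4) =500 * (4 * C0 *45 ^ (c0 +4)) * ℓ ^ (c0 +5) / n := by
      rw [mul_pow]; field_simp; ring
    rw [e, div_le_one (by linarith)]
    have h3 : ℓ ^ (c0 +5) ≤ ℓ ^ (c0 +6) := pow_le_pow_right₀ l1 (by omega)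
    have h4 : Real.sqrt n ≤ n := Real.sqrt_le_iff.2 ⟨by linarith, by nlinarith⟩
    have h5 :500 * (4 * C0 *45 ^ (c0 +4)) * ℓ ^ (c0 +5) ≤1000000 * (4 * C0 *45 ^ (c0 +4)) * ℓ ^ (c0 +6) := by
      gcongr; norm_num
    linarith [h.hlg]

lemma cost (h : Big C0 c0 n m d ℓ) {L r y : ℝ} (hL : ℓ ≤ d ∧ L =45 ∨ d < ℓ ∧ L =45 * ℓ)
    (hr :2 * (r +14 * ℓ) ≤ y) (hy :96 * ℓ * d ^2 ≤ y ^4) (y0 :0 < y) (hyL : y ≤ L * d) :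
    (∀ D : Fin n → ℤ, Win m d r D → 0 < NN D) ∧ ∃ B : ℝ, 0 ≤ B ∧
    (∀ D D' : Fin n → ℤ, Win m d r D → Win m d r D' → |Tl n d D - Tl n d D'| ≤ (∑ i, |(D i : ℝ) - D' i|) * B) ∧
    n * B ≤4 * C0 * L ^ c0 * y ^4 / (n * d ^2) := by
  have n4 := h.nr; have l1 := h.ℓ1; have hC := h.hC; have d1 := h.d1
  have d0 :0 < d := by linarith
  have L1 :1 ≤ L := by rcases hL with ⟨_, rfl⟩ | ⟨_, rfl⟩ <;> linarith
  have s := h.small hL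
  have μ0 :0 ≤ d / ((n : ℝ) -1) := div_nonneg (by linarith) (by linarith)
  have kc := Nat.ceil_lt_add_one (show 0 ≤ ℓ by linarith)
  have P : Prm n m d r (y / d) L ⌈ℓ⌉₊ := by
    refine ⟨h.hd, by linarith [h.hn], d1, by positivity, ?_, ?_, ?_, L1, by rwa [div_le_iff₀ d0], ?_, by rw [h.hℓ]; exact Nat.le_ceil _⟩
    · rw [div_mul_cancel₀ _ d0.ne']; linarith
    · rw [div_pow, div_le_div_iff₀ d0 (by positivity)]
      have : d ≤ y ^2 := by
        refine (pow_le_pow_iff_left₀ d0.le (by positivity) two_ne_zero).1 ?_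
        nlinarith [sq_nonneg d]
      nlinarith
    · rw [div_pow, div_pow, mul_div_assoc', div_le_div_iff₀ (by positivity) (by positivity)]
      have :8 * ((4 * (⌈ℓ⌉₊ : ℝ) +3) +1) ≤96 * ℓ := by linarith
      calc 8 * ((4 * (⌈ℓ⌉₊ : ℝ) +3) +1) *1 ^2 * d ^4 ≤ (96 * ℓ) *1 ^2 * d ^4 := by gcongr
        _ = (96 * ℓ * d ^2) * d ^2 := by ring
        _ ≤ y ^4 * d ^2 := by gcongr
    · have a :1 * (d / ((n : ℝ) -1)) * L ^4 ≤ C0 * (d / ((n : ℝ) -1)) * L ^ (c0 +4) := by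
        gcongr <;> first | exact L1 | omega
      linarith
  have s2 : C0 * (d / ((n : ℝ) -1)) * L ^ c0 ≤1 := by
    have a : C0 * (d / ((n : ℝ) -1)) * L ^ c0 ≤ C0 * (d / ((n : ℝ) -1)) * L ^ (c0 +4) := by
      gcongr <;> first | exact L1 | omega
    have :0 ≤ C0 * (d / ((n : ℝ) -1)) * L ^ (c0 +4) := by positivity
    linarith
  refine ⟨fun D hD => P.pos hD, _, ?_, h.tele n m d r _ L _ P s2, ?_⟩
  · positivity
  · have n1 :0 < (n : ℝ) -1 := by linarith
    have e : n * (C0 * ((d / ((n : ℝ) -1)) ^2 * (y / d) ^4 * L ^ c0)) = (C0 * L ^ c0 * y ^4 / d ^2) * (n / ((n : ℝ) -1) ^2) := by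
      field_simp
    have e2 :4 * C0 * L ^ c0 * y ^4 / (n * d ^2) = (C0 * L ^ c0 * y ^4 / d ^2) * (4 / n) := by
      field_simp
    rw [e, e2]
    refine mL ?_ (by positivity)
    rw [div_le_div_iff₀ (by positivity) (by linarith)]
    nlinarith
end Big

namespace Big
variable {C0 : ℝ} {c0 n m : ℕ} {d ℓ : ℝ}

lemma bas (h : Big C0 c0 n m d ℓ) : Bas n (n -1) m d := by
  have n4 := h.nr; have hn := h.hn
  refine ⟨by omega, h.hn, h.hd, h.d1, ?_⟩
  rw [Nat.cast_sub (by omega), Nat.cast_one]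
  have h1 : d / ((n : ℝ) -1) ≤1 /2 := by
    refine h.hμ.trans ?_
    have := h.K0
    have e :1000 * C0 * (45 : ℝ) ^ (c0 +4) =1000 *45 ^4 * (C0 *45 ^ c0) := by ring
    rw [e]
    gcongr
    nlinarith
  rw [div_le_iff₀ (by linarith)] at h1
  linarith

lemma dn (h : Big C0 c0 n m d ℓ) : d ≤ n := by
  have := h.bas.hp; rw [h.bas.νr] at this; linarith [h.nr]

lemma nearreg (h : Big C0 c0 n m d ℓ) :
    ∃ D0 : Fin n → ℤ, (∀ i, 0 ≤ D0 i) ∧ ∑ i, D0 i =2 * m ∧ ∀ i, |(D0 i : ℝ) - d| ≤1 := by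
  have n4 := h.nr
  have n0 :0 < n := by linarith [h.hn]
  have hm := Nat.div_add_mod (2 * m) n
  have hlt := Nat.mod_lt (2 * m) n0
  set q := 2 * m / n
  set t := 2 * m % n
  refine ⟨fun i => (q : ℤ) + if i.1 < t then 1 else 0, fun i => by positivity, ?_, fun i => ?_⟩
  · rw [sum_add_distrib, sum_const, card_univ, Fintype.card_fin, sum_boole]
    have : #{i : Fin n | i.1 < t} = t := by
      rw [Fin.card_filter_val_lt]; omega
    rw [this, nsmul_eq_mul]; exact_mod_cast hm
  · have e : (n : ℝ) * d = n * q + t := by rw [h.hd]; exact_mod_cast hm.symm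
    have t1 : (t : ℝ) < n := mod_cast hlt
    have t0 : (0 : ℝ) ≤ t := by positivity
    have a1 : (q : ℝ) ≤ d := by nlinarith
    have a2 : d ≤ q +1 := by nlinarith
    push_cast
    split_ifs <;> rw [abs_le] <;> constructor <;> linarith

lemma sq_facts (h : Big C0 c0 n m d ℓ) {j : ℕ} (hj : j ≤ c0 +6) :
    1000000 * (4 * C0 *45 ^ (c0 +4)) * ℓ ^ j ≤ Real.sqrt n := by
  have hC := h.hC
  refine le_trans ?_ h.hlg
  gcongr
  exact h.ℓ1

set_option maxHeartbeats 1000000 in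
lemma window (h : Big C0 c0 n m d ℓ) {D0 : Fin n → ℤ} (h0 : ∀ i, 0 ≤ D0 i) (hs : ∑ i, D0 i =2 * m)
    (h1 : ∀ i, |(D0 i : ℝ) - d| ≤1) :
    |Real.exp (Tl n d D0 -1 /4) * ((#(univ : Finset (Fin n × Fin (n -1)))).choose (2 * m) : ℝ) /
      ((#(Om n)).choose m : ℝ) -1| ≤1220 * (4 * C0 *45 ^ (c0 +4)) * (ℓ ^2 / Real.sqrt n) := by
  have n4 := h.nr; have l1 := h.ℓ1; have hC := h.hC; have d1 := h.d1; have hK := h.K0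
  have S := h.sq_facts (j := 3) (by omega)
  have S' := h.sq_facts (j := c0 +5) (by omega)
  have dn := h.dn
  have K1 :16000000 ≤4 * C0 * (45 : ℝ) ^ (c0 +4) := by
    have :4 * C0 * (45 : ℝ) ^ (c0 +4) =4 *45 ^4 * (C0 *45 ^ c0) := by ring
    rw [this]; linarith
  have K1e :4 * C0 * (45 : ℝ) ^ (c0 +4) =4 * C0 *45 ^ c0 *45 ^4 := by ring
  set K := 4 * C0 * (45 : ℝ) ^ (c0 +4) with hKdef
  obtain ⟨a, ha⟩ : ∃ a, a = Real.sqrt d := ⟨_, rfl⟩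
  obtain ⟨b, hb⟩ : ∃ b, b = Real.sqrt ℓ := ⟨_, rfl⟩
  obtain ⟨z, hz⟩ : ∃ z, z = Real.sqrt n := ⟨_, rfl⟩
  have ea : d = a ^2 := by rw [ha, Real.sq_sqrt (by linarith)]
  have eb : ℓ = b ^2 := by rw [hb, Real.sq_sqrt (by linarith)]
  have ez : (n : ℝ) = z ^2 := by rw [hz, Real.sq_sqrt (by linarith)]
  have a1 :1 ≤ a := by rw [ha]; exact Real.one_le_sqrt.2 d1
  have b1 :1 ≤ b := by rw [hb]; exact Real.one_le_sqrt.2 l1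
  have a0 :0 < a := by linarith
  have b0 :0 < b := by linarith
  have az : a ≤ z := by rw [ha, hz]; exact Real.sqrt_le_sqrt dn
  rw [← hz] at S S' ⊢
  have z1 :1 ≤ z := a1.trans az
  set r := 4 * (a * b) +4 * b ^2 with hr
  set y := 8 * (a * b) +36 * b ^2 with hy
  have hyr :2 * (r +14 * ℓ) ≤ y := by rw [hr, hy, eb]; linarith
  have y0 :0 < y := by positivity
  have hy4 :96 * ℓ * d ^2 ≤ y ^4 := by
    have :8 * (a * b) ≤ y := by rw [hy]; linarith [sq_nonneg b]
    calc 96 * ℓ * d ^2 =96 * (a ^4 * b ^2) := by rw [ea, eb]; ring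
      _ ≤4096 * (a ^4 * b ^4) := by gcongr <;> norm_num
      _ = (8 * (a * b)) ^4 := by ring
      _ ≤ _ := by gcongr
  obtain ⟨hpos, B, B0, htele, hnB⟩ : (∀ D : Fin n → ℤ, Win m d r D → 0 < NN D) ∧ ∃ B : ℝ, 0 ≤ B ∧
    (∀ D D' : Fin n → ℤ, Win m d r D → Win m d r D' → |Tl n d D - Tl n d D'| ≤ (∑ i, |(D i : ℝ) - D' i|) * B) ∧
    n * B * a ≤ K * (ℓ ^2 / z) := by
    rcases le_or_gt ℓ d with hd | hd
    · have ab : b ≤ a := by rw [ha, hb]; exact Real.sqrt_le_sqrt hd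
      have hyL : y ≤44 * (a * b) := by
        rw [hy]; linarith [mR ab b0.le]
      obtain ⟨p, B, B0, t, c⟩ := h.cost (L := 45) (r := r) (y := y) (.inl ⟨hd, rfl⟩) hyr hy4 y0 (by rw [ea]; linarith [mL ab a0.le, mul_pos a0 b0])
      refine ⟨p, B, B0, t, ?_⟩
      have c2 : n * B ≤ K * (ℓ ^2 / n) := c.trans (by
        calc 4 * C0 *45 ^ c0 * y ^4 / (n * d ^2) ≤4 * C0 *45 ^ c0 * (45 * (a * b)) ^4 / (n * d ^2) := by
              gcongr; linarith [mul_pos a0 b0]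
          _ = _ := by
              rw [K1e, ea, eb]; field_simp)
      calc n * B * a ≤ K * (ℓ ^2 / n) * z := by gcongr
        _ = _ := by rw [ez]; field_simp
    · have ab : a ≤ b := by rw [ha, hb]; exact Real.sqrt_le_sqrt hd.le
      have hyL : y ≤44 * b ^2 := by
        rw [hy]; linarith [mR ab b0.le]
      obtain ⟨p, B, B0, t, c⟩ := h.cost (L := 45 * ℓ) (r := r) (y := y) (.inr ⟨hd, rfl⟩) hyr hy4 y0 (by
        have := mL d1 (show 0 ≤45 * ℓ by linarith)
        linarith)
      refine ⟨p, B, B0, t, ?_⟩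
      have c2 : n * B ≤ K * ℓ ^ (c0 +4) / n := c.trans (by
        calc 4 * C0 * (45 * ℓ) ^ c0 * y ^4 / (n * d ^2) ≤4 * C0 * (45 * ℓ) ^ c0 * (45 * ℓ) ^4 / (n *1 ^2) := by
              gcongr; linarith
          _ = _ := by
              rw [K1e, mul_pow, mul_pow]; field_simp; ring)
      have bl : a ≤ ℓ := by rw [eb]; exact ab.trans (le_self_pow₀ b1 two_ne_zero)
      calc n * B * a ≤ K * ℓ ^ (c0 +4) / n * ℓ := by gcongr
        _ = K * ℓ ^ (c0 +5) / z / z := by rw [ez]; field_simp; ring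
        _ ≤ z / z / z := by
          gcongr
          have :0 ≤ K * ℓ ^ (c0 +5) := by positivity
          linarith
        _ =1 * (1 / z) := by field_simp
        _ ≤ K * (ℓ ^2 / z) := by
          gcongr
          · linarith
          · exact one_le_pow₀ l1
  set q := ℓ ^2 / z with hq
  have zq :1 / z ≤ q := by rw [hq]; gcongr; exact one_le_pow₀ l1
  have q0 :0 < q := by positivity
  have lq :1000000 * K * (ℓ * q) ≤1 := by
    rw [hq, show 1000000 * K * (ℓ * (ℓ ^2 / z)) =1000000 * K * ℓ ^3 / z by field_simp, div_le_one (by linarith)]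
    exact S
  have lq2 :1000000 * K * q ≤1 := by
    refine le_trans ?_ lq
    gcongr; exact le_mul_of_one_le_left q0.le l1
  obtain ⟨x, x0, x1, hx⟩ : ∃ x, 0 ≤ x ∧ x ≤1 ∧ x ^2 * d - x * r ≤ -(2 * ℓ) := by
    rcases le_or_gt ℓ d with hd | hd
    · have ab : b ≤ a := by rw [ha, hb]; exact Real.sqrt_le_sqrt hd
      refine ⟨b / a, by positivity, by rw [div_le_one (by linarith)]; exact ab, ?_⟩
      have e : (b / a) ^2 * d - b / a * r = b ^2 -4 * b ^2 -4 * (b ^3 / a) := by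
        rw [ea, hr]; field_simp; ring
      have :0 ≤ b ^3 / a := by positivity
      rw [e, eb]; linarith [sq_nonneg b]
    · refine ⟨1, by norm_num, le_rfl, ?_⟩
      rw [hr, eb]; rw [eb] at hd
      linarith [mul_pos a0 b0]
  have hτ : n * (2 * Real.exp (x ^2 * d - x * r)) ≤2 * q := by
    have e1 : Real.exp (x ^2 * d - x * r) ≤1 / (n : ℝ) ^2 := by
      refine (Real.exp_le_exp.2 hx).trans (le_of_eq ?_)
      rw [Real.exp_neg, two_mul, Real.exp_add, ← h.hℓ, Real.exp_log (by linarith), one_div, sq]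
    calc n * (2 * Real.exp (x ^2 * d - x * r)) ≤ n * (2 * (1 / (n : ℝ) ^2)) := by gcongr
      _ =2 * (1 / z / z) := by rw [ez]; field_simp
      _ ≤2 * (q /1) := by gcongr
      _ = _ := by ring
  have r1 :1 ≤ r := by rw [hr]; linarith [mul_pos a0 b0, one_le_pow₀ b1 (n := 2)]
  have w0 : Win m d r D0 := ⟨h0, hs, fun i => (h1 i).trans r1⟩
  have nB0 :0 ≤ n * B := by positivity
  have hBr : n * (r +1) * B ≤1 := by
    have : r +1 ≤9 * (ℓ * a) := by
      rw [hr, eb]; linarith [mul_nonneg (mul_nonneg a0.le b0.le) (show 0 ≤ b -1 by linarith), mul_nonneg (sq_nonneg b) (show 0 ≤ a -1 by linarith), one_le_pow₀ b1 (n := 2)]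
    calc n * (r +1) * B = (n * B) * (r +1) := by ring
      _ ≤ (n * B) * (9 * (ℓ * a)) := by gcongr
      _ =9 * ℓ * (n * B * a) := by ring
      _ ≤9 * ℓ * (K * q) := by gcongr
      _ =9 * (K * (ℓ * q)) := by ring
      _ ≤1 := by linarith
  have he :2 * q +4 * B * (n * (151 * Real.sqrt d +1)) +20000 / Real.sqrt n ≤609 * K * q -2 * q := by
    rw [← ha, ← hz]
    have t1 :4 * B * (n * (151 * a +1)) ≤608 * (K * q) := by
      calc 4 * B * (n * (151 * a +1)) ≤4 * B * (n * (151 * a + a)) := by gcongr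
        _ =608 * (n * B * a) := by ring
        _ ≤ _ := by gcongr
    have t2 :20000 / z ≤20000 * q := by
      calc 20000 / z =20000 * (1 / z) := by ring
        _ ≤ _ := by gcongr
    have t3 :16000000 * q ≤ K * q := by gcongr
    linarith
  have := h.bas.norm0 x0 x1 B0 hpos htele w0 h1 hBr hτ he (by linarith)
  refine this.trans ?_
  have :0 ≤ K * q := by positivity
  linarith
end Big

lemma pow4_three (x y z : ℝ) : (x + y + z) ^4 ≤27 * (x ^4 + y ^4 + z ^4) := by
  have h : ∀ a b c : ℝ, (a + b + c) ^2 ≤3 * (a ^2 + b ^2 + c ^2) := fun a b c => by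
    linarith [sq_nonneg (a - b), sq_nonneg (b - c), sq_nonneg (a - c)]
  calc (x + y + z) ^4 = ((x + y + z) ^2) ^2 := by ring
    _ ≤ (3 * (x ^2 + y ^2 + z ^2)) ^2 := by gcongr; exact h _ _ _
    _ =9 * (x ^2 + y ^2 + z ^2) ^2 := by ring
    _ ≤9 * (3 * ((x ^2) ^2 + (y ^2) ^2 + (z ^2) ^2)) := by gcongr; exact h _ _ _
    _ = _ := by ring

namespace Big
variable {C0 : ℝ} {c0 n m : ℕ} {d ℓ : ℝ}

set_option maxHeartbeats 1000000 in
lemma star (h : Big C0 c0 n m d ℓ) {u : ℝ} (u1 :1 ≤ u) (ud : u ≤ d) {D D0 : Fin n → ℤ}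
    (h0 : ∀ i, 0 ≤ D0 i) (hs : ∑ i, D0 i =2 * m)
    (h1 : ∀ i, |(D0 i : ℝ) - d| ≤1) (hD : Win m d u D) :
    0 < NN D ∧ |Tl n d D - Tl n d D0| ≤20 * (4 * C0 *45 ^ (c0 +4)) * (ℓ ^2 / Real.sqrt n + u ^5 / d ^3) := by
  have n4 := h.nr; have l1 := h.ℓ1; have hC := h.hC; have d1 := h.d1; have hK := h.K0
  have S := h.sq_facts (j := 2) (by omega)
  have S' := h.sq_facts (j := c0 +5) (by omega)
  have dn := h.dn
  have K1e :4 * C0 * (45 : ℝ) ^ (c0 +4) =4 * C0 *45 ^ c0 *45 ^4 := by ring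
  have K1 :1 ≤4 * C0 * (45 : ℝ) ^ (c0 +4) := by rw [K1e]; linarith
  set K := 4 * C0 * (45 : ℝ) ^ (c0 +4) with hKdef
  obtain ⟨a, ha⟩ : ∃ a, a = Real.sqrt d := ⟨_, rfl⟩
  obtain ⟨b, hb⟩ : ∃ b, b = Real.sqrt ℓ := ⟨_, rfl⟩
  obtain ⟨w, hw⟩ : ∃ w, w = Real.sqrt b := ⟨_, rfl⟩
  obtain ⟨z, hz⟩ : ∃ z, z = Real.sqrt n := ⟨_, rfl⟩
  have b1 :1 ≤ b := by rw [hb]; exact Real.one_le_sqrt.2 l1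
  have ea : d = a ^2 := by rw [ha, Real.sq_sqrt (by linarith)]
  have eb : ℓ = b ^2 := by rw [hb, Real.sq_sqrt (by linarith)]
  have ew : b = w ^2 := by rw [hw, Real.sq_sqrt (by linarith)]
  have ez : (n : ℝ) = z ^2 := by rw [hz, Real.sq_sqrt (by linarith)]
  have a1 :1 ≤ a := by rw [ha]; exact Real.one_le_sqrt.2 d1
  have w1 :1 ≤ w := by rw [hw]; exact Real.one_le_sqrt.2 b1
  have a0 :0 < a := by linarith
  have b0 :0 < b := by linarith
  have w0 :0 < w := by linarith
  have wb : w ≤ b := by rw [ew]; exact le_self_pow₀ w1 two_ne_zero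
  have az : a ≤ z := by rw [ha, hz]; exact Real.sqrt_le_sqrt dn
  rw [← hz] at S S' ⊢
  have z1 :1 ≤ z := a1.trans az
  have u0 :0 < u := by linarith
  set q := ℓ ^2 / z with hq
  have q0 :0 < q := by positivity
  have q1 : q ≤1 := by
    rw [hq, div_le_one (by linarith)]
    refine le_trans ?_ S
    exact le_mul_of_one_le_left (by positivity) (by linarith)
  have v0 :0 ≤ u ^5 / d ^3 := by positivity
  set y := 2 * u +28 * ℓ +4 * (w * a) with hy
  have y0 :0 < y := by positivity
  have hyr :2 * (u +14 * ℓ) ≤ y := by rw [hy]; linarith [mul_pos w0 a0]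
  have hwa : (4 * (w * a)) ^4 =256 * (ℓ * d ^2) := by rw [eb, ew, ea]; ring
  have hy4 :96 * ℓ * d ^2 ≤ y ^4 := by
    have :4 * (w * a) ≤ y := by rw [hy]; linarith
    calc 96 * ℓ * d ^2 ≤256 * (ℓ * d ^2) := by linarith [show 0 ≤ ℓ * d ^2 by positivity]
      _ = (4 * (w * a)) ^4 := hwa.symm
      _ ≤ _ := by gcongr
  have wD0 : Win m d u D0 := ⟨h0, hs, fun i => (h1 i).trans u1⟩
  have hsum : ∑ i, |(D i : ℝ) - D0 i| ≤ n * (2 * u) := by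
    have : ∀ i ∈ (univ : Finset (Fin n)), |(D i : ℝ) - D0 i| ≤2 * u := fun i _ => by
      have := abs_sub_le (D i : ℝ) d (D0 i)
      rw [abs_sub_comm d] at this
      linarith [hD.2.2 i, h1 i]
    have := sum_le_card_nsmul _ _ _ this
    simpa using this
  obtain ⟨hpos, B, B0, htele, hnB⟩ : (∀ D : Fin n → ℤ, Win m d u D → 0 < NN D) ∧ ∃ B : ℝ, 0 ≤ B ∧
    (∀ D D' : Fin n → ℤ, Win m d u D → Win m d u D' → |Tl n d D - Tl n d D'| ≤ (∑ i, |(D i : ℝ) - D' i|) * B) ∧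
    2 * u * (n * B) ≤20 * K * (q + u ^5 / d ^3) := by
    rcases le_or_gt ℓ d with hd | hd
    · have ab : b ≤ a := by rw [ha, hb]; exact Real.sqrt_le_sqrt hd
      have wa : w * a ≤ d := by rw [ea, sq]; exact mR (wb.trans ab) a0.le
      obtain ⟨p, B, B0, t, c⟩ := h.cost (L := 45) (r := u) (y := y) (.inl ⟨hd, rfl⟩) hyr hy4 y0 (by linarith)
      refine ⟨p, B, B0, t, ?_⟩
      have c1 : y ^4 ≤5 *45 ^4 * (u ^4 + ℓ ^4 + ℓ * d ^2) := by
        have := pow4_three (2 * u) (28 * ℓ) (4 * (w * a))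
        rw [hwa, mul_pow, mul_pow] at this
        linarith [show 0 ≤ u ^4 by positivity, show 0 ≤ ℓ ^4 by positivity, show 0 ≤ ℓ * d ^2 by positivity]
      have t1 : u ^5 / d ^2 / n ≤ u ^5 / d ^3 := by
        rw [div_div]; gcongr
        calc d ^3 = d ^2 * d := by ring
          _ ≤ _ := by gcongr
      have t2 : u * ℓ ^4 / d ^2 / n ≤ q := by
        calc u * ℓ ^4 / d ^2 / n ≤ d ^2 * ℓ ^4 / d ^2 / n := by
              gcongr; exact ud.trans (le_self_pow₀ d1 two_ne_zero)
          _ = q * q := by rw [hq, ez]; field_simp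
          _ ≤ q *1 := by gcongr
          _ = q := mul_one _
      have t3 : u * ℓ / n ≤ q + u ^5 / d ^3 := by
        rcases le_or_gt (ℓ * d ^2) (u ^4) with hc | hc
        · have : u * ℓ / n ≤ u ^5 / d ^2 / n := by
            gcongr
            rw [le_div_iff₀ (by positivity)]
            calc u * ℓ * d ^2 = u * (ℓ * d ^2) := by ring
              _ ≤ u * u ^4 := by gcongr
              _ = u ^5 := by ring
          linarith
        · have hua : u ≤ ℓ * a := by
            refine (pow_le_pow_iff_left₀ u0.le (by positivity) (show 4 ≠ 0 by norm_num)).1 (hc.le.trans ?_)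
            calc ℓ * d ^2 ≤ ℓ ^4 * d ^2 := by gcongr; exact le_self_pow₀ l1 (by norm_num)
              _ = _ := by rw [ea]; ring
          have : u * ℓ / n ≤ q := by
            calc u * ℓ / n ≤ (ℓ * z) * ℓ / n := by gcongr; exact hua.trans (by gcongr)
              _ = q := by rw [hq, ez]; field_simp
          linarith
      calc 2 * u * (n * B) ≤2 * u * (4 * C0 *45 ^ c0 * (5 *45 ^4 * (u ^4 + ℓ ^4 + ℓ * d ^2)) / (n * d ^2)) := by
            gcongr; exact c.trans (by gcongr)
        _ =10 * K * (u ^5 / d ^2 / n + u * ℓ ^4 / d ^2 / n + u * ℓ / n) := by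
            rw [K1e]; field_simp; ring
        _ ≤10 * K * (u ^5 / d ^3 + q + (q + u ^5 / d ^3)) := by gcongr
        _ = _ := by ring
    · have ab : a ≤ b := by rw [ha, hb]; exact Real.sqrt_le_sqrt hd.le
      have wa : w * a ≤ ℓ := by rw [eb, sq]; exact mul_le_mul wb ab a0.le b0.le
      have hyL : y ≤45 * ℓ := by linarith
      obtain ⟨p, B, B0, t, c⟩ := h.cost (L := 45 * ℓ) (r := u) (y := y) (.inr ⟨hd, rfl⟩) hyr hy4 y0
        (hyL.trans (le_mul_of_one_le_right (by linarith) d1))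
      refine ⟨p, B, B0, t, ?_⟩
      have c2 : n * B ≤ K * ℓ ^ (c0 +4) / n := c.trans (by
        calc 4 * C0 * (45 * ℓ) ^ c0 * y ^4 / (n * d ^2) ≤4 * C0 * (45 * ℓ) ^ c0 * (45 * ℓ) ^4 / (n *1 ^2) := by
              gcongr
          _ = _ := by
              rw [K1e, mul_pow, mul_pow]; field_simp; ring)
      calc 2 * u * (n * B) ≤2 * ℓ * (K * ℓ ^ (c0 +4) / n) := by gcongr; linarith
        _ =2 * (K * ℓ ^ (c0 +5) / z / z) := by rw [ez]; field_simp; ring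
        _ ≤2 * (z / z / z) := by
          gcongr
          have :0 ≤ K * ℓ ^ (c0 +5) := by positivity
          linarith
        _ =2 * (1 / z) := by field_simp
        _ ≤2 * q := by
          rw [hq]; gcongr
          exact one_le_pow₀ l1
        _ ≤ (20 * K) * q := by gcongr; linarith
        _ ≤ _ := by gcongr; linarith
  refine ⟨hpos D hD, (htele D D0 hD wD0).trans ?_⟩
  calc _ ≤ n * (2 * u) * B := by gcongr
    _ =2 * u * (n * B) := by ring
    _ ≤ _ := hnB
end Big

namespace Big
variable {C0 : ℝ} {c0 n m : ℕ} {d ℓ : ℝ}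

lemma fin (h : Big C0 c0 n m d ℓ) {u : ℝ} (u1 :1 ≤ u) (ud : u ≤ d) {D : Fin n → ℕ}
    (hs : ∑ i, D i =2 * m) (hD : ∀ i, |(D i : ℝ) - d| ≤ u)
    (hsm :20 * (4 * C0 *45 ^ (c0 +4)) * (ℓ ^2 / Real.sqrt n + u ^5 / d ^3) ≤1) :
    ∃ E : ℝ, |E| ≤1300 * (4 * C0 *45 ^ (c0 +4)) * (ℓ ^2 / Real.sqrt n + u ^5 / d ^3) ∧
      prG n m D = prB n m D * Real.exp (1 /4 - X2 n d (fun i => (D i : ℤ)) ^2 /4) * (1 + E) := by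
  have d1 := h.d1; have hC := h.hC
  have hW : Win m d u (fun i => (D i : ℤ)) :=
    ⟨fun i => by positivity, by show ∑ i, (D i : ℤ) =2 * m; exact_mod_cast hs, fun i => by simpa using hD i⟩
  obtain ⟨D0, p1, p2, p3⟩ := h.nearreg
  have hw := h.window p1 p2 p3
  obtain ⟨np, st⟩ := h.star u1 ud p1 p2 p3 hW
  obtain ⟨c1, c2⟩ := h.bas.cpos
  have v0 :0 ≤ u ^5 / d ^3 := by positivity
  have hn := h.hn
  have hcB : (#(univ : Finset (Fin n × Fin (n -1)))).choose (2 * m) = (n * (n -1)).choose (2 * m) := by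
    rw [card_grid]
  rw [hcB] at hw c1
  set cB : ℝ := ((n * (n -1)).choose (2 * m) : ℝ)
  set cG : ℝ := ((#(Om n)).choose m : ℝ)
  set K := 4 * C0 * (45 : ℝ) ^ (c0 +4)
  set q := ℓ ^2 / Real.sqrt n
  set DZ : Fin n → ℤ := fun i => (D i : ℤ)
  set ψ := Tl n d DZ - Tl n d D0
  set T0 := Real.exp (Tl n d D0 -1 /4) * cB / cG with hT0
  have T00 :0 ≤ T0 := by positivity
  have q0 :0 ≤ q := by positivity
  have K0 :0 ≤ K := by positivity
  have hw2 : T0 ≤2 := by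
    have S := h.sq_facts (j := 2) (by omega)
    have sp :0 < Real.sqrt n := Real.sqrt_pos.2 (by linarith [h.nr])
    have :1000000 * K * q ≤1 := by
      rw [show 1000000 * K * q =1000000 * K * ℓ ^2 / Real.sqrt n from (mul_div_assoc _ _ _).symm, div_le_one sp]
      exact S
    linarith [(abs_le.1 hw).2, mul_nonneg K0 q0]
  refine ⟨Real.exp (Tl n d DZ -1 /4) * cB / cG -1, ?_, ?_⟩
  · have e : Real.exp (Tl n d DZ -1 /4) * cB / cG -1 = T0 * (Real.exp ψ -1) + (T0 -1) := by
      have : Real.exp (Tl n d DZ -1 /4) = Real.exp (Tl n d D0 -1 /4) * Real.exp ψ := by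
        rw [← Real.exp_add]; congr 1; ring
      rw [hT0, this]; ring
    rw [e]
    have h2 := Real.abs_exp_sub_one_le (st.trans hsm)
    calc |T0 * (Real.exp ψ -1) + (T0 -1)| ≤ T0 * |Real.exp ψ -1| + |T0 -1| := by
          refine (abs_add_le _ _).trans ?_
          rw [abs_mul, abs_of_nonneg T00]
      _ ≤2 * (2 * (20 * K * (q + u ^5 / d ^3))) +1220 * K * q := by
          gcongr
          exact h2.trans (by gcongr)
      _ ≤ _ := by linarith [mul_nonneg K0 v0, mul_nonneg K0 q0]
  · have hG : prG n m D = (NN DZ : ℝ) / cG := by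
      have g1 : (Graphs n).filter (fun E => E.card = m ∧ ∀ i, deg E i = D i) =
          (powersetCard m (Om n)).filter (fun E => ∀ i, deg E i = D i) := by
        rw [← Graphs_m, filter_filter]
      rw [prG, g1, Graphs_m, card_powersetCard, NN_nat hs]
    have hp : ∀ i, 0 < ((n -1).choose (D i) : ℝ) := fun i => by
      have a := h.bas.hp
      have b := (abs_le.1 (hD i)).2
      have : (D i : ℝ) ≤ ((n -1 : ℕ) : ℝ) := by linarith
      exact_mod_cast Nat.choose_pos (mod_cast this)
    have hB : prB n m D = Real.exp (lH n d DZ + X2 n d DZ ^2 /4) / cB := by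
      have e : lH n d DZ + X2 n d DZ ^2 /4 = ∑ i, Real.log ((n -1).choose (D i)) := by
        rw [lH]; simp [DZ]
      rw [prB, if_pos hs, e, Real.exp_sum]
      congr 1
      exact prod_congr rfl fun i _ => (Real.exp_log (hp i)).symm
    have hN : (NN DZ : ℝ) = Real.exp (lH n d DZ + Tl n d DZ) := by
      rw [Tl, add_sub_cancel, Real.exp_log (mod_cast np)]
    have e3 : Real.exp (lH n d DZ + Tl n d DZ) = Real.exp (lH n d DZ + X2 n d DZ ^2 /4) *
        Real.exp (1 /4 - X2 n d DZ ^2 /4) * Real.exp (Tl n d DZ -1 /4) := by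
      rw [← Real.exp_add, ← Real.exp_add]; congr 1; ring
    rw [hG, hB, hN, e3]
    field_simp
    ring
end Big

theorem binomial_approximation_conjecture_wide :
    ∃ μ₀ : ℝ, 0 < μ₀ ∧
      ∀ α : ℝ, 1 / 2 ≤ α → α < 3 / 5 →
        ∃ A : ℝ, 0 < A ∧
          ∀ K : ℝ, 0 < K →
            ∃ n₀ : ℕ, ∀ n : ℕ, n₀ ≤ n → ∀ m : ℕ,
              let d : ℝ := 2 * (m : ℝ) / (n : ℝ)
              let μ : ℝ := d / ((n : ℝ) - 1)
              Real.log n ^ K / n ≤ μ → μ ≤ μ₀ →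
              ∀ D : Fin n → ℕ, (∑ i, D i) = 2 * m →
                (∀ i, |(D i : ℝ) - d| ≤ d ^ α) →
                let γ₂ : ℝ := (∑ i, ((D i : ℝ) - d) ^ 2) / ((n : ℝ) - 1) ^ 2
                ∃ E : ℝ,
                  |E| ≤ A * ((Real.log n) ^ 2 / Real.sqrt n + d ^ (5 * α - 3)) ∧
                  prG n m D = prB n m D *
                    Real.exp (1 / 4 - γ₂ ^ 2 / (4 * μ ^ 2 * (1 - μ) ^ 2)) * (1 + E) := by
  obtain ⟨C0, c0, hC, htele⟩ := tele
  set K1 : ℝ := 4 * C0 *45 ^ (c0 +4) with hK1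
  have K1p :0 < K1 := by positivity
  refine ⟨1 / (1000 * C0 *45 ^ (c0 +4)), by positivity, fun α hα1 hα2 => ⟨1300 * K1, by positivity, fun K hK => ?_⟩⟩
  obtain ⟨X0, hX0⟩ := Filter.eventually_atTop.1 ((tendsto_rpow_neg_atTop (show 0 <3 -5 * α by linarith)).eventually
    (ge_mem_nhds (show (0 : ℝ) <1 / (40 * K1) by positivity)))
  have L := Real.tendsto_log_atTop.comp (tendsto_natCast_atTop_atTop (R := ℝ))
  have E1 := L.eventually_ge_atTop 1
  have E2 := ((tendsto_rpow_atTop hK).comp L).eventually_ge_atTop (2 * max X0 1)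
  have E3 := tendsto_natCast_atTop_atTop.eventually ((Real.isLittleO_pow_log_id_atTop (n := 2 * (c0 +6))).bound
    (show 0 < (1 / (1000000 * K1)) ^2 by positivity))
  obtain ⟨n₀, hn₀⟩ := Filter.eventually_atTop.1 (((E1.and E2).and E3).and (Filter.eventually_ge_atTop 4))
  refine ⟨n₀, ?_⟩
  intro n hn m d μ hlo hhi D hs hD γ₂
  obtain ⟨⟨⟨l1, l2⟩, l3⟩, n4⟩ := hn₀ n hn
  simp only [Function.comp_apply] at l1 l2
  have nr : (4 : ℝ) ≤ n := mod_cast n4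
  have n1 :0 < (n : ℝ) -1 := by linarith
  have hdX : max X0 1 ≤ d := by
    have a1 : d = μ * (n -1) := by simp only [μ]; field_simp
    have a2 :2 * max X0 1 / n * (n -1) ≤ μ * (n -1) := by
      gcongr
      exact le_trans (by gcongr) hlo
    have a3 : max X0 1 ≤2 * max X0 1 / n * (n -1) := by
      have :0 ≤ max X0 1 := zero_le_one.trans (le_max_right _ _)
      rw [div_mul_eq_mul_div, le_div_iff₀ (by linarith)]
      nlinarith
    linarith
  have d1 :1 ≤ d := (le_max_right _ _).trans hdX
  have hlg :1000000 * K1 * Real.log n ^ (c0 +6) ≤ Real.sqrt n := by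
    refine Real.le_sqrt_of_sq_le ?_
    rw [Real.norm_of_nonneg (by positivity), id, Real.norm_of_nonneg (by positivity)] at l3
    calc (1000000 * K1 * Real.log n ^ (c0 +6)) ^2 = (1000000 * K1) ^2 * Real.log n ^ (2 * (c0 +6)) := by ring
      _ ≤ (1000000 * K1) ^2 * ((1 / (1000000 * K1)) ^2 * n) := by gcongr
      _ = n := by field_simp
  have B : Big C0 c0 n m d (Real.log n) :=
    ⟨hC, htele, n4, rfl, l1, hlg, by simp only [d]; field_simp, d1, hhi⟩
  have hv : d ^ (5 * α -3) = (d ^ α) ^5 / d ^3 := by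
    rw [Real.rpow_sub (by linarith), mul_comm, Real.rpow_mul (by linarith)]
    norm_cast
  have hsm :20 * K1 * (Real.log n ^2 / Real.sqrt n + (d ^ α) ^5 / d ^3) ≤1 := by
    have b1 : d ^ (5 * α -3) ≤1 / (40 * K1) := by
      have := hX0 d ((le_max_left _ _).trans hdX)
      rwa [neg_sub] at this
    rw [← hv]
    have S := B.sq_facts (j := 2) (by omega)
    have sp :0 < Real.sqrt n := Real.sqrt_pos.2 (by linarith)
    have b2 : Real.log n ^2 / Real.sqrt n ≤1 / (40 * K1) := by
      rw [div_le_div_iff₀ sp (by positivity)]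
      have :0 ≤ K1 * Real.log n ^2 := by positivity
      linarith
    calc 20 * K1 * (Real.log n ^2 / Real.sqrt n + d ^ (5 * α -3)) ≤20 * K1 * (1 / (40 * K1) +1 / (40 * K1)) := by gcongr
      _ =1 := by field_simp; norm_num
  obtain ⟨E, hE, hpr⟩ := B.fin (u := d ^ α) (Real.one_le_rpow d1 (by linarith))
    (by simpa using Real.rpow_le_rpow_of_exponent_le d1 (show α ≤1 by linarith)) hs hD hsm
  refine ⟨E, by rw [hv]; exact hE, ?_⟩
  have hX : γ₂ ^2 / (4 * μ ^2 * (1 - μ) ^2) = X2 n d (fun i => (D i : ℤ)) ^2 /4 := by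
    have m1 :1 - μ ≠ 0 := by
      have := B.bas.hp
      rw [B.bas.νr] at this
      have : μ ≤1 /2 := by simp only [μ]; rw [div_le_iff₀ n1]; linarith
      linarith
    have eμ : d / ((n : ℝ) -1) = μ := rfl
    have ed : d = μ * (n -1) := by simp only [μ]; field_simp
    have m0 : μ ≠ 0 := by intro h0; rw [h0] at ed; linarith
    have eγ : γ₂ = (∑ i, ((D i : ℝ) - d) ^2) / ((n : ℝ) -1) ^2 := rfl
    rw [X2, eμ, eγ]
    simp only [Int.cast_natCast]
    generalize ∑ i, ((D i : ℝ) - d) ^2 = S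
    rw [ed]
    field_simp
  rw [hX]; exact hpr
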